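/- For every ε > 0 there exists n₀ such that for all n ≥ n₀: every odd natural number N with (N : ℝ) ≥ (3+ε)·p_n belongs to S_{n+1}. -/

import Mathlib

open Filter Pointwise

/-- `nthPrime n` is the `n`-th prime number (1-indexed): `nthPrime 1 = 2`, etc. -/
noncomputable def nthPrime (n : ℕ) : ℕ := Nat.nth Nat.Prime (n - 1)

/-- `S n` is the additive submonoid of `ℕ` generated by the primes `q ≥ nthPrime n`. -/
def S (n : ℕ) : AddSubmonoid ℕ :=
  AddSubmonoid.closure {q : ℕ | q.Prime ∧ nthPrime n ≤ q}

/-- `frob n` is the Frobenius number of `S n`: the largest natural number not in `S n`. -/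
noncomputable def frob (n : ℕ) : ℕ := sSup {m : ℕ | m ∉ S n}

/-- `genus n` is the number of natural numbers not in `S n`. -/
noncomputable def genus (n : ℕ) : ℕ := {m : ℕ | m ∉ S n}.ncard

/-- `atoms n` is the minimal generating set `S n \ {0} \ ((S n \ {0}) + (S n \ {0}))`. -/
def atoms (n : ℕ) : Set ℕ :=
  ((S n : Set ℕ) \ {0}) \ (((S n : Set ℕ) \ {0}) + ((S n : Set ℕ) \ {0}))

/-- `u n` is the largest atom of `S n`. -/
noncomputable def u (n : ℕ) : ℕ := sSup (atoms n)

/-- `e n` is the embedding dimension of `S n`: the number of atoms. -/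
noncomputable def e (n : ℕ) : ℕ := (atoms n).ncard

namespace Ternary

/-- The additive character `x ↦ exp (2 * π * i * x)` of `ℝ`. -/
noncomputable def ee (x : ℝ) : ℂ := Complex.exp (2 * Real.pi * x * Complex.I)

/-- The distance from `x` to the nearest integer. -/
noncomputable def nd (x : ℝ) : ℝ := |x - round x|

/-- The exponential sum `∑ a n e(n x)` over `n ≤ N`. -/
noncomputable def expSum (a : ℕ → ℂ) (N : ℕ) (x : ℝ) : ℂ :=
  ∑ n ∈ Finset.range (N + 1), a n * ee (n * x)

lemma ee_add (x y : ℝ) : ee (x + y) = ee x * ee y := by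
  simp only [ee, ← Complex.exp_add]; push_cast; ring_nf

lemma ee_zero : ee 0 = 1 := by simp [ee]

lemma norm_ee (x : ℝ) : ‖ee x‖ = 1 := by
  rw [ee, show (2 * Real.pi * x * Complex.I : ℂ) = ((2 * Real.pi * x : ℝ) : ℂ) * Complex.I by
    push_cast; ring]
  exact Complex.norm_exp_ofReal_mul_I _

lemma ee_int (k : ℤ) : ee k = 1 := by
  rw [ee, Complex.exp_eq_one_iff]; exact ⟨k, by push_cast; ring⟩

lemma ee_add_int (x : ℝ) (k : ℤ) : ee (x + k) = ee x := by rw [ee_add, ee_int, mul_one]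

lemma ee_neg (x : ℝ) : ee (-x) = (starRingEnd ℂ) (ee x) := by
  simp only [ee, ← Complex.exp_conj]; congr 1
  simp [Complex.conj_ofNat]

lemma ee_natMul (n : ℕ) (x : ℝ) : ee (n * x) = ee x ^ n := by
  rw [ee, ee, ← Complex.exp_nat_mul]; congr 1; push_cast; ring

lemma nd_nonneg (x : ℝ) : 0 ≤ nd x := abs_nonneg _

lemma nd_le (x : ℝ) (k : ℤ) : nd x ≤ |x - k| := round_le x k

lemma nd_le_abs (x : ℝ) : nd x ≤ |x| := by simpa using nd_le x 0

lemma nd_add_int (x : ℝ) (k : ℤ) : nd (x + k) = nd x := by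
  unfold nd; rw [round_add_intCast]; congr 1; push_cast; ring

lemma nd_neg (x : ℝ) : nd (-x) = nd x := by
  apply le_antisymm
  · have := nd_le (-x) (-round x)
    rwa [Int.cast_neg, show -x - -(round x : ℝ) = -(x - round x) by ring, abs_neg] at this
  · have := nd_le x (-round (-x))
    rwa [Int.cast_neg, show x - -(round (-x) : ℝ) = -(-x - round (-x)) by ring, abs_neg] at this

lemma nd_add_le (x y : ℝ) : nd (x + y) ≤ nd x + nd y := by
  have := nd_le (x + y) (round x + round y)
  refine this.trans ?_
  rw [show x + y - ((round x + round y : ℤ) : ℝ) = (x - round x) + (y - round y) by push_cast; ring]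
  exact abs_add_le _ _

lemma nd_sub_le (x y : ℝ) : nd (x - y) ≤ nd x + nd y := by
  have := nd_add_le x (-y); rwa [nd_neg, ← sub_eq_add_neg] at this

lemma nd_eq_abs {x : ℝ} (h : |x| ≤ 1 / 2) : nd x = |x| := by
  apply le_antisymm (nd_le_abs x)
  unfold nd
  rcases eq_or_ne (round x) 0 with h0 | h0
  · simp [h0]
  · have h1 : (1 : ℝ) ≤ |(round x : ℝ)| := by exact_mod_cast Int.one_le_abs h0
    have h2 : |(round x : ℝ)| ≤ |x - round x| + |x| := by
      have := abs_sub_abs_le_abs_sub (round x : ℝ) x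
      rw [abs_sub_comm] at this; linarith
    linarith

lemma nd_natMul_le (n : ℕ) (x : ℝ) : nd (n * x) ≤ n * nd x := by
  have := nd_le (n * x) (n * round x)
  refine this.trans (le_of_eq ?_)
  rw [nd, show (n * x - ((n * round x : ℤ) : ℝ)) = n * (x - round x) by push_cast; ring, abs_mul,
    abs_of_nonneg (by positivity : (0:ℝ) ≤ n)]

/-- `‖e(x) - 1‖ ≥ 4‖x‖`. -/
lemma four_nd_le (x : ℝ) : 4 * nd x ≤ ‖ee x - 1‖ := by
  set t := x - round x with ht
  have h1 : ee x = ee t := by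
    have := ee_add_int t (round x); rw [← this]; congr 1; simp [ht]
  have habs : |t| ≤ 1 / 2 := abs_sub_round x
  have h2 : ‖ee t - 1‖ = 2 * |Real.sin (Real.pi * t)| := by
    have : ee t - 1 = ee (t/2) * (2 * Complex.I * Complex.sin (Real.pi * t)) := by
      rw [Complex.sin]
      have e1 : ee t = ee (t/2) * ee (t/2) := by rw [← ee_add]; ring_nf
      have e2 : Complex.exp (Real.pi * t * Complex.I) = ee (t/2) := by
        rw [ee]; congr 1; push_cast; ring
      have e3 : ee (t/2) * Complex.exp (-(Real.pi * t) * Complex.I) = 1 := by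
        rw [ee, ← Complex.exp_add, Complex.exp_eq_one_iff]; exact ⟨0, by push_cast; ring⟩
      rw [e2, e1]
      linear_combination e3 - ee (t/2) * (Complex.exp (-(Real.pi * t) * Complex.I) - ee (t/2)) * Complex.I_sq
    rw [this, norm_mul, norm_ee, one_mul, norm_mul, norm_mul]
    simp only [Complex.norm_I, mul_one, Complex.norm_ofNat]
    rw [← Complex.ofReal_mul, ← Complex.ofReal_sin, Complex.norm_real, Real.norm_eq_abs]
  rw [h1, h2]
  have h3 : 2 / Real.pi * |Real.pi * t| ≤ |Real.sin (Real.pi * t)| := by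
    apply Real.mul_abs_le_abs_sin
    rw [abs_mul, abs_of_pos Real.pi_pos]
    nlinarith [Real.pi_pos]
  rw [abs_mul, abs_of_pos Real.pi_pos] at h3
  have h4 : 2 / Real.pi * (Real.pi * |t|) = 2 * |t| := by field_simp
  rw [h4] at h3
  change 4 * |t| ≤ _
  linarith

/-- Geometric sums. -/
lemma norm_geom_le (M : ℕ) (x : ℝ) (hx : 0 < nd x) :
    ‖∑ n ∈ Finset.range M, ee (n * x)‖ ≤ 1 / (2 * nd x) := by
  have h4 := four_nd_le x
  have hne : ee x ≠ 1 := by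
    intro h; rw [h] at h4; simp at h4; linarith
  simp_rw [ee_natMul]
  rw [geom_sum_eq hne, norm_div]
  have hn : ‖ee x ^ M - 1‖ ≤ 2 := by
    refine (norm_sub_le _ _).trans ?_
    rw [norm_pow, norm_ee]; norm_num
  calc ‖ee x ^ M - 1‖ / ‖ee x - 1‖ ≤ 2 / (4 * nd x) := by gcongr
    _ = 1 / (2 * nd x) := by field_simp; norm_num

/-- `∑ 1/z²` over the integers. -/
noncomputable def zetaZ : ℝ := ∑' z : ℤ, 1 / (z : ℝ) ^ 2

lemma sum_inv_sq_le (Z : Finset ℤ) : ∑ z ∈ Z, 1 / (z : ℝ) ^ 2 ≤ zetaZ :=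
  (Real.summable_one_div_int_pow.2 (by norm_num)).sum_le_tsum _ (fun z _ => by positivity)

lemma zetaZ_nonneg : 0 ≤ zetaZ := by simpa using sum_inv_sq_le ∅

lemma sum_inv_nd_sq_le {ι : Type*} (s : Finset ι) (x : ι → ℝ) (y δ : ℝ) (hδ : 0 < δ)
    (hy : ∀ j ∈ s, δ ≤ nd (y - x j))
    (hs : ∀ i ∈ s, ∀ j ∈ s, i ≠ j → δ ≤ nd (x i - x j)) :
    ∑ j ∈ s, 1 / nd (y - x j) ^ 2 ≤ 4 / δ ^ 2 * zetaZ := by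
  classical
  set t : ι → ℝ := fun j => (y - x j) - round (y - x j) with ht
  set z : ι → ℤ := fun j => ⌊t j / δ⌋ with hz
  have hinj : Set.InjOn z s := by
    intro i hi j hj hij
    by_contra hne
    have h1 := hs i hi j hj hne
    have h2 : nd (x i - x j) ≤ |t j - t i| := by
      have := nd_le (x i - x j) (round (y - x j) - round (y - x i))
      refine this.trans (le_of_eq ?_)
      congr 1; simp only [ht]; push_cast; ring
    have h3 : |t j / δ - t i / δ| < 1 := by
      apply Int.abs_sub_lt_one_of_floor_eq_floor; exact hij.symm
    rw [← sub_div, abs_div, abs_of_pos hδ, div_lt_one hδ] at h3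
    linarith
  have hterm : ∀ j ∈ s, 1 / nd (y - x j) ^ 2 ≤ 4 / δ ^ 2 * (1 / (z j : ℝ) ^ 2) := by
    intro j hj
    have h1 : δ ≤ |t j| := hy j hj
    have hfl : (z j : ℝ) ≤ t j / δ := Int.floor_le _
    have hfl2 : t j / δ < z j + 1 := Int.lt_floor_add_one _
    rw [le_div_iff₀ hδ] at hfl
    rw [div_lt_iff₀ hδ] at hfl2
    have hz0 : z j ≠ 0 := by
      intro h0; rw [h0] at hfl hfl2; push_cast at hfl hfl2
      rw [abs_of_nonneg (by linarith)] at h1; linarith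
    have key : |(z j : ℝ)| * δ ≤ 2 * |t j| := by
      rcases lt_or_gt_of_ne hz0 with h | h
      · have h' : (z j : ℝ) ≤ -1 := by exact_mod_cast Int.le_sub_one_of_lt h
        rw [abs_of_neg (by linarith : (z j : ℝ) < 0)]
        have : t j < 0 := by nlinarith
        rw [abs_of_neg this] at h1 ⊢
        nlinarith
      · have h' : (1 : ℝ) ≤ z j := by exact_mod_cast h
        have : 0 < t j := by nlinarith
        rw [abs_of_pos (by linarith : (0:ℝ) < z j), abs_of_pos this]
        nlinarith
    have hp : 0 < |(z j : ℝ)| := by positivity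
    have e1 : (z j : ℝ) ^ 2 = |(z j : ℝ)| ^ 2 := (sq_abs _).symm
    change 1 / |t j| ^ 2 ≤ _
    rw [e1, div_mul_div_comm, mul_one, div_le_div_iff₀ (by nlinarith [pow_pos (hδ.trans_le h1) 2]) (by positivity)]
    nlinarith [mul_pos hp hδ]
  calc ∑ j ∈ s, 1 / nd (y - x j) ^ 2 ≤ ∑ j ∈ s, 4 / δ ^ 2 * (1 / (z j : ℝ) ^ 2) :=
        Finset.sum_le_sum hterm
    _ = 4 / δ ^ 2 * ∑ w ∈ s.image z, 1 / (w : ℝ) ^ 2 := by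
        rw [Finset.sum_image hinj, Finset.mul_sum]
    _ ≤ _ := by gcongr; exact sum_inv_sq_le _

/-- The kernel `∑ e(u * θ)` over `u < 2 * H`. -/
noncomputable def geomKer (H : ℕ) (x : ℝ) : ℂ := ∑ u ∈ Finset.range (2 * H), ee (u * x)

lemma geomKer_row {ι : Type*} (s : Finset ι) (x : ι → ℝ) (δ : ℝ) (hδ : 0 < δ)
    (hs : ∀ i ∈ s, ∀ j ∈ s, i ≠ j → δ ≤ nd (x i - x j)) (H : ℕ) (i : ι) (hi : i ∈ s) :
    ∑ j ∈ s, ‖geomKer H (x i - x j)‖ ^ 2 ≤ 4 * (H : ℝ) ^ 2 + zetaZ / δ ^ 2 := by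
  classical
  rw [← Finset.add_sum_erase _ _ hi]
  have h0 : ‖geomKer H (x i - x i)‖ ^ 2 = 4 * (H : ℝ) ^ 2 := by
    simp [geomKer, ee_zero]; ring
  rw [h0]
  gcongr
  have h1 := sum_inv_nd_sq_le (s.erase i) x (x i) δ hδ
    (fun j hj => hs i hi j (Finset.mem_of_mem_erase hj) (Finset.ne_of_mem_erase hj).symm)
    (fun a ha b hb hab => hs a (Finset.mem_of_mem_erase ha) b (Finset.mem_of_mem_erase hb) hab)
  have h2 : ∀ j ∈ s.erase i, ‖geomKer H (x i - x j)‖ ^ 2 ≤ 1 / 4 * (1 / nd (x i - x j) ^ 2) := by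
    intro j hj
    have hp : 0 < nd (x i - x j) :=
      hδ.trans_le (hs i hi j (Finset.mem_of_mem_erase hj) (Finset.ne_of_mem_erase hj).symm)
    calc ‖geomKer H (x i - x j)‖ ^ 2 ≤ (1 / (2 * nd (x i - x j))) ^ 2 := by
          gcongr; exact norm_geom_le _ _ hp
      _ = _ := by field_simp; norm_num
  calc _ ≤ ∑ j ∈ s.erase i, 1 / 4 * (1 / nd (x i - x j) ^ 2) := Finset.sum_le_sum h2
    _ ≤ 1 / 4 * (4 / δ ^ 2 * zetaZ) := by rw [← Finset.mul_sum]; gcongr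
    _ = _ := by ring

/-- Dual form of the large sieve inequality. -/
lemma largeSieve_dual {ι : Type*} (s : Finset ι) (x : ι → ℝ) (δ : ℝ) (hδ : 0 < δ)
    (hs : ∀ i ∈ s, ∀ j ∈ s, i ≠ j → δ ≤ nd (x i - x j)) (N : ℕ) (c : ι → ℂ) :
    (N + 1) * ∑ n ∈ Finset.range (N + 1), ‖∑ i ∈ s, c i * ee (n * x i)‖ ^ 2 ≤
      (4 * ((N : ℝ) + 1) ^ 2 + zetaZ / δ ^ 2) * ∑ i ∈ s, ‖c i‖ ^ 2 := by
  classical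
  set H := N + 1 with hH
  set f : ℤ → ℝ := fun k => ‖∑ i ∈ s, c i * ee (k * x i)‖ ^ 2 with hf
  set R := Finset.range (2 * H) with hR
  have step1 : (N + 1 : ℝ) * ∑ n ∈ Finset.range H, f n ≤ ∑ u ∈ R, ∑ v ∈ R, f ((u : ℤ) - v) := by
    have : ∀ v ∈ Finset.range H, ∑ n ∈ Finset.range H, f n ≤ ∑ u ∈ R, f ((u : ℤ) - v) := by
      intro v hv
      have e : ∑ n ∈ Finset.range H, f n
          = ∑ u ∈ (Finset.range H).image (fun n => n + v), f ((u : ℤ) - v) := by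
        rw [Finset.sum_image (by intro a _ b _ h; simpa using h)]
        simp
      rw [e]
      apply Finset.sum_le_sum_of_subset_of_nonneg
      · intro u hu
        simp only [Finset.mem_image, Finset.mem_range, hR] at hu hv ⊢
        obtain ⟨n, hn, rfl⟩ := hu; omega
      · intros; simp only [hf]; positivity
    rw [Finset.sum_comm]
    calc (N + 1 : ℝ) * ∑ n ∈ Finset.range H, f n
        = ∑ v ∈ Finset.range H, ∑ n ∈ Finset.range H, f n := by
          rw [Finset.sum_const, Finset.card_range, nsmul_eq_mul, hH]; push_cast; ring
      _ ≤ ∑ v ∈ Finset.range H, ∑ u ∈ R, f ((u : ℤ) - v) := Finset.sum_le_sum this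
      _ ≤ _ := by
          apply Finset.sum_le_sum_of_subset_of_nonneg
          · intro u hu
            simp only [Finset.mem_range, hR] at hu ⊢; omega
          · intros; apply Finset.sum_nonneg; intros; simp only [hf]; positivity
  have step2 : ((∑ u ∈ R, ∑ v ∈ R, f ((u : ℤ) - v) : ℝ) : ℂ) =
      ∑ i ∈ s, ∑ j ∈ s, c i * (starRingEnd ℂ) (c j) * ((‖geomKer H (x i - x j)‖ ^ 2 : ℝ) : ℂ) := by
    have e1 : ∀ u v : ℕ, ((f ((u : ℤ) - v) : ℝ) : ℂ) = ∑ i ∈ s, ∑ j ∈ s,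
        c i * (starRingEnd ℂ) (c j) * (ee (u * (x i - x j)) * (starRingEnd ℂ) (ee (v * (x i - x j)))) := by
      intro u v
      simp only [hf]
      rw [Complex.ofReal_pow, ← Complex.mul_conj', map_sum, Finset.sum_mul_sum]
      refine Finset.sum_congr rfl fun i _ => Finset.sum_congr rfl fun j _ => ?_
      rw [map_mul, ← ee_neg, ← ee_neg, ← ee_add]
      have : ee ((((u : ℤ) - v : ℤ) : ℝ) * x i) * ee (-((((u : ℤ) - v : ℤ) : ℝ) * x j)) =
          ee (u * (x i - x j) + -(v * (x i - x j))) := by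
        rw [← ee_add]; congr 1; push_cast; ring
      rw [← this]; ring
    push_cast
    simp_rw [e1]
    have e2 : ∀ u ∈ R, ∑ v ∈ R, ∑ i ∈ s, ∑ j ∈ s,
        c i * (starRingEnd ℂ) (c j) * (ee (u * (x i - x j)) * (starRingEnd ℂ) (ee (v * (x i - x j))))
        = ∑ i ∈ s, ∑ j ∈ s, ∑ v ∈ R, c i * (starRingEnd ℂ) (c j) *
          (ee (u * (x i - x j)) * (starRingEnd ℂ) (ee (v * (x i - x j)))) := by
      intro u _
      rw [Finset.sum_comm]
      refine Finset.sum_congr rfl fun i _ => ?_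
      rw [Finset.sum_comm]
    rw [Finset.sum_congr rfl e2, Finset.sum_comm]
    refine Finset.sum_congr rfl fun i _ => ?_
    rw [Finset.sum_comm]
    refine Finset.sum_congr rfl fun j _ => ?_
    simp_rw [← Finset.mul_sum]
    congr 1
    rw [← Complex.mul_conj', geomKer, map_sum, Finset.sum_mul]
  have hsymm : ∀ i j, ‖geomKer H (x j - x i)‖ = ‖geomKer H (x i - x j)‖ := by
    intro i j
    have : geomKer H (x j - x i) = (starRingEnd ℂ) (geomKer H (x i - x j)) := by
      simp only [geomKer, map_sum, ← ee_neg]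
      refine Finset.sum_congr rfl fun u _ => ?_
      congr 1; ring
    rw [this, Complex.norm_conj]
  have hrow := geomKer_row s x δ hδ hs H
  have step3 : ∑ u ∈ R, ∑ v ∈ R, f ((u : ℤ) - v) ≤
      (4 * (H : ℝ) ^ 2 + zetaZ / δ ^ 2) * ∑ i ∈ s, ‖c i‖ ^ 2 := by
    have h1 : ∑ u ∈ R, ∑ v ∈ R, f ((u : ℤ) - v) ≤ ‖((∑ u ∈ R, ∑ v ∈ R, f ((u : ℤ) - v) : ℝ) : ℂ)‖ := by
      rw [Complex.norm_real]; exact Real.le_norm_self _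
    refine h1.trans ?_
    rw [step2]
    calc _ ≤ ∑ i ∈ s, ∑ j ∈ s, ‖c i‖ * ‖c j‖ * ‖geomKer H (x i - x j)‖ ^ 2 := by
          refine (norm_sum_le _ _).trans (Finset.sum_le_sum fun i _ => ?_)
          refine (norm_sum_le _ _).trans (Finset.sum_le_sum fun j _ => ?_)
          rw [norm_mul, norm_mul, Complex.norm_conj, Complex.norm_real, norm_pow, norm_norm]
      _ ≤ ∑ i ∈ s, ∑ j ∈ s, (1 / 2 * (‖c i‖ ^ 2 * ‖geomKer H (x i - x j)‖ ^ 2) +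
            1 / 2 * (‖c j‖ ^ 2 * ‖geomKer H (x j - x i)‖ ^ 2)) := by
          refine Finset.sum_le_sum fun i _ => Finset.sum_le_sum fun j _ => ?_
          rw [hsymm i j]
          nlinarith [mul_nonneg (sq_nonneg (‖c i‖ - ‖c j‖)) (sq_nonneg ‖geomKer H (x i - x j)‖)]
      _ = ∑ i ∈ s, ‖c i‖ ^ 2 * ∑ j ∈ s, ‖geomKer H (x i - x j)‖ ^ 2 := by
          simp_rw [Finset.sum_add_distrib]
          rw [Finset.sum_comm (f := fun i j => 1 / 2 * (‖c j‖ ^ 2 * ‖geomKer H (x j - x i)‖ ^ 2))]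
          rw [← Finset.sum_add_distrib]
          refine Finset.sum_congr rfl fun i _ => ?_
          rw [← Finset.sum_add_distrib, Finset.mul_sum]
          refine Finset.sum_congr rfl fun j _ => ?_
          ring
      _ ≤ ∑ i ∈ s, ‖c i‖ ^ 2 * (4 * (H : ℝ) ^ 2 + zetaZ / δ ^ 2) := by
          refine Finset.sum_le_sum fun i hi => ?_
          gcongr; exact hrow i hi
      _ = _ := by rw [← Finset.sum_mul, mul_comm]
  have := step1.trans step3
  simp only [hf] at this
  push_cast [hH] at this ⊢
  exact this

/-- The large sieve inequality for well-spaced points. -/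
lemma largeSieve {ι : Type*} (s : Finset ι) (x : ι → ℝ) (δ : ℝ) (hδ : 0 < δ)
    (hs : ∀ i ∈ s, ∀ j ∈ s, i ≠ j → δ ≤ nd (x i - x j)) (N : ℕ) (a : ℕ → ℂ) :
    (N + 1) * ∑ i ∈ s, ‖expSum a N (x i)‖ ^ 2 ≤
      (4 * ((N : ℝ) + 1) ^ 2 + zetaZ / δ ^ 2) * ∑ n ∈ Finset.range (N + 1), ‖a n‖ ^ 2 := by
  set c : ι → ℂ := fun i => (starRingEnd ℂ) (expSum a N (x i)) with hc
  set X := ∑ i ∈ s, ‖expSum a N (x i)‖ ^ 2 with hX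
  have hdual := largeSieve_dual s x δ hδ hs N c
  set Y := ∑ n ∈ Finset.range (N + 1), ‖∑ i ∈ s, c i * ee (n * x i)‖ ^ 2 with hY
  set A := ∑ n ∈ Finset.range (N + 1), ‖a n‖ ^ 2 with hA
  have hcX : ∑ i ∈ s, ‖c i‖ ^ 2 = X := by simp [hc, hX]
  rw [hcX] at hdual
  have h1 : (X : ℂ) = ∑ n ∈ Finset.range (N + 1), a n * ∑ i ∈ s, c i * ee (n * x i) := by
    simp_rw [Finset.mul_sum]
    rw [Finset.sum_comm, hX]; push_cast
    refine Finset.sum_congr rfl fun i _ => ?_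
    rw [← Complex.mul_conj', expSum, Finset.sum_mul]
    refine Finset.sum_congr rfl fun n _ => ?_
    simp only [hc, expSum]; ring
  have hX0 : 0 ≤ X := Finset.sum_nonneg fun _ _ => by positivity
  have h2 : X ≤ ∑ n ∈ Finset.range (N + 1), ‖a n‖ * ‖∑ i ∈ s, c i * ee (n * x i)‖ := by
    have : X = ‖(X : ℂ)‖ := by rw [Complex.norm_real, Real.norm_of_nonneg hX0]
    rw [this, h1]
    refine (norm_sum_le _ _).trans (le_of_eq ?_)
    simp_rw [norm_mul]
  have h3 : X ^ 2 ≤ A * Y := (pow_le_pow_left₀ hX0 h2 2).trans (Finset.sum_mul_sq_le_sq_mul_sq _ _ _)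
  rcases hX0.eq_or_lt with h | h
  · rw [← h]; simp
    have := zetaZ_nonneg
    positivity
  · have hA0 : 0 ≤ A := Finset.sum_nonneg fun _ _ => by positivity
    have : (N + 1) * X * X ≤ (4 * ((N : ℝ) + 1) ^ 2 + zetaZ / δ ^ 2) * A * X := by
      calc (N + 1) * X * X = (N + 1) * X ^ 2 := by ring
        _ ≤ (N + 1) * (A * Y) := by gcongr
        _ = A * ((N + 1) * Y) := by ring
        _ ≤ A * ((4 * ((N : ℝ) + 1) ^ 2 + zetaZ / δ ^ 2) * X) := by gcongr
        _ = _ := by ring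
    exact le_of_mul_le_mul_right this h

lemma sum_nthRoots (k : ℕ) (hk : 0 < k) :
    ∑ z ∈ Polynomial.nthRootsFinset k (1 : ℂ), z = if k = 1 then 1 else 0 := by
  split_ifs with h
  · subst h
    have : Polynomial.nthRootsFinset 1 (1 : ℂ) = {1} := by
      ext z; simp [Polynomial.mem_nthRootsFinset]
    simp [this]
  · have hz := Complex.isPrimitiveRoot_exp k hk.ne'
    set ζ := Complex.exp (2 * Real.pi * Complex.I / k) with hζ
    have hz0 : ζ ≠ 0 := Complex.exp_ne_zero _
    have h1 : ∑ z ∈ Polynomial.nthRootsFinset k (1 : ℂ), z =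
        ∑ z ∈ Polynomial.nthRootsFinset k (1 : ℂ), ζ * z := by
      symm
      refine Finset.sum_equiv (Equiv.mulLeft₀ ζ hz0) ?_ ?_
      · intro i
        simp [Polynomial.mem_nthRootsFinset hk, mul_pow, hz.pow_eq_one]
      · intros; rfl
    rw [← Finset.mul_sum] at h1
    have h2 : ζ ≠ 1 := hz.ne_one (by omega)
    have h3 : (ζ - 1) * ∑ z ∈ Polynomial.nthRootsFinset k (1 : ℂ), z = 0 := by
      linear_combination -h1
    exact (mul_eq_zero.1 h3).resolve_left (sub_ne_zero.2 h2)

lemma sum_primitiveRoots (k : ℕ) (hk : 0 < k) :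
    ∑ z ∈ primitiveRoots k ℂ, z = (ArithmeticFunction.moebius k : ℂ) := by
  classical
  have h : ∀ n > 0, ∑ i ∈ n.divisors, (∑ z ∈ primitiveRoots i ℂ, z) =
      (fun n : ℕ => if n = 1 then (1 : ℂ) else 0) n := by
    intro n hn
    beta_reduce
    rw [← sum_nthRoots n hn, IsPrimitiveRoot.nthRoots_one_eq_biUnion_primitiveRoots,
      Finset.sum_biUnion]
    intro a _ b _ hab
    exact IsPrimitiveRoot.disjoint hab
  rw [← (ArithmeticFunction.sum_eq_iff_sum_mul_moebius_eq.1 h) k hk,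
    Finset.sum_eq_single (k, 1)]
  · simp
  · rintro ⟨a, b⟩ hab hne
    have : b ≠ 1 := by
      rintro rfl; apply hne; simp at hab; simp [hab.1]
    simp [this]
  · intro hh; simp [hk.ne'] at hh

/-- The reduced residues below `k`. -/
def redRes (k : ℕ) : Finset ℕ := (Finset.range k).filter k.Coprime

lemma card_redRes (k : ℕ) : (redRes k).card = k.totient := rfl

lemma ramanujan (k n : ℕ) (hk : 0 < k) (hn : n.Coprime k) :
    ∑ b ∈ redRes k, ee (n * (b / k)) = (ArithmeticFunction.moebius k : ℂ) := by
  rw [← sum_primitiveRoots k hk]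
  have hz : IsPrimitiveRoot (ee (n / k)) k := by
    have := Complex.isPrimitiveRoot_exp_of_isCoprime n k hk.ne' (by exact_mod_cast hn.isCoprime)
    convert this using 1
    rw [ee]; congr 1; push_cast; ring
  refine Finset.sum_bij (fun b _ => ee (n / k) ^ b) ?_ ?_ ?_ ?_
  · intro b hb
    rw [mem_primitiveRoots hk]
    exact hz.pow_of_coprime b (Finset.mem_filter.1 hb).2.symm
  · intro a ha b hb h
    exact hz.pow_inj (Finset.mem_range.1 (Finset.mem_filter.1 ha).1)
      (Finset.mem_range.1 (Finset.mem_filter.1 hb).1) h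
  · intro z hz'
    have : NeZero k := ⟨hk.ne'⟩
    obtain ⟨i, hi, hc, rfl⟩ := (hz.isPrimitiveRoot_iff).1
      ((mem_primitiveRoots hk).1 hz')
    exact ⟨i, Finset.mem_filter.2 ⟨Finset.mem_range.2 hi, hc.symm⟩, rfl⟩
  · intro b _
    rw [← ee_natMul]; congr 1; ring

lemma sq_norm_expSum_le (a : ℕ → ℂ) (N k : ℕ) (hk : Squarefree k)
    (ha : ∀ n, a n ≠ 0 → n.Coprime k) (x : ℝ) :
    1 / (k.totient : ℝ) * ‖expSum a N x‖ ^ 2 ≤ ∑ b ∈ redRes k, ‖expSum a N (x + b / k)‖ ^ 2 := by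
  have hk0 : 0 < k := Nat.pos_of_ne_zero hk.ne_zero
  have h1 : ∑ b ∈ redRes k, expSum a N (x + b / k) =
      (ArithmeticFunction.moebius k : ℂ) * expSum a N x := by
    simp only [expSum]
    rw [Finset.sum_comm, Finset.mul_sum]
    refine Finset.sum_congr rfl fun n _ => ?_
    by_cases h : a n = 0
    · simp [h]
    · rw [← ramanujan k n hk0 (ha n h), Finset.sum_mul]
      refine Finset.sum_congr rfl fun b _ => ?_
      rw [mul_add, ee_add]; ring
  have h2 : ‖(ArithmeticFunction.moebius k : ℂ)‖ = 1 := by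
    rcases ArithmeticFunction.moebius_eq_or k with h | h | h
    · exact absurd h (ArithmeticFunction.moebius_ne_zero_iff_squarefree.2 hk)
    · simp [h]
    · simp [h]
  have h3 : ‖expSum a N x‖ ≤ ∑ b ∈ redRes k, 1 * ‖expSum a N (x + b / k)‖ := by
    have : ‖expSum a N x‖ = ‖∑ b ∈ redRes k, expSum a N (x + b / k)‖ := by
      rw [h1, norm_mul, h2, one_mul]
    rw [this]; simpa using norm_sum_le _ _
  have h4 := (pow_le_pow_left₀ (norm_nonneg _) h3 2).trans (Finset.sum_mul_sq_le_sq_mul_sq _ _ _)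
  simp only [one_pow, Finset.sum_const, card_redRes, nsmul_eq_mul, mul_one] at h4
  have : (0 : ℝ) < k.totient := by exact_mod_cast Nat.totient_pos.2 hk0
  rw [one_div, inv_mul_le_iff₀ this]
  exact h4

/-- Removing finitely many primes from a divisor-closed family of squarefree moduli. -/
lemma sum_inv_totient_coprime (F : Finset ℕ) (hsq : ∀ k ∈ F, Squarefree k)
    (hdiv : ∀ k ∈ F, ∀ d, d ∣ k → d ∈ F) (P : Finset ℕ) (hP : ∀ p ∈ P, p.Prime) :
    (∏ p ∈ P, (1 - 1 / (p : ℝ))) * ∑ k ∈ F, 1 / (k.totient : ℝ) ≤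
      ∑ k ∈ F with ∀ p ∈ P, ¬ p ∣ k, 1 / (k.totient : ℝ) := by
  classical
  induction P using Finset.induction_on with
  | empty => simp
  | insert p P hp ih =>
    have ih' := ih (fun q hq => hP q (Finset.mem_insert_of_mem hq))
    have hpp := hP p (Finset.mem_insert_self _ _)
    have hp2 : (2 : ℝ) ≤ p := by exact_mod_cast hpp.two_le
    rw [Finset.prod_insert hp]
    set G := F.filter (fun k => ∀ q ∈ P, ¬ q ∣ k) with hG
    have e1 : F.filter (fun k => ∀ q ∈ insert p P, ¬ q ∣ k) = G.filter (fun k => ¬ p ∣ k) := by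
      ext k; simp [hG]; tauto
    rw [e1]
    have key : ∑ k ∈ G, 1 / (k.totient : ℝ) ≤
        (p / (p - 1) : ℝ) * ∑ k ∈ G with ¬ p ∣ k, 1 / (k.totient : ℝ) := by
      rw [← Finset.sum_filter_add_sum_filter_not G (fun k => p ∣ k)]
      have h1 : ∑ k ∈ G with p ∣ k, 1 / (k.totient : ℝ) ≤
          1 / (p - 1 : ℝ) * ∑ k ∈ G with ¬ p ∣ k, 1 / (k.totient : ℝ) := by
        rw [Finset.mul_sum]
        have hk' : ∀ k ∈ G.filter (fun k => p ∣ k), ∃ m, k = p * m ∧ ¬ p ∣ m := by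
          intro k hk
          obtain ⟨hkG, m, rfl⟩ := Finset.mem_filter.1 hk
          refine ⟨m, rfl, fun hd => ?_⟩
          have hs := hsq _ (Finset.mem_filter.1 hkG).1
          exact hpp.one_lt.ne' (Nat.isUnit_iff.1 (hs p (mul_dvd_mul_left p hd)))
        calc ∑ k ∈ G with p ∣ k, 1 / (k.totient : ℝ)
            = ∑ k ∈ G with p ∣ k, 1 / (p - 1 : ℝ) * (1 / ((k / p).totient : ℝ)) := by
              refine Finset.sum_congr rfl fun k hk => ?_
              obtain ⟨m, rfl, hm⟩ := hk' k hk
              rw [Nat.mul_div_cancel_left _ hpp.pos, Nat.totient_mul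
                ((Nat.Prime.coprime_iff_not_dvd hpp).2 hm), Nat.totient_prime hpp]
              rw [Nat.cast_mul, Nat.cast_sub hpp.one_le]; push_cast
              rw [one_div_mul_one_div]
          _ = ∑ m ∈ (G.filter (fun k => p ∣ k)).image (fun k => k / p),
                1 / (p - 1 : ℝ) * (1 / (m.totient : ℝ)) := by
              rw [Finset.sum_image]
              intro a ha b hb hab
              simp only [Finset.coe_filter, Set.mem_ofPred_eq] at ha hb
              rw [← Nat.mul_div_cancel' ha.2, ← Nat.mul_div_cancel' hb.2]
              simp only at hab; rw [hab]
          _ ≤ _ := by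
              apply Finset.sum_le_sum_of_subset_of_nonneg
              · intro m hm
                obtain ⟨k, hk, rfl⟩ := Finset.mem_image.1 hm
                obtain ⟨m, rfl, hpm⟩ := hk' k hk
                rw [Nat.mul_div_cancel_left _ hpp.pos]
                have hkG := (Finset.mem_filter.1 (Finset.mem_filter.1 hk).1)
                refine Finset.mem_filter.2 ⟨Finset.mem_filter.2 ⟨hdiv _ hkG.1 _ (dvd_mul_left _ _), ?_⟩, hpm⟩
                intro q hq hd
                exact hkG.2 q hq (hd.mul_left p)
              · intros
                have : (0:ℝ) < p - 1 := by linarith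
                positivity
      have e2 : (p / (p - 1) : ℝ) = 1 / (p - 1) + 1 := by
        field_simp [show (p - 1 : ℝ) ≠ 0 by linarith]; ring
      rw [e2, add_mul, one_mul]
      gcongr
    have hpos : (0:ℝ) < 1 - 1 / p := by
      rw [sub_pos, div_lt_one (by linarith)]; linarith
    calc _ = (1 - 1 / (p:ℝ)) * ((∏ q ∈ P, (1 - 1 / (q : ℝ))) * ∑ k ∈ F, 1 / (k.totient : ℝ)) := by ring
      _ ≤ (1 - 1 / (p:ℝ)) * ∑ k ∈ G, 1 / (k.totient : ℝ) := by gcongr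
      _ ≤ (1 - 1 / (p:ℝ)) * ((p / (p - 1) : ℝ) * ∑ k ∈ G with ¬ p ∣ k, 1 / (k.totient : ℝ)) := by gcongr
      _ = _ := by
        rw [← mul_assoc]
        have : (1 - 1 / (p:ℝ)) * (p / (p - 1) : ℝ) = 1 := by
          field_simp [show (p - 1 : ℝ) ≠ 0 by linarith]
        rw [this, one_mul]

/-- Any finite set of primes is large enough that `∏ (1 - 1/p)⁻¹` grows slower than a
small power of its cardinality. -/
lemma exists_prod_primes_le : ∃ C : ℝ, 1 ≤ C ∧ ∀ P : Finset ℕ, (∀ p ∈ P, p.Prime) →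
    1 ≤ C * ((P.card : ℝ) + 1) * (∏ p ∈ P, (1 - 1 / (p : ℝ))) ^ 10 := by
  have hpi : ∃ m0 : ℕ, 2 ≤ m0 ∧ ∀ m ≥ m0, (20 * m).primeCounting < m := by
    have h := Chebyshev.eventually_primeCounting_le (ε := 1) one_pos
    have h' : ∀ᶠ x : ℝ in atTop, (Real.log 4 + 1) * 20 < Real.log x :=
      Real.tendsto_log_atTop.eventually_gt_atTop _
    have h2 : Tendsto (fun m : ℕ => (20 * m : ℝ)) atTop atTop :=
      tendsto_natCast_atTop_atTop.const_mul_atTop (by norm_num)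
    obtain ⟨m0, hm0⟩ := eventually_atTop.1 (h2.eventually (h.and h'))
    refine ⟨m0 + 2, by omega, fun m hm => ?_⟩
    obtain ⟨h3, h4⟩ := hm0 m (by omega)
    have hm1 : (0 : ℝ) < m := by exact_mod_cast (by omega : 0 < m)
    have hl4 : 0 < Real.log 4 := Real.log_pos (by norm_num)
    have e : ⌊(20 * m : ℝ)⌋₊ = 20 * m := by
      have : (20 * m : ℝ) = ((20 * m : ℕ) : ℝ) := by push_cast; ring
      rw [this, Nat.floor_natCast]
    rw [e] at h3
    have hlp : 0 < Real.log (20 * m) := by linarith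
    have : ((20 * m).primeCounting : ℝ) < m := by
      refine h3.trans_lt ?_
      rw [div_lt_iff₀ hlp]
      nlinarith
    exact_mod_cast this
  obtain ⟨m0, hm01, hm0⟩ := hpi
  refine ⟨(2 ^ 10) ^ m0, one_le_pow₀ (by norm_num), ?_⟩
  intro P
  induction hc : P.card generalizing P with
  | zero =>
    intro _
    rw [Finset.card_eq_zero.1 hc]; simp
    exact_mod_cast Nat.one_le_pow _ _ (by norm_num)
  | succ n ih =>
    intro hP
    have hhalf : ∀ p ∈ P, (1 / 2 : ℝ) ≤ 1 - 1 / p := by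
      intro p hp
      have hp2 : (2 : ℝ) ≤ p := by exact_mod_cast (hP p hp).two_le
      have : 1 / (p : ℝ) ≤ 1 / 2 := by gcongr
      linarith
    by_cases hn : n + 1 < m0 + 1
    · have h1 : (1 / 2 : ℝ) ^ m0 ≤ ∏ p ∈ P, (1 - 1 / (p : ℝ)) := by
        calc (1 / 2 : ℝ) ^ m0 ≤ (1 / 2 : ℝ) ^ P.card :=
              pow_le_pow_of_le_one (by norm_num) (by norm_num) (by omega)
          _ = ∏ p ∈ P, (1 / 2 : ℝ) := by rw [Finset.prod_const]
          _ ≤ _ := Finset.prod_le_prod (fun _ _ => by norm_num) hhalf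
      calc (1:ℝ) = (2 ^ 10) ^ m0 * 1 * ((1 / 2 : ℝ) ^ m0) ^ 10 := by
            rw [← pow_mul, ← pow_mul, mul_one, mul_comm m0 10, ← mul_pow]; norm_num
        _ ≤ _ := by
            gcongr
            · push_cast; linarith [n.cast_nonneg (α := ℝ)]
    · have hne : P.Nonempty := Finset.card_pos.1 (by omega)
      set p := P.max' hne with hp
      have hpP : p ∈ P := P.max'_mem hne
      have hbig : 20 * n < p := by
        by_contra hle
        have hsub : P ⊆ (Finset.range (20 * (n + 1) + 1)).filter Nat.Prime := by
          intro q hq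
          refine Finset.mem_filter.2 ⟨Finset.mem_range.2 ?_, hP q hq⟩
          have := P.le_max' q hq
          omega
        have h1 := Finset.card_le_card hsub
        have h2 := hm0 (n + 1) (by omega)
        rw [Nat.primeCounting, Nat.primeCounting', Nat.count_eq_card_filter_range] at h2
        have h3 := h1.trans_lt (by convert h2)
        omega
      have hih := ih (P.erase p) (by rw [Finset.card_erase_of_mem hpP]; omega)
        (fun q hq => hP q (Finset.mem_of_mem_erase hq))
      rw [← Finset.mul_prod_erase _ _ hpP]
      set X := ∏ q ∈ P.erase p, (1 - 1 / (q : ℝ)) with hX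
      have hn1 : (2:ℝ) ≤ n := by exact_mod_cast (by omega : 2 ≤ n)
      have hpn : (20 * n + 1 : ℝ) ≤ p := by exact_mod_cast hbig
      have hfac : ((n : ℝ) + 1) ≤ ((n + 1 : ℕ) + 1 : ℝ) * (1 - 1 / (p : ℝ)) ^ 10 := by
        have hb : 1 + (10 : ℕ) * (-(1 / (p : ℝ))) ≤ (1 + -(1 / (p : ℝ))) ^ 10 :=
          one_add_mul_le_pow (by
            have : 1 / (p:ℝ) ≤ 1 := by rw [div_le_one (by linarith)]; linarith
            linarith) 10
        have h1p : 1 / (p : ℝ) ≤ 1 / (20 * n) := by gcongr; linarith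
        have h2p : 1 / (20 * (n:ℝ)) * (n + 2) ≤ 1 / 10 := by
          rw [div_mul_eq_mul_div, div_le_div_iff₀ (by positivity) (by norm_num)]; nlinarith
        rw [← sub_eq_add_neg] at hb
        push_cast at hb ⊢
        have : (n + 1 + 1 : ℝ) * (1 + 10 * -(1 / (p:ℝ))) ≤ (n + 1 + 1) * (1 - 1 / (p : ℝ)) ^ 10 := by gcongr
        have h3p : 1 / (p:ℝ) * (n + 2) ≤ 1 / (20 * (n:ℝ)) * (n + 2) := by gcongr
        nlinarith
      calc (1 : ℝ) ≤ (2 ^ 10) ^ m0 * ((n : ℝ) + 1) * X ^ 10 := hih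
        _ ≤ (2 ^ 10) ^ m0 * (((n + 1 : ℕ) + 1 : ℝ) * (1 - 1 / (p : ℝ)) ^ 10) * X ^ 10 := by
            have : 0 ≤ X ^ 10 := Even.pow_nonneg (by decide) _
            gcongr
        _ = _ := by ring

lemma exists_int_of_nd_lt (q : ℚ) (d : ℕ) (hd : q.den ∣ d) (hd0 : 0 < d) (h : nd (q : ℝ) < 1 / d) :
    ∃ z : ℤ, q = z := by
  refine ⟨round (q : ℝ), ?_⟩
  obtain ⟨m, rfl⟩ := hd
  have hden : (0:ℝ) < q.den := by exact_mod_cast q.den_pos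
  have hm : 0 < m := Nat.pos_of_mul_pos_left hd0
  have hm' : (1:ℝ) ≤ m := by exact_mod_cast hm
  have h1 : |((q.num - round (q : ℝ) * q.den : ℤ) : ℝ)| < 1 := by
    have e : ((q.num - round (q : ℝ) * q.den : ℤ) : ℝ) = ((q : ℝ) - round (q : ℝ)) * q.den := by
      push_cast
      rw [sub_mul]; congr 1
      have : (q : ℝ) = q.num / q.den := by exact_mod_cast (Rat.num_div_den q).symm
      rw [this]; field_simp
    rw [e, abs_mul, abs_of_pos hden]
    change nd (q : ℝ) * _ < 1
    rw [lt_div_iff₀ (by positivity)] at h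
    push_cast at h
    have := nd_nonneg (q : ℝ)
    nlinarith [mul_nonneg this hden.le]
  have h2 : q.num - round (q : ℝ) * q.den = 0 := by
    rw [← Int.abs_lt_one_iff]; exact_mod_cast h1
  have : (q.num : ℚ) = round (q : ℝ) * q.den := by exact_mod_cast sub_eq_zero.1 h2
  conv_lhs => rw [← Rat.num_div_den q]
  rw [this]; field_simp

lemma den_redRes {k b : ℕ} (hb : b ∈ redRes k) : ((b : ℚ) / k).den = k := by
  obtain ⟨h1, h2⟩ := Finset.mem_filter.1 hb
  have hk : 0 < k := by have := Finset.mem_range.1 h1; omega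
  have := Rat.den_div_eq_of_coprime (a := b) (b := k) (by exact_mod_cast hk)
    (by simpa using h2.symm)
  simp only [Int.cast_natCast] at this
  exact Int.natCast_inj.1 this

lemma redRes_inj {k b k' b' : ℕ} (hb : b ∈ redRes k) (hb' : b' ∈ redRes k') (z : ℤ)
    (h : (b : ℚ) / k - b' / k' = z) : k = k' ∧ b = b' := by
  have h1 := Finset.mem_range.1 (Finset.mem_filter.1 hb).1
  have h1' := Finset.mem_range.1 (Finset.mem_filter.1 hb').1
  have hk : (0:ℚ) < k := by exact_mod_cast (by omega : 0 < k)
  have hk' : (0:ℚ) < k' := by exact_mod_cast (by omega : 0 < k')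
  have l1 : (b : ℚ) / k < 1 := by rw [div_lt_one hk]; exact_mod_cast h1
  have l1' : (b' : ℚ) / k' < 1 := by rw [div_lt_one hk']; exact_mod_cast h1'
  have l2 : (0:ℚ) ≤ (b : ℚ) / k := by positivity
  have l2' : (0:ℚ) ≤ (b' : ℚ) / k' := by positivity
  have hz : z = 0 := by
    rw [← Int.abs_lt_one_iff, abs_lt]
    constructor
    · have : (-1 : ℚ) < z := by linarith
      exact_mod_cast this
    · have : (z : ℚ) < 1 := by linarith
      exact_mod_cast this
  have heq : (b : ℚ) / k = b' / k' := by rw [hz] at h; push_cast at h; linarith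
  have hkk : k = k' := by rw [← den_redRes hb, ← den_redRes hb', heq]
  subst hkk
  refine ⟨rfl, ?_⟩
  rw [div_left_inj' hk.ne'] at heq
  exact_mod_cast heq

/-- Large values estimate for exponential sums supported on integers coprime to the moduli in a
divisor-closed family. -/
lemma exists_largeValues : ∃ C : ℝ, 0 < C ∧ ∀ (ι : Type) (s : Finset ι) (x : ι → ℝ) (N K : ℕ),
    1 ≤ N → K ^ 4 ≤ N → (∀ i ∈ s, ∀ j ∈ s, i ≠ j → 1 / (N : ℝ) ≤ nd (x i - x j)) →
    ∀ F : Finset ℕ, (∀ k ∈ F, Squarefree k) → (∀ k ∈ F, ∀ d, d ∣ k → d ∈ F) → (∀ k ∈ F, k ≤ K) →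
    ∀ a : ℕ → ℂ, (∀ n, a n ≠ 0 → ∀ k ∈ F, n.Coprime k) →
    (∑ i ∈ s, ‖expSum a N (x i)‖ ^ 2) * ∑ k ∈ F, 1 / (k.totient : ℝ) ≤
      C * (s.card : ℝ) ^ (1 / 5 : ℝ) * N * ∑ n ∈ Finset.range (N + 1), ‖a n‖ ^ 2 := by
  classical
  obtain ⟨C1, hC1, hprod⟩ := exists_prod_primes_le
  have hz0 := zetaZ_nonneg
  refine ⟨(2 * C1) ^ (1 / 10 : ℝ) * (8 + 4 * zetaZ), by positivity, ?_⟩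
  intro ι s x N K hN hK hs F hsq hdiv hFK a ha
  rcases s.eq_empty_or_nonempty with rfl | hne
  · simp
  have hR : (1 : ℝ) ≤ s.card := by exact_mod_cast hne.card_pos
  have hN' : (1 : ℝ) ≤ N := by exact_mod_cast hN
  set δ : ℝ := 1 / (2 * N) with hδ
  have hδ0 : 0 < δ := by positivity
  -- the primes to be avoided
  set bad : ι × ι → ℚ → Prop := fun r q =>
    1 < q.den ∧ q.den ≤ K ^ 2 ∧ nd (x r.1 - x r.2 - q) < δ with hbad
  set f : ι × ι → ℕ := fun r => if h : ∃ q, bad r q then (h.choose).den.minFac else 2 with hf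
  set P := (s ×ˢ s).image f with hP
  have hPp : ∀ p ∈ P, p.Prime := by
    intro p hp
    obtain ⟨r, _, rfl⟩ := Finset.mem_image.1 hp
    simp only [hf]
    split_ifs with h
    · exact Nat.minFac_prime (h.choose_spec.1.ne')
    · exact Nat.prime_two
  have hPc : (P.card : ℝ) ≤ (s.card : ℝ) ^ 2 := by
    have : P.card ≤ s.card ^ 2 := by
      refine Finset.card_image_le.trans ?_
      rw [Finset.card_product, sq]
    exact_mod_cast this
  set G := F.filter (fun k => ∀ p ∈ P, ¬ p ∣ k) with hG
  have hbad_dvd : ∀ i ∈ s, ∀ j ∈ s, ∀ q, bad (i, j) q → f (i, j) ∣ q.den := by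
    intro i hi j hj q hq
    have hex : ∃ q, bad (i, j) q := ⟨q, hq⟩
    have hfe : f (i, j) = (hex.choose).den.minFac := by simp only [hf]; rw [dif_pos hex]
    rw [hfe]
    have hq' := hex.choose_spec
    set q' := hex.choose with hq'e
    have hlt : nd ((q - q' : ℚ) : ℝ) < 1 / N := by
      have := nd_sub_le (x i - x j - q') (x i - x j - q)
      have e : x i - x j - (q' : ℝ) - (x i - x j - q) = ((q - q' : ℚ) : ℝ) := by push_cast; ring
      rw [e] at this
      have e2 : δ + δ = 1 / N := by rw [hδ]; field_simp; norm_num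
      have h1 := hq'.2.2
      have h2 := hq.2.2
      simp only at h1 h2
      linarith
    have hdpos : 0 < q.den * q'.den := Nat.mul_pos q.den_pos q'.den_pos
    have hle : (1 : ℝ) / N ≤ 1 / ((q.den * q'.den : ℕ) : ℝ) := by
      apply one_div_le_one_div_of_le (by exact_mod_cast hdpos)
      have : q.den * q'.den ≤ N := (Nat.mul_le_mul hq.2.1 hq'.2.1).trans (by rw [← pow_add]; exact hK)
      exact_mod_cast this
    obtain ⟨z, hz⟩ := exists_int_of_nd_lt _ _ (Rat.sub_den_dvd q q') hdpos (hlt.trans_le hle)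
    have : q = q' + z := by linarith
    rw [this, Rat.add_intCast_den]
    exact Nat.minFac_dvd _
  set T := s ×ˢ G.sigma redRes with hT
  set y : ι × (Σ _ : ℕ, ℕ) → ℝ := fun t => x t.1 + t.2.2 / t.2.1 with hy
  have hTs : ∀ t ∈ T, ∀ t' ∈ T, t ≠ t' → δ ≤ nd (y t - y t') := by
    rintro ⟨i, k, b⟩ ht ⟨j, k', b'⟩ ht' hne
    simp only [hT, Finset.mem_product, Finset.mem_sigma] at ht ht'
    obtain ⟨hi, hk, hb⟩ := ht
    obtain ⟨hj, hk', hb'⟩ := ht'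
    set q : ℚ := b' / k' - b / k with hq
    have hqden : q.den ∣ k' * k := by
      have := Rat.sub_den_dvd ((b' : ℚ) / k') ((b : ℚ) / k)
      rwa [den_redRes hb, den_redRes hb'] at this
    have hkF := (Finset.mem_filter.1 hk)
    have hkF' := (Finset.mem_filter.1 hk')
    have hk0 : 0 < k := Nat.pos_of_ne_zero (hsq k hkF.1).ne_zero
    have hk0' : 0 < k' := Nat.pos_of_ne_zero (hsq k' hkF'.1).ne_zero
    have hkk : k' * k ≤ K ^ 2 := by rw [sq]; exact Nat.mul_le_mul (hFK _ hkF'.1) (hFK _ hkF.1)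
    have e : y (i, ⟨k, b⟩) - y (j, ⟨k', b'⟩) = x i - x j - q := by
      simp only [hy, hq]; push_cast; ring
    rw [e]
    by_contra hlt
    push Not at hlt
    by_cases hij : i = j
    · subst hij
      have h1 : nd (q : ℝ) < 1 / ((k' * k : ℕ) : ℝ) := by
        have : x i - x i - (q : ℝ) = -q := by ring
        rw [this, nd_neg] at hlt
        refine hlt.trans_le ?_
        apply one_div_le_one_div_of_le (by exact_mod_cast Nat.mul_pos hk0' hk0)
        have h2 : K ^ 2 ≤ N := by
          refine le_trans ?_ hK
          rcases K.eq_zero_or_pos with h | h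
          · simp [h]
          · exact Nat.pow_le_pow_right h (by norm_num)
        have : ((k' * k : ℕ) : ℝ) ≤ N := by exact_mod_cast hkk.trans h2
        linarith
      obtain ⟨z, hz⟩ := exists_int_of_nd_lt _ _ hqden (Nat.mul_pos hk0' hk0) h1
      obtain ⟨rfl, rfl⟩ := redRes_inj hb' hb z hz
      exact hne rfl
    · rcases (Nat.succ_le_of_lt q.den_pos).eq_or_lt with h | h
      · have hqz : q = q.num := (Rat.coe_int_num_of_den_eq_one h.symm).symm
        have h1 := hs i hi j hj hij
        have : nd (x i - x j - q) = nd (x i - x j) := by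
          rw [hqz]
          have := nd_add_int (x i - x j) (-q.num)
          rw [← this]; congr 1; push_cast; ring
        rw [this] at hlt
        have : δ ≤ 1 / N := by
          rw [hδ]; gcongr; linarith
        linarith
      · have hb : bad (i, j) q := ⟨h, (Nat.le_of_dvd (Nat.mul_pos hk0' hk0) hqden).trans hkk, hlt⟩
        have hfP : f (i, j) ∈ P := Finset.mem_image_of_mem _ (Finset.mem_product.2 ⟨hi, hj⟩)
        have hd := (hbad_dvd i hi j hj q hb).trans hqden
        rcases (hPp _ hfP).dvd_mul.1 hd with h | h
        · exact hkF'.2 _ hfP h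
        · exact hkF.2 _ hfP h
  have hls := largeSieve T y δ hδ0 hTs N a
  set A := ∑ n ∈ Finset.range (N + 1), ‖a n‖ ^ 2 with hA
  have hA0 : 0 ≤ A := Finset.sum_nonneg fun _ _ => by positivity
  have hlow : (∑ i ∈ s, ‖expSum a N (x i)‖ ^ 2) * ∑ k ∈ G, 1 / (k.totient : ℝ) ≤
      ∑ t ∈ T, ‖expSum a N (y t)‖ ^ 2 := by
    rw [hT, Finset.sum_product, Finset.sum_mul]
    refine Finset.sum_le_sum fun i _ => ?_
    rw [Finset.sum_sigma, Finset.mul_sum]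
    refine Finset.sum_le_sum fun k hk => ?_
    have hkF := (Finset.mem_filter.1 hk)
    have := sq_norm_expSum_le a N k (hsq k hkF.1) (fun n hn => ha n hn k hkF.1) (x i)
    rw [mul_comm]; exact this
  have hup : ∑ t ∈ T, ‖expSum a N (y t)‖ ^ 2 ≤ (8 + 4 * zetaZ) * N * A := by
    have e1 : (4 * ((N : ℝ) + 1) ^ 2 + zetaZ / δ ^ 2) ≤ (N + 1) * ((8 + 4 * zetaZ) * N) := by
      have : zetaZ / δ ^ 2 = 4 * zetaZ * N ^ 2 := by rw [hδ]; field_simp; ring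
      rw [this]
      have := mul_nonneg hz0 (by linarith : (0:ℝ) ≤ N)
      nlinarith
    have h2 : ((N : ℝ) + 1) * ∑ t ∈ T, ‖expSum a N (y t)‖ ^ 2 ≤
        (N + 1) * ((8 + 4 * zetaZ) * N * A) := by
      refine hls.trans ?_
      calc _ ≤ (N + 1) * ((8 + 4 * zetaZ) * N) * A := by gcongr
        _ = _ := by ring
    exact le_of_mul_le_mul_left h2 (by positivity)
  have hrem := sum_inv_totient_coprime F hsq hdiv P hPp
  set Pr := ∏ p ∈ P, (1 - 1 / (p : ℝ)) with hPr
  set V := ∑ k ∈ F, 1 / (k.totient : ℝ) with hV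
  set X := ∑ i ∈ s, ‖expSum a N (x i)‖ ^ 2 with hX
  have hX0 : 0 ≤ X := Finset.sum_nonneg fun _ _ => by positivity
  have hV0 : 0 ≤ V := Finset.sum_nonneg fun _ _ => by positivity
  have hPr0 : 0 ≤ Pr := Finset.prod_nonneg fun p hp => by
    have : (1:ℝ) ≤ p := by exact_mod_cast (hPp p hp).one_le
    rw [sub_nonneg, div_le_one (by linarith)]; exact this
  have hmain : X * V * Pr ≤ (8 + 4 * zetaZ) * N * A := by
    calc X * V * Pr = X * (Pr * V) := by ring
      _ ≤ X * ∑ k ∈ G, 1 / (k.totient : ℝ) := by gcongr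
      _ ≤ _ := hlow.trans hup
  have hone : 1 ≤ (2 * C1) ^ (1 / 10 : ℝ) * (s.card : ℝ) ^ (1 / 5 : ℝ) * Pr := by
    have h1 := hprod P hPp
    have h2 : 1 ≤ 2 * C1 * (s.card : ℝ) ^ 2 * Pr ^ 10 := by
      refine h1.trans ?_
      have : C1 * ((P.card : ℝ) + 1) ≤ 2 * C1 * (s.card : ℝ) ^ 2 := by
        have h0 : (P.card : ℝ) + 1 ≤ 2 * (s.card : ℝ) ^ 2 := by nlinarith
        nlinarith [mul_le_mul_of_nonneg_left h0 (by linarith : (0:ℝ) ≤ C1)]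
      gcongr
    have h3 : (1:ℝ) ≤ (2 * C1 * (s.card : ℝ) ^ 2 * Pr ^ 10) ^ (1 / 10 : ℝ) :=
      Real.one_le_rpow h2 (by norm_num)
    rw [Real.mul_rpow (by positivity) (by positivity), Real.mul_rpow (by positivity) (by positivity)] at h3
    rw [← Real.rpow_natCast, ← Real.rpow_natCast, ← Real.rpow_mul (by positivity),
      ← Real.rpow_mul hPr0] at h3
    norm_num at h3 ⊢
    exact h3
  calc X * V ≤ X * V * ((2 * C1) ^ (1 / 10 : ℝ) * (s.card : ℝ) ^ (1 / 5 : ℝ) * Pr) :=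
        le_mul_of_one_le_right (by positivity) hone
    _ = (2 * C1) ^ (1 / 10 : ℝ) * (s.card : ℝ) ^ (1 / 5 : ℝ) * (X * V * Pr) := by ring
    _ ≤ (2 * C1) ^ (1 / 10 : ℝ) * (s.card : ℝ) ^ (1 / 5 : ℝ) * ((8 + 4 * zetaZ) * N * A) := by gcongr
    _ = _ := by ring

/-- The weight `log p` on primes. -/
noncomputable def th (n : ℕ) : ℝ := if n.Prime then Real.log n else 0

lemma th_nonneg (n : ℕ) : 0 ≤ th n := by
  unfold th; split_ifs
  · exact Real.log_natCast_nonneg n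
  · exact le_rfl

lemma th_le_log (n : ℕ) : th n ≤ Real.log n := by
  unfold th; split_ifs
  · exact le_rfl
  · exact Real.log_natCast_nonneg n

/-- Squarefree integers in `[1, K]`. -/
def sqf (K : ℕ) : Finset ℕ := (Finset.range (K + 1)).filter Squarefree

lemma log_le_sum_sqf (K : ℕ) :
    Real.log (K + 1) ≤ zetaZ * ∑ k ∈ sqf K, 1 / (k.totient : ℝ) := by
  classical
  have h1 : Real.log ((K + 1 : ℕ) : ℝ) ≤ harmonic K := log_add_one_le_harmonic K
  have h2 : ((harmonic K : ℚ) : ℝ) = ∑ n ∈ Finset.Icc 1 K, 1 / (n : ℝ) := by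
    rw [harmonic_eq_sum_Icc]; push_cast; simp
  have h3 : ∑ n ∈ Finset.Icc 1 K, 1 / (n : ℝ) ≤
      ∑ t ∈ sqf K ×ˢ Finset.Icc 1 K, 1 / (t.1 : ℝ) * (1 / ((t.2 : ℤ) : ℝ) ^ 2) := by
    have hex : ∀ n ∈ Finset.Icc 1 K, ∃ t : ℕ × ℕ, t ∈ sqf K ×ˢ Finset.Icc 1 K ∧ t.2 ^ 2 * t.1 = n := by
      intro n hn
      obtain ⟨h1, h2⟩ := Finset.mem_Icc.1 hn
      obtain ⟨a, b, hab, ha⟩ := Nat.sq_mul_squarefree n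
      have hb : b ≠ 0 := by rintro rfl; simp at hab; omega
      have ha0 : a ≠ 0 := ha.ne_zero
      refine ⟨(a, b), ?_, hab⟩
      have hb2 : 1 ≤ b ^ 2 := Nat.one_le_iff_ne_zero.2 (by positivity)
      have : a ≤ n := by rw [← hab]; exact Nat.le_mul_of_pos_left _ (by omega)
      have : b ≤ n := by
        rw [← hab, sq, mul_assoc]; exact Nat.le_mul_of_pos_right _ (by positivity)
      simp only [Finset.mem_product, sqf, Finset.mem_filter, Finset.mem_range, Finset.mem_Icc]
      refine ⟨⟨by omega, ha⟩, by omega, by omega⟩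
    choose! g hg1 hg2 using hex
    calc _ = ∑ n ∈ Finset.Icc 1 K, 1 / ((g n).1 : ℝ) * (1 / (((g n).2 : ℤ) : ℝ) ^ 2) := by
          refine Finset.sum_congr rfl fun n hn => ?_
          rw [one_div_mul_one_div, ← hg2 n hn, hg2 n hn]
          congr 1
          rw [← hg2 n hn, hg2 n hn]
          have := hg2 n hn
          conv_lhs => rw [← this]
          push_cast; ring
      _ = ∑ t ∈ (Finset.Icc 1 K).image g, 1 / (t.1 : ℝ) * (1 / ((t.2 : ℤ) : ℝ) ^ 2) := by
          rw [Finset.sum_image]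
          intro a ha b hb hab
          rw [← hg2 a ha, ← hg2 b hb, hab]
      _ ≤ _ := by
          apply Finset.sum_le_sum_of_subset_of_nonneg
          · intro t ht
            obtain ⟨n, hn, rfl⟩ := Finset.mem_image.1 ht
            exact hg1 n hn
          · intros; positivity
  have h4 : ∑ m ∈ Finset.Icc 1 K, 1 / ((m : ℤ) : ℝ) ^ 2 ≤ zetaZ := by
    have := sum_inv_sq_le ((Finset.Icc 1 K).image (fun m : ℕ => (m : ℤ)))
    rwa [Finset.sum_image (by intro a _ b _ h; simpa using h)] at this
  rw [Finset.sum_product] at h3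
  simp_rw [← Finset.mul_sum] at h3
  rw [← Finset.sum_mul] at h3
  have h5 : ∑ k ∈ sqf K, 1 / (k : ℝ) ≤ ∑ k ∈ sqf K, 1 / (k.totient : ℝ) := by
    refine Finset.sum_le_sum fun k hk => ?_
    have hk0 : k ≠ 0 := (Finset.mem_filter.1 hk).2.ne_zero
    have : 0 < k.totient := Nat.totient_pos.2 (by omega)
    apply one_div_le_one_div_of_le (by exact_mod_cast this)
    exact_mod_cast Nat.totient_le k
  have h6 : 0 ≤ ∑ k ∈ sqf K, 1 / (k.totient : ℝ) := Finset.sum_nonneg fun _ _ => by positivity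
  push_cast at h1
  calc Real.log (K + 1) ≤ _ := h1
    _ = _ := h2
    _ ≤ _ := h3
    _ ≤ (∑ k ∈ sqf K, 1 / (k.totient : ℝ)) * zetaZ := by gcongr
    _ = _ := mul_comm _ _

/-- Large values estimate for exponential sums over primes. -/
lemma exists_largeValues_prime : ∃ C : ℝ, 0 < C ∧ ∀ (ι : Type) (s : Finset ι) (x : ι → ℝ) (N : ℕ),
    1 ≤ N → (∀ i ∈ s, ∀ j ∈ s, i ≠ j → 1 / (N : ℝ) ≤ nd (x i - x j)) →
    ∀ a : ℕ → ℂ, (∀ n, a n ≠ 0 → n.Prime ∧ N < n ^ 2) →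
    (∑ i ∈ s, ‖expSum a N (x i)‖ ^ 2) * Real.log N ≤
      C * (s.card : ℝ) ^ (1 / 5 : ℝ) * N * ∑ n ∈ Finset.range (N + 1), ‖a n‖ ^ 2 := by
  obtain ⟨C, hC, hLV⟩ := exists_largeValues
  have hz0 := zetaZ_nonneg
  refine ⟨4 * (zetaZ + 1) * C, by positivity, ?_⟩
  intro ι s x N hN hs a ha
  set K := (N.sqrt).sqrt with hK
  have hK4 : K ^ 4 ≤ N := by
    have h1 : K ^ 2 ≤ N.sqrt := Nat.sqrt_le' _
    calc K ^ 4 = (K ^ 2) ^ 2 := by ring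
      _ ≤ N.sqrt ^ 2 := Nat.pow_le_pow_left h1 2
      _ ≤ N := Nat.sqrt_le' _
  have hKN : N ≤ (K + 1) ^ 4 := by
    have h1 : N.sqrt + 1 ≤ (K + 1) ^ 2 := Nat.lt_succ_sqrt' _
    have h2 : N < (N.sqrt + 1) ^ 2 := Nat.lt_succ_sqrt' _
    calc N ≤ (N.sqrt + 1) ^ 2 := h2.le
      _ ≤ ((K + 1) ^ 2) ^ 2 := Nat.pow_le_pow_left h1 2
      _ = _ := by ring
  have hmain := hLV ι s x N K hN hK4 hs (sqf K)
    (fun k hk => (Finset.mem_filter.1 hk).2)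
    (fun k hk d hd => Finset.mem_filter.2 ⟨Finset.mem_range.2 (by
      have h1 := Finset.mem_range.1 (Finset.mem_filter.1 hk).1
      have h2 := Nat.le_of_dvd (Nat.pos_of_ne_zero (Finset.mem_filter.1 hk).2.ne_zero) hd
      omega), (Finset.mem_filter.1 hk).2.squarefree_of_dvd hd⟩)
    (fun k hk => by have := Finset.mem_range.1 (Finset.mem_filter.1 hk).1; omega) a
    (by
      intro n hn k hk
      obtain ⟨hp, hlt⟩ := ha n hn
      rw [Nat.Prime.coprime_iff_not_dvd hp]
      intro hd
      have hk' := Finset.mem_filter.1 hk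
      have h1 := Nat.le_of_dvd (Nat.pos_of_ne_zero hk'.2.ne_zero) hd
      have h2 := Finset.mem_range.1 hk'.1
      have h3 : n ^ 2 ≤ n ^ 4 := Nat.pow_le_pow_right hp.pos (by norm_num)
      have h4 : n ^ 4 ≤ K ^ 4 := Nat.pow_le_pow_left (by omega) 4
      omega)
  have hlog : Real.log N ≤ 4 * (zetaZ + 1) * ∑ k ∈ sqf K, 1 / (k.totient : ℝ) := by
    have h1 := log_le_sum_sqf K
    have h2 : Real.log N ≤ 4 * Real.log (K + 1) := by
      have : ((K : ℝ) + 1) ^ 4 = ((K + 1) ^ 4 : ℕ) := by push_cast; ring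
      rw [show (4:ℝ) = ((4 : ℕ) : ℝ) by norm_num, ← Real.log_pow, this]
      apply Real.log_le_log (by exact_mod_cast hN)
      exact_mod_cast hKN
    have h6 : 0 ≤ ∑ k ∈ sqf K, 1 / (k.totient : ℝ) := Finset.sum_nonneg fun _ _ => by positivity
    nlinarith
  have hX0 : 0 ≤ ∑ i ∈ s, ‖expSum a N (x i)‖ ^ 2 := Finset.sum_nonneg fun _ _ => by positivity
  calc _ ≤ (∑ i ∈ s, ‖expSum a N (x i)‖ ^ 2) *
        (4 * (zetaZ + 1) * ∑ k ∈ sqf K, 1 / (k.totient : ℝ)) := by gcongr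
    _ = 4 * (zetaZ + 1) * ((∑ i ∈ s, ‖expSum a N (x i)‖ ^ 2) * ∑ k ∈ sqf K, 1 / (k.totient : ℝ)) := by ring
    _ ≤ 4 * (zetaZ + 1) * (C * (s.card : ℝ) ^ (1 / 5 : ℝ) * N *
          ∑ n ∈ Finset.range (N + 1), ‖a n‖ ^ 2) := by gcongr
    _ = _ := by ring

lemma nd_div_ge (q : ℕ) (i j : ℕ) (hi : i < q) (hj : j < q) (hij : i ≠ j) :
    1 / (q : ℝ) ≤ nd ((i : ℝ) / q - (j : ℝ) / q) := by
  by_contra h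
  push Not at h
  have hq : 0 < q := by omega
  have hq' : (0:ℚ) < q := by exact_mod_cast hq
  have e : (i : ℝ) / q - (j : ℝ) / q = ((((i : ℤ) - (j : ℤ) : ℤ) : ℚ) / ((q : ℤ) : ℚ) : ℚ) := by
    push_cast; ring
  rw [e] at h
  obtain ⟨z, hz⟩ := exists_int_of_nd_lt _ q (by
    have := Rat.den_dvd ((i : ℤ) - j) q
    rw [Rat.divInt_eq_div] at this
    exact_mod_cast this) hq h
  rw [div_eq_iff (by exact_mod_cast hq.ne')] at hz
  have hz2 : (i : ℤ) - j = z * q := by exact_mod_cast hz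
  have hz0 : z = 0 := by
    by_contra hne
    have : (q : ℤ) ≤ |z * q| := by
      rw [abs_mul, abs_of_nonneg (by positivity : (0:ℤ) ≤ q)]
      have := Int.one_le_abs hne
      nlinarith
    rw [← hz2, le_abs] at this
    omega
  rw [hz0] at hz2; omega

/-- A weak Brun–Titchmarsh inequality. -/
lemma exists_brunTitchmarsh : ∃ C : ℝ, 0 < C ∧ ∀ M q c : ℕ, 1 ≤ M → 1 ≤ q → q ≤ 2 * M + 1 →
    ∑ p ∈ Finset.Ioc M (2 * M) with p ≡ c [MOD q], th p ≤ C * M * (q : ℝ) ^ (-(4 / 5) : ℝ) := by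
  obtain ⟨C, hC, hLV⟩ := exists_largeValues_prime
  refine ⟨3 * C, by positivity, ?_⟩
  intro M q c hM hq hqM
  set N := 2 * M + 1 with hN
  set A := (Finset.Ioc M (2 * M)).filter (fun p => p ≡ c [MOD q]) with hA
  set a : ℕ → ℂ := fun n => if n ∈ A then (th n : ℂ) else 0 with ha
  set X := ∑ p ∈ A, th p with hX
  have hX0 : 0 ≤ X := Finset.sum_nonneg fun _ _ => th_nonneg _
  have hAsub : A ⊆ Finset.range (N + 1) := by
    intro n hn
    have := Finset.mem_Ioc.1 (Finset.mem_filter.1 hn).1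
    exact Finset.mem_range.2 (by omega)
  have hq0 : (0:ℝ) < q := by exact_mod_cast hq
  have hmain := hLV ℕ (Finset.range q) (fun r => (r : ℝ) / q) N (by omega)
    (by
      intro i hi j hj hij
      refine le_trans ?_ (nd_div_ge q i j (Finset.mem_range.1 hi) (Finset.mem_range.1 hj) hij)
      apply one_div_le_one_div_of_le hq0
      exact_mod_cast hqM) a
    (by
      intro n hn
      simp only [ha] at hn
      split_ifs at hn with h
      · have h1 := Finset.mem_Ioc.1 (Finset.mem_filter.1 h).1
        refine ⟨?_, by nlinarith⟩
        by_contra hnp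
        exact hn (by simp [th, hnp])
      · exact absurd rfl hn)
  have hval : ∀ r ∈ Finset.range q, ‖expSum a N ((r : ℝ) / q)‖ ^ 2 = X ^ 2 := by
    intro r _
    have : expSum a N ((r : ℝ) / q) = ee (c * (r / q)) * X := by
      simp only [expSum, ha, ite_mul, zero_mul]
      rw [← Finset.sum_filter, Finset.filter_mem_eq_inter, Finset.inter_eq_right.2 hAsub, hX]
      push_cast
      rw [Finset.mul_sum]
      refine Finset.sum_congr rfl fun n hn => ?_
      have hmod := (Finset.mem_filter.1 hn).2
      rw [mul_comm]; congr 1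
      obtain ⟨z, hz⟩ := (Nat.modEq_iff_dvd.1 hmod)
      have hz' : (c : ℝ) - n = q * z := by exact_mod_cast hz
      have : (n : ℝ) * (r / q) = c * (r / q) + ((-(z * r) : ℤ) : ℝ) := by
        have : (n : ℝ) = c - q * z := by linarith
        rw [this]; push_cast; field_simp; ring
      rw [this, ee_add_int]
    rw [this, norm_mul, norm_ee, one_mul, Complex.norm_real, Real.norm_eq_abs, sq_abs]
  rw [Finset.sum_congr rfl hval, Finset.sum_const, Finset.card_range, nsmul_eq_mul] at hmain
  have hsq : ∑ n ∈ Finset.range (N + 1), ‖a n‖ ^ 2 ≤ Real.log N * X := by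
    have : ∀ n, ‖a n‖ ^ 2 = if n ∈ A then th n ^ 2 else 0 := by
      intro n; simp only [ha]; split_ifs
      · rw [Complex.norm_real, Real.norm_eq_abs, sq_abs]
      · simp
    simp_rw [this]
    rw [← Finset.sum_filter, Finset.filter_mem_eq_inter, Finset.inter_eq_right.2 hAsub, hX, Finset.mul_sum]
    refine Finset.sum_le_sum fun n hn => ?_
    rw [sq]
    have h1 := Finset.mem_Ioc.1 (Finset.mem_filter.1 hn).1
    have : th n ≤ Real.log N := (th_le_log n).trans
      (Real.log_le_log (by exact_mod_cast (by omega : 0 < n)) (by exact_mod_cast (by omega : n ≤ N)))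
    exact mul_le_mul_of_nonneg_right this (th_nonneg n)
  have hlogN : 0 < Real.log N := Real.log_pos (by exact_mod_cast (by omega : 1 < N))
  have h2 : q * X ^ 2 * Real.log N ≤ C * (q:ℝ) ^ (1 / 5 : ℝ) * N * (Real.log N * X) :=
    hmain.trans (by gcongr)
  rcases hX0.eq_or_lt with h0 | h0
  · rw [← h0]; positivity
  · have h3 : q * X ≤ C * (q:ℝ) ^ (1 / 5 : ℝ) * N := by
      have : (q * X) * (X * Real.log N) ≤ (C * (q:ℝ) ^ (1 / 5 : ℝ) * N) * (X * Real.log N) := by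
        calc _ = q * X ^ 2 * Real.log N := by ring
          _ ≤ _ := h2
          _ = _ := by ring
      exact le_of_mul_le_mul_right this (by positivity)
    have h4 : (q:ℝ) ^ (1 / 5 : ℝ) = q * (q:ℝ) ^ (-(4 / 5) : ℝ) := by
      conv_rhs => rw [← Real.rpow_one_add' hq0.le (by norm_num)]
      norm_num
    rw [h4] at h3
    have h5 : (N : ℝ) ≤ 3 * M := by rw [hN]; push_cast; have : (1:ℝ) ≤ M := by exact_mod_cast hM
                                    linarith
    have h6 : X ≤ C * (q:ℝ) ^ (-(4 / 5) : ℝ) * N := by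
      have : q * X ≤ q * (C * (q:ℝ) ^ (-(4 / 5) : ℝ) * N) := by
        calc _ ≤ _ := h3
          _ = _ := by ring
      exact le_of_mul_le_mul_left this hq0
    calc X ≤ C * (q:ℝ) ^ (-(4 / 5) : ℝ) * N := h6
      _ ≤ C * (q:ℝ) ^ (-(4 / 5) : ℝ) * (3 * M) := by gcongr
      _ = _ := by ring

end Ternary

namespace Ternary
open MeasureTheory Topology

/-- The Fejer kernel on the line. -/
noncomputable def fejer (u : ℝ) : ℝ := Real.sinc (Real.pi * u) ^ 2

lemma fejer_nonneg (u : ℝ) : 0 ≤ fejer u := sq_nonneg _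

lemma continuous_fejer : Continuous fejer := by
  unfold fejer
  exact (Real.continuous_sinc.comp (continuous_const.mul continuous_id)).pow 2

lemma fejer_zero : fejer 0 = 1 := by simp [fejer]

lemma fejer_le (u : ℝ) : fejer u ≤ 2 * (1 + u ^ 2)⁻¹ := by
  have h1 : fejer u ≤ 1 := by
    unfold fejer
    rw [sq_le_one_iff_abs_le_one]
    exact abs_le.2 ⟨Real.neg_one_le_sinc _, Real.sinc_le_one _⟩
  have h2 : (Real.pi * u) ^ 2 * fejer u ≤ 1 := by
    unfold fejer
    rw [← mul_pow]
    by_cases hu : Real.pi * u = 0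
    · simp [hu]
    · rw [Real.sinc_of_ne_zero hu, mul_div_cancel₀ _ hu]
      exact Real.sin_sq_le_one _
  have h3 : u ^ 2 * fejer u ≤ 1 := by
    refine le_trans ?_ h2
    rw [mul_pow, mul_assoc]
    have : (1 : ℝ) ≤ Real.pi ^ 2 := by nlinarith [Real.pi_gt_three]
    have h0 : 0 ≤ u ^ 2 * fejer u := mul_nonneg (sq_nonneg _) (fejer_nonneg _)
    nlinarith
  rw [← div_eq_mul_inv, le_div_iff₀ (by positivity)]
  nlinarith

lemma integrable_fejer : Integrable fejer := by
  refine Integrable.mono' (integrable_inv_one_add_sq.const_mul 2)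
    continuous_fejer.aestronglyMeasurable (ae_of_all _ fun u ↦ ?_)
  rw [Real.norm_eq_abs, abs_of_nonneg (fejer_nonneg u)]
  exact fejer_le u

lemma integral_fejer_pos : 0 < ∫ u, fejer u := by
  refine integral_pos_of_integrable_nonneg_nonzero continuous_fejer integrable_fejer
    fejer_nonneg (x := 0) ?_
  rw [fejer_zero]; exact one_ne_zero

lemma integral_tri_mul_ee (u : ℝ) :
    ∫ t in (-1 : ℝ)..1, ((1 - |t| : ℝ) : ℂ) * ee (t * u) = fejer u := by
  have hcont : Continuous fun t : ℝ ↦ ((1 - |t| : ℝ) : ℂ) * ee (t * u) := by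
    unfold ee; fun_prop
  rw [← intervalIntegral.integral_add_adjacent_intervals (b := 0)
    (hcont.intervalIntegrable _ _) (hcont.intervalIntegrable _ _)]
  set c : ℂ := 2 * Real.pi * u * Complex.I with hc
  have hee (t : ℝ) : ee (t * u) = Complex.exp (c * t) := by
    unfold ee; rw [hc]; congr 1; push_cast; ring
  by_cases hu : u = 0
  · subst hu
    have e1 : ∫ t in (-1 : ℝ)..0, ((1 - |t| : ℝ) : ℂ) * ee (t * 0) = ∫ t in (-1 : ℝ)..0, ((1 + t : ℝ) : ℂ) := by
      refine intervalIntegral.integral_congr fun t ht ↦ ?_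
      rw [Set.uIcc_of_le (by norm_num)] at ht
      simp [ee_zero, abs_of_nonpos ht.2]
    have e2 : ∫ t in (0 : ℝ)..1, ((1 - |t| : ℝ) : ℂ) * ee (t * 0) = ∫ t in (0 : ℝ)..1, ((1 - t : ℝ) : ℂ) := by
      refine intervalIntegral.integral_congr fun t ht ↦ ?_
      rw [Set.uIcc_of_le (by norm_num)] at ht
      simp [ee_zero, abs_of_nonneg ht.1]
    rw [e1, e2, intervalIntegral.integral_ofReal, intervalIntegral.integral_ofReal, fejer_zero,
      ← Complex.ofReal_add]
    congr 1
    rw [intervalIntegral.integral_add (by simp) (by simp),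
      intervalIntegral.integral_sub (by simp) (by simp)]
    simp; norm_num
  have hc0 : c ≠ 0 := by
    rw [hc]
    simp [Real.pi_ne_zero, hu]
  have hd (t : ℝ) : HasDerivAt (fun t : ℝ ↦ Complex.exp (c * t)) (Complex.exp (c * t) * c) t := by
    have := ((hasDerivAt_id (t : ℂ)).const_mul c).cexp.comp_ofReal
    simpa using this
  have hof (t : ℝ) : HasDerivAt (fun t : ℝ ↦ (t : ℂ)) 1 t := (hasDerivAt_id (t : ℂ)).comp_ofReal
  have e1 : ∫ t in (-1 : ℝ)..0, ((1 - |t| : ℝ) : ℂ) * ee (t * u) =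
      (1 / c - 1 / c ^ 2) + Complex.exp (-c) / c ^ 2 := by
    have : ∫ t in (-1 : ℝ)..0, ((1 - |t| : ℝ) : ℂ) * ee (t * u) =
        ∫ t in (-1 : ℝ)..0, (1 + (t : ℂ)) * Complex.exp (c * t) := by
      refine intervalIntegral.integral_congr fun t ht ↦ ?_
      rw [Set.uIcc_of_le (by norm_num)] at ht
      simp [hee, abs_of_nonpos ht.2]
    rw [this, intervalIntegral.integral_eq_sub_of_hasDerivAt
      (f := fun t : ℝ ↦ (1 + (t : ℂ)) * Complex.exp (c * t) / c - Complex.exp (c * t) / c ^ 2)]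
    · simp
    · intro t _
      convert! ((((hof t).const_add 1).mul (hd t)).div_const c).sub ((hd t).div_const (c ^ 2)) using 1
      field_simp
      ring
    · exact (by fun_prop : Continuous fun t : ℝ ↦ (1 + (t : ℂ)) * Complex.exp (c * t)).intervalIntegrable _ _
  have e2 : ∫ t in (0 : ℝ)..1, ((1 - |t| : ℝ) : ℂ) * ee (t * u) =
      Complex.exp c / c ^ 2 - (1 / c + 1 / c ^ 2) := by
    have : ∫ t in (0 : ℝ)..1, ((1 - |t| : ℝ) : ℂ) * ee (t * u) =
        ∫ t in (0 : ℝ)..1, (1 - (t : ℂ)) * Complex.exp (c * t) := by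
      refine intervalIntegral.integral_congr fun t ht ↦ ?_
      rw [Set.uIcc_of_le (by norm_num)] at ht
      simp [hee, abs_of_nonneg ht.1]
    rw [this, intervalIntegral.integral_eq_sub_of_hasDerivAt
      (f := fun t : ℝ ↦ (1 - (t : ℂ)) * Complex.exp (c * t) / c + Complex.exp (c * t) / c ^ 2)]
    · simp
    · intro t _
      convert! ((((hof t).const_sub 1).mul (hd t)).div_const c).add ((hd t).div_const (c ^ 2)) using 1
      field_simp
      ring
    · exact (by fun_prop : Continuous fun t : ℝ ↦ (1 - (t : ℂ)) * Complex.exp (c * t)).intervalIntegrable _ _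
  rw [e1, e2]
  have hpu : Real.pi * u ≠ 0 := mul_ne_zero Real.pi_ne_zero hu
  have hcos : Complex.exp c + Complex.exp (-c) = 2 - 4 * (Real.sin (Real.pi * u) : ℂ) ^ 2 := by
    have h1 : c = ((2 * (Real.pi * u) : ℝ) : ℂ) * Complex.I := by rw [hc]; push_cast; ring
    have h2 := Complex.two_cos ((2 * (Real.pi * u) : ℝ) : ℂ)
    rw [neg_mul, ← h1] at h2
    rw [← h2, ← Complex.ofReal_cos, Real.cos_two_mul, Real.cos_sq']
    push_cast; ring
  unfold fejer
  rw [Real.sinc_of_ne_zero hpu]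
  have hc2 : c ^ 2 = -4 * ((Real.pi * u : ℝ) : ℂ) ^ 2 := by
    rw [hc]; push_cast; ring_nf; simp; 
  have : (1 / c - 1 / c ^ 2) + Complex.exp (-c) / c ^ 2 + (Complex.exp c / c ^ 2 - (1 / c + 1 / c ^ 2)) =
    (Complex.exp c + Complex.exp (-c) - 2) / c ^ 2 := by ring
  rw [this, hcos, hc2]
  have hpc : ((Real.pi * u : ℝ) : ℂ) ≠ 0 := by exact_mod_cast hpu
  rw [Complex.ofReal_pow, Complex.ofReal_div]
  field_simp
  ring

section Tauberian
variable {D : ℝ → ℝ} {C₀ : ℝ} {H : ℂ → ℂ}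

lemma laplace_integrable (hm : Measurable D) (hb : ∀ v, |D v| ≤ C₀) {ε : ℝ} (hε : 0 < ε) :
    Integrable (fun v ↦ ((D v * Real.exp (-ε * v) : ℝ) : ℂ)) (volume.restrict (Set.Ioi 0)) := by
  have h1 : Integrable (fun v ↦ Real.exp (-ε * v)) (volume.restrict (Set.Ioi 0)) :=
    exp_neg_integrableOn_Ioi 0 hε
  refine Integrable.ofReal ?_
  refine h1.bdd_mul (c := C₀) hm.aestronglyMeasurable (ae_of_all _ fun v ↦ ?_)
  exact hb v

lemma fejer_laplace (hm : Measurable D) (hb : ∀ v, |D v| ≤ C₀)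
    (hH : ∀ s : ℂ, 1 < s.re → ∫ v in Set.Ioi (0 : ℝ), (D v : ℂ) * Complex.exp (-(s - 1) * v) = H s)
    {ε : ℝ} (hε : 0 < ε) (R u : ℝ) :
    ∫ v in Set.Ioi (0 : ℝ), ((D v * Real.exp (-ε * v) : ℝ) : ℂ) * fejer (R * (u - v)) =
      ∫ t in Set.Ioc (-1 : ℝ) 1, ((1 - |t| : ℝ) : ℂ) * ee (t * (R * u)) *
        H (1 + ε + 2 * Real.pi * (R * t) * Complex.I) := by
  have hinteg := laplace_integrable hm hb hε
  have htri : Integrable (fun t : ℝ ↦ ((1 - |t| : ℝ) : ℂ)) (volume.restrict (Set.Ioc (-1) 1)) :=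
    ((by fun_prop : Continuous fun t : ℝ ↦ ((1 - |t| : ℝ) : ℂ)).continuousOn.integrableOn_Icc).mono_set
      Set.Ioc_subset_Icc_self
  have hprod := hinteg.mul_prod htri
  have hprod2 : Integrable (Function.uncurry fun v t : ℝ ↦ ((D v * Real.exp (-ε * v) : ℝ) : ℂ) *
      (((1 - |t| : ℝ) : ℂ) * ee (t * (R * (u - v)))))
      ((volume.restrict (Set.Ioi 0)).prod (volume.restrict (Set.Ioc (-1) 1))) := by
    have hc : Continuous fun z : ℝ × ℝ ↦ ee (z.2 * (R * (u - z.1))) := by unfold ee; fun_prop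
    refine (hprod.bdd_mul (c := 1) (f := fun z : ℝ × ℝ ↦ ee (z.2 * (R * (u - z.1))))
      hc.aestronglyMeasurable (ae_of_all _ fun z ↦ (norm_ee _).le)).congr (ae_of_all _ fun z ↦ ?_)
    simp only [Function.uncurry]
    ring
  calc _ = ∫ v in Set.Ioi (0 : ℝ), ∫ t in Set.Ioc (-1 : ℝ) 1, ((D v * Real.exp (-ε * v) : ℝ) : ℂ) *
      (((1 - |t| : ℝ) : ℂ) * ee (t * (R * (u - v)))) := by
        refine integral_congr_ae (ae_of_all _ fun v ↦ ?_)
        simp only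
        rw [integral_const_mul, ← integral_tri_mul_ee, intervalIntegral.integral_of_le (by norm_num)]
    _ = _ := by
        rw [integral_integral_swap hprod2]
        refine integral_congr_ae (ae_of_all _ fun t ↦ ?_)
        simp only
        rw [← hH _ (by simp [hε]), ← integral_const_mul]
        refine integral_congr_ae (ae_of_all _ fun v ↦ ?_)
        simp only
        have : ee (t * (R * (u - v))) = ee (t * (R * u)) * Complex.exp (-(2 * Real.pi * (R * t) * Complex.I) * v) := by
          unfold ee; rw [← Complex.exp_add]; congr 1; push_cast; ring
        rw [this]
        have h2 : Complex.exp (-(1 + ε + 2 * Real.pi * (R * t) * Complex.I - 1) * v) =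
          (Real.exp (-ε * v) : ℝ) * Complex.exp (-(2 * Real.pi * (R * t) * Complex.I) * v) := by
          rw [Complex.ofReal_exp, ← Complex.exp_add]; congr 1; push_cast; ring
        rw [h2]; push_cast; ring

lemma fejer_integrable_scale {R : ℝ} (hR : 0 < R) (u : ℝ) :
    Integrable fun v ↦ fejer (R * (u - v)) := by
  have := (integrable_fejer.comp_mul_left' hR.ne')
  exact this.comp_sub_left u

lemma fejer_boundary (hm : Measurable D) (hb : ∀ v, |D v| ≤ C₀)
    (hHc : ContinuousOn H {s | 1 ≤ s.re})
    (hH : ∀ s : ℂ, 1 < s.re → ∫ v in Set.Ioi (0 : ℝ), (D v : ℂ) * Complex.exp (-(s - 1) * v) = H s)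
    {R : ℝ} (hR : 0 < R) (u : ℝ) :
    ∫ v in Set.Ioi (0 : ℝ), (D v : ℂ) * fejer (R * (u - v)) =
      ∫ t in Set.Ioc (-1 : ℝ) 1, ((1 - |t| : ℝ) : ℂ) * ee (t * (R * u)) *
        H (1 + 2 * Real.pi * (R * t) * Complex.I) := by
  have hC0 : 0 ≤ C₀ := (abs_nonneg _).trans (hb 0)
  have hl : Tendsto (fun ε : ℝ ↦ ∫ v in Set.Ioi (0 : ℝ),
      ((D v * Real.exp (-ε * v) : ℝ) : ℂ) * fejer (R * (u - v))) (𝓝[>] 0)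
      (𝓝 (∫ v in Set.Ioi (0 : ℝ), (D v : ℂ) * fejer (R * (u - v)))) := by
    refine tendsto_integral_filter_of_dominated_convergence (fun v ↦ C₀ * fejer (R * (u - v))) ?_ ?_
      ((fejer_integrable_scale hR u).integrableOn.const_mul _) ?_
    · refine Eventually.of_forall fun ε ↦ ?_
      have h1 : Measurable fun v ↦ ((D v * Real.exp (-ε * v) : ℝ) : ℂ) * fejer (R * (u - v)) := by
        have := continuous_fejer.measurable
        fun_prop
      exact h1.aestronglyMeasurable
    · filter_upwards [self_mem_nhdsWithin] with ε hε
      filter_upwards [ae_restrict_mem measurableSet_Ioi] with v hv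
      rw [norm_mul, Complex.norm_real, Complex.norm_real, Real.norm_eq_abs, Real.norm_eq_abs,
        abs_of_nonneg (fejer_nonneg _), abs_mul, abs_of_pos (Real.exp_pos _)]
      have h2 : Real.exp (-ε * v) ≤ 1 := by
        rw [Real.exp_le_one_iff]
        have := mul_pos (Set.mem_Ioi.1 hε) (Set.mem_Ioi.1 hv)
        linarith
      have := hb v
      refine mul_le_mul_of_nonneg_right ?_ (fejer_nonneg _)
      calc _ ≤ C₀ * 1 := mul_le_mul this h2 (Real.exp_pos _).le hC0
        _ = _ := mul_one _
    · refine ae_of_all _ fun v ↦ ?_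
      have hc : Continuous fun ε : ℝ ↦ ((D v * Real.exp (-ε * v) : ℝ) : ℂ) * fejer (R * (u - v)) := by
        fun_prop
      have := (hc.tendsto 0).mono_left (nhdsWithin_le_nhds (s := Set.Ioi 0))
      simpa using this
  have hr : Tendsto (fun ε : ℝ ↦ ∫ t in Set.Ioc (-1 : ℝ) 1, ((1 - |t| : ℝ) : ℂ) * ee (t * (R * u)) *
        H (1 + ε + 2 * Real.pi * (R * t) * Complex.I)) (𝓝[>] 0)
      (𝓝 (∫ t in Set.Ioc (-1 : ℝ) 1, ((1 - |t| : ℝ) : ℂ) * ee (t * (R * u)) *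
        H (1 + 2 * Real.pi * (R * t) * Complex.I))) := by
    have hcont : ContinuousOn (fun z : ℝ × ℝ ↦ H (1 + z.1 + 2 * Real.pi * (R * z.2) * Complex.I))
        (Set.Icc 0 1 ×ˢ Set.Icc (-1) 1) := by
      refine hHc.comp (by fun_prop) fun z hz ↦ ?_
      have := hz.1.1
      simpa using this
    obtain ⟨B, hB⟩ := (isCompact_Icc.prod isCompact_Icc).exists_bound_of_continuousOn hcont
    have htri : ∀ t ∈ Set.Icc (-1 : ℝ) 1, ‖((1 - |t| : ℝ) : ℂ)‖ ≤ 1 := by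
      intro t ht
      rw [Complex.norm_real, Real.norm_eq_abs, abs_le]
      have := abs_le.2 ht
      constructor <;> linarith [abs_nonneg t]
    refine tendsto_integral_filter_of_dominated_convergence (fun _ ↦ B) ?_ ?_ (by simp) ?_
    · filter_upwards [Ioc_mem_nhdsGT zero_lt_one] with ε hε
      have h1 : ContinuousOn (fun t : ℝ ↦ ((1 - |t| : ℝ) : ℂ) * ee (t * (R * u)) *
        H (1 + ε + 2 * Real.pi * (R * t) * Complex.I)) (Set.Icc (-1) 1) := by
        refine ContinuousOn.mul (by unfold ee; fun_prop) ?_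
        exact hcont.comp (f := fun t : ℝ ↦ (ε, t)) (by fun_prop) fun t ht ↦ ⟨⟨hε.1.le, hε.2⟩, ht⟩
      exact (h1.mono Set.Ioc_subset_Icc_self).aestronglyMeasurable measurableSet_Ioc
    · filter_upwards [Ioc_mem_nhdsGT zero_lt_one] with ε hε
      filter_upwards [ae_restrict_mem measurableSet_Ioc] with t ht
      have ht' := Set.Ioc_subset_Icc_self ht
      rw [norm_mul, norm_mul, norm_ee, mul_one]
      have h1 := hB (ε, t) ⟨⟨hε.1.le, hε.2⟩, ht'⟩
      calc _ ≤ 1 * B := mul_le_mul (htri t ht') h1 (norm_nonneg _) zero_le_one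
        _ = B := one_mul _
    · filter_upwards [ae_restrict_mem measurableSet_Ioc] with t ht
      have ht' := Set.Ioc_subset_Icc_self ht
      refine Tendsto.const_mul _ ?_
      have h1 : ContinuousOn (fun ε : ℝ ↦ H (1 + ε + 2 * Real.pi * (R * t) * Complex.I)) (Set.Icc 0 1) :=
        hcont.comp (f := fun ε : ℝ ↦ (ε, t)) (by fun_prop) fun ε hε ↦ ⟨hε, ht'⟩
      have h2 := h1 0 ⟨le_rfl, zero_le_one⟩
      have h3 : Tendsto (fun ε : ℝ ↦ H (1 + ε + 2 * Real.pi * (R * t) * Complex.I)) (𝓝[>] 0)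
          (𝓝 (H (1 + (0 : ℝ) + 2 * Real.pi * (R * t) * Complex.I))) := by
        refine h2.mono_left ?_
        rw [← nhdsWithin_Ioc_eq_nhdsGT zero_lt_one]
        exact nhdsWithin_mono _ Set.Ioc_subset_Icc_self
      simpa using h3
  refine tendsto_nhds_unique hl (hr.congr' ?_)
  filter_upwards [self_mem_nhdsWithin] with ε hε
  exact (fejer_laplace hm hb hH hε R u).symm

lemma tendsto_fejer_average (hm : Measurable D) (hb : ∀ v, |D v| ≤ C₀)
    (hHc : ContinuousOn H {s | 1 ≤ s.re})
    (hH : ∀ s : ℂ, 1 < s.re → ∫ v in Set.Ioi (0 : ℝ), (D v : ℂ) * Complex.exp (-(s - 1) * v) = H s)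
    {R : ℝ} (hR : 0 < R) :
    Tendsto (fun u ↦ ∫ v in Set.Ioi (0 : ℝ), D v * fejer (R * (u - v))) atTop (𝓝 0) := by
  have h1 : Tendsto (fun u : ℝ ↦ -(R * u)) atTop (cocompact ℝ) := by
    have : Tendsto (fun u : ℝ ↦ -(R * u)) atTop atBot :=
      tendsto_neg_atTop_atBot.comp (tendsto_id.const_mul_atTop hR)
    exact this.mono_right atBot_le_cocompact
  have h2 := (Real.tendsto_integral_exp_smul_cocompact (Set.indicator (Set.Ioc (-1 : ℝ) 1) fun t ↦
    ((1 - |t| : ℝ) : ℂ) * H (1 + 2 * Real.pi * (R * t) * Complex.I))).comp h1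
  have h3 : Tendsto (fun u ↦ ((∫ v in Set.Ioi (0 : ℝ), D v * fejer (R * (u - v)) : ℝ) : ℂ)) atTop
      (𝓝 ((0 : ℝ) : ℂ)) := by
    rw [Complex.ofReal_zero]
    refine h2.congr fun u ↦ ?_
    have e1 : ((∫ v in Set.Ioi (0 : ℝ), D v * fejer (R * (u - v)) : ℝ) : ℂ) =
      ∫ v in Set.Ioi (0 : ℝ), (D v : ℂ) * fejer (R * (u - v)) := by
      rw [← integral_complex_ofReal]; simp
    rw [e1, fejer_boundary hm hb hHc hH hR, ← integral_indicator measurableSet_Ioc]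
    simp only [Function.comp]
    refine integral_congr_ae (ae_of_all _ fun t ↦ ?_)
    simp only [Set.indicator_apply]
    split_ifs
    · have : (Real.fourierChar (-(t * -(R * u))) : ℂ) = ee (t * (R * u)) := by
        rw [Real.fourierChar_apply]; unfold ee; congr 1; push_cast; ring
      rw [Circle.smul_def, this, smul_eq_mul]; ring
    · simp
  exact (Complex.continuous_re.tendsto _).comp h3 |>.congr fun u ↦ by simp

lemma fejer_average_lower {η δ : ℝ} (hη : 0 < η) (hδ : 0 < δ) (C₀ : ℝ) (hC₀ : 0 ≤ C₀) :
    ∃ R > 0, ∃ c > 0, ∀ D : ℝ → ℝ, Measurable D → (∀ v, |D v| ≤ C₀) → ∀ u ≥ 0,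
      (∀ v ∈ Set.Ioc u (u + δ), η ≤ D v) →
      c ≤ ∫ v in Set.Ioi (0 : ℝ), D v * fejer (R * (u + δ / 2 - v)) := by
  set κ := ∫ u, fejer u with hκ
  have hκ0 : 0 < κ := integral_fejer_pos
  have ht := intervalIntegral_tendsto_integral integrable_fejer tendsto_neg_atTop_atBot tendsto_id
  rw [← hκ] at ht
  have hlt : κ - κ * η / (2 * (η + C₀)) < κ := by
    have : 0 < κ * η / (2 * (η + C₀)) := by positivity
    linarith
  obtain ⟨ρ, hρ, hρ0⟩ := ((ht.eventually (lt_mem_nhds hlt)).and (eventually_gt_atTop 0)).exists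
  simp only [id] at hρ
  set g := ∫ x in (-ρ)..ρ, fejer x with hg
  refine ⟨2 * ρ / δ, by positivity, κ * η / 2 * (2 * ρ / δ)⁻¹, by positivity, fun D hm hb u hu hD ↦ ?_⟩
  set R := 2 * ρ / δ with hR
  have hR0 : 0 < R := by positivity
  have hinteg := fejer_integrable_scale hR0 (u + δ / 2)
  have e1 : ∫ v, fejer (R * (u + δ / 2 - v)) = R⁻¹ * κ := by
    rw [integral_sub_left_eq_self (fun v ↦ fejer (R * v)) volume (u + δ / 2),
      Measure.integral_comp_mul_left, abs_of_pos (by positivity), smul_eq_mul]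
  have e2 : ∫ v in Set.Ioc u (u + δ), fejer (R * (u + δ / 2 - v)) = R⁻¹ * g := by
    rw [← intervalIntegral.integral_of_le (by linarith)]
    rw [intervalIntegral.integral_comp_sub_left (fun v ↦ fejer (R * v)),
      intervalIntegral.integral_comp_mul_left _ hR0.ne', smul_eq_mul]
    have h1 : R * (u + δ / 2 - (u + δ)) = -ρ := by rw [hR]; field_simp; ring
    have h2 : R * (u + δ / 2 - u) = ρ := by rw [hR]; field_simp; ring
    rw [h1, h2]
  have hDint : Integrable (fun v ↦ (Set.Ioi (0 : ℝ)).indicator (fun v ↦ D v * fejer (R * (u + δ / 2 - v))) v) := by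
    refine Integrable.indicator ?_ measurableSet_Ioi
    exact hinteg.bdd_mul hm.aestronglyMeasurable (ae_of_all _ hb)
  have key : ∫ v, ((Set.Ioc u (u + δ)).indicator (fun v ↦ (η + C₀) * fejer (R * (u + δ / 2 - v))) v
      - C₀ * fejer (R * (u + δ / 2 - v))) ≤
      ∫ v, (Set.Ioi (0 : ℝ)).indicator (fun v ↦ D v * fejer (R * (u + δ / 2 - v))) v := by
    refine integral_mono (((hinteg.const_mul _).indicator measurableSet_Ioc).sub (hinteg.const_mul _))
      hDint fun v ↦ ?_
    have hf := fejer_nonneg (R * (u + δ / 2 - v))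
    simp only [Set.indicator_apply]
    by_cases h1 : v ∈ Set.Ioc u (u + δ)
    · have h0 : v ∈ Set.Ioi (0 : ℝ) := lt_of_le_of_lt hu h1.1
      rw [if_pos h1, if_pos h0]
      nlinarith [hD v h1]
    · rw [if_neg h1]
      have := neg_le_of_abs_le (hb v)
      split_ifs
      · nlinarith
      · nlinarith
  rw [integral_indicator measurableSet_Ioi, integral_sub ((hinteg.const_mul _).indicator measurableSet_Ioc)
    (hinteg.const_mul _), integral_indicator measurableSet_Ioc, integral_const_mul, integral_const_mul,
    e1, e2] at key
  refine le_trans ?_ key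
  have h3 : (η + C₀) * (κ - g) ≤ κ * η / 2 := by
    have : κ - g ≤ κ * η / (2 * (η + C₀)) := by linarith
    calc _ ≤ (η + C₀) * (κ * η / (2 * (η + C₀))) := by gcongr
      _ = _ := by field_simp
  have h4 : κ * η / 2 ≤ (η + C₀) * g - C₀ * κ := by linarith
  have := mul_le_mul_of_nonneg_right h4 (inv_pos.2 hR0).le
  linarith

/-- A Wiener-Ikehara type Tauberian theorem: a bounded slowly decreasing function whose Laplace
transform extends continuously to the boundary line tends to zero. -/
theorem tauberian (hm : Measurable D) (hb : ∀ v, |D v| ≤ C₀)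
    (hHc : ContinuousOn H {s | 1 ≤ s.re})
    (hH : ∀ s : ℂ, 1 < s.re → ∫ v in Set.Ioi (0 : ℝ), (D v : ℂ) * Complex.exp (-(s - 1) * v) = H s)
    (slow : ∀ η > 0, ∃ δ > 0, ∀ v ≥ 0, ∀ w, v ≤ w → w ≤ v + δ → D v - η ≤ D w) :
    Tendsto D atTop (𝓝 0) := by
  have hC₀ : 0 ≤ C₀ := (abs_nonneg _).trans (hb 0)
  rw [Metric.tendsto_atTop']
  intro η' hη'
  set η := η' / 3 with hη
  have hη0 : 0 < η := by positivity
  obtain ⟨δ, hδ, hs⟩ := slow η hη0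
  obtain ⟨R, hR, c, hc, hlow⟩ := fejer_average_lower hη0 hδ C₀ hC₀
  have ht := tendsto_fejer_average hm hb hHc hH hR
  rw [Metric.tendsto_atTop'] at ht
  obtain ⟨U, hU⟩ := ht c hc
  refine ⟨max U 0 + δ + 1, fun v hv ↦ ?_⟩
  have hv1 : U + δ + 1 < v := lt_of_le_of_lt (by gcongr; exact le_max_left _ _) hv
  have hv2 : δ + 1 < v := lt_of_le_of_lt (by linarith [le_max_right U 0]) hv
  have hlt1 : D v < 2 * η := by
    by_contra! h
    have h1 := hlow D hm hb v (by linarith) fun w hw ↦ by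
      linarith [hs v (by linarith) w hw.1.le hw.2]
    have h2 := hU (v + δ / 2) (by linarith)
    rw [Real.dist_eq, sub_zero] at h2
    linarith [le_abs_self (∫ w in Set.Ioi (0 : ℝ), D w * fejer (R * (v + δ / 2 - w)))]
  have hlt2 : -(2 * η) < D v := by
    by_contra! h
    have h1 := hlow (fun w ↦ -D w) hm.neg (by simpa using hb) (v - δ) (by linarith) fun w hw ↦ by
      have := hs w (by linarith [hw.1]) v (by linarith [hw.2]) (by linarith [hw.1])
      linarith
    have h2 := hU (v - δ + δ / 2) (by linarith)
    rw [Real.dist_eq, sub_zero] at h2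
    simp only [neg_mul, integral_neg] at h1
    linarith [neg_abs_le (∫ w in Set.Ioi (0 : ℝ), D w * fejer (R * (v - δ + δ / 2 - w)))]
  rw [Real.dist_eq, sub_zero, abs_lt]
  constructor <;> linarith

end Tauberian

end Ternary

namespace Ternary
open MeasureTheory Topology
open ArithmeticFunction (vonMangoldt)
open ArithmeticFunction.vonMangoldt (residueClass LFunctionResidueClassAux)

lemma sum_vonMangoldt_le (n : ℕ) : ∑ k ∈ Finset.Icc 1 n, vonMangoldt k ≤ 6 * n := by
  have h := Chebyshev.psi_le_const_mul_self (x := n) n.cast_nonneg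
  unfold Chebyshev.psi at h
  rw [Nat.floor_natCast] at h
  refine h.trans (mul_le_mul_of_nonneg_right ?_ n.cast_nonneg)
  have : Real.log 4 = 2 * Real.log 2 := by
    rw [show (4 : ℝ) = 2 ^ 2 by norm_num, Real.log_pow]; norm_num
  rw [this]; linarith [Real.log_two_lt_d9]

lemma sum_residueClass_bounds {q : ℕ} (a : ZMod q) (n : ℕ) :
    0 ≤ ∑ k ∈ Finset.Icc 1 n, residueClass a k ∧ ∑ k ∈ Finset.Icc 1 n, residueClass a k ≤ 6 * n := by
  refine ⟨Finset.sum_nonneg fun k _ ↦ ArithmeticFunction.vonMangoldt.residueClass_nonneg a k,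
    le_trans (Finset.sum_le_sum fun k _ ↦ ArithmeticFunction.vonMangoldt.residueClass_le a k)
      (sum_vonMangoldt_le n)⟩

/-- The prime number theorem in arithmetic progressions, for the von Mangoldt function. -/
theorem tendsto_sum_residueClass {q : ℕ} [NeZero q] {a : ZMod q} (ha : IsUnit a) :
    Tendsto (fun n : ℕ ↦ (∑ k ∈ Finset.Icc 1 n, residueClass a k) / n) atTop
      (𝓝 ((q.totient : ℝ)⁻¹)) := by
  set A : ℝ := (q.totient : ℝ)⁻¹ with hA
  have hA0 : 0 ≤ A := by positivity
  set T : ℕ → ℝ := fun n ↦ ∑ k ∈ Finset.Icc 1 n, residueClass a k with hT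
  have hTb (n : ℕ) : 0 ≤ T n ∧ T n ≤ 6 * n := sum_residueClass_bounds a n
  have hTm : Monotone T := fun m n hmn ↦ Finset.sum_le_sum_of_subset_of_nonneg
    (Finset.Icc_subset_Icc_right hmn)
    fun k _ _ ↦ ArithmeticFunction.vonMangoldt.residueClass_nonneg a k
  set E : ℝ → ℝ := fun v ↦ Real.exp (-v) * T ⌊Real.exp v⌋₊ with hE
  have hEb (v : ℝ) : 0 ≤ E v ∧ E v ≤ 6 := by
    refine ⟨mul_nonneg (Real.exp_pos _).le (hTb _).1, ?_⟩
    calc E v ≤ Real.exp (-v) * (6 * ⌊Real.exp v⌋₊) :=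
          mul_le_mul_of_nonneg_left (hTb _).2 (Real.exp_pos _).le
      _ ≤ Real.exp (-v) * (6 * Real.exp v) := by
          gcongr; exact Nat.floor_le (Real.exp_pos _).le
      _ = 6 := by rw [mul_left_comm, ← Real.exp_add]; simp
  have hEm : Measurable E := by
    have h1 : Measurable fun v : ℝ ↦ T ⌊Real.exp v⌋₊ :=
      (measurable_from_nat (f := T)).comp (Nat.measurable_floor.comp Real.measurable_exp)
    exact (Real.measurable_exp.comp measurable_neg).mul h1
  have key : Tendsto (fun v ↦ E v - A) atTop (𝓝 0) := by
    refine tauberian (C₀ := 6 + A) (H := fun s ↦ (LFunctionResidueClassAux a s - A) / s)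
      (hEm.sub_const A) ?_ ?_ ?_ ?_
    · intro v
      have := hEb v
      rw [abs_le]; constructor <;> linarith
    · refine ContinuousOn.div
        ((ArithmeticFunction.vonMangoldt.continuousOn_LFunctionResidueClassAux a).sub continuousOn_const)
        continuousOn_id fun s hs h0 ↦ ?_
      rw [h0] at hs
      norm_num at hs
    · intro s hs
      have hs0 : s ≠ 0 := fun h ↦ by rw [h] at hs; norm_num at hs
      have hs1 : s - 1 ≠ 0 := fun h ↦ by
        rw [sub_eq_zero.1 h] at hs; norm_num at hs
      have hL := ArithmeticFunction.vonMangoldt.eqOn_LFunctionResidueClassAux ha hs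
      have hLI := LSeries_eq_mul_integral_of_nonneg (residueClass a) zero_le_one (s := s) (by simpa using hs)
        (by
          simp only [Real.rpow_one]
          refine Asymptotics.isBigO_of_le' (c := 6) _ fun n ↦ ?_
          rw [Real.norm_eq_abs, abs_of_nonneg (hTb n).1, Real.norm_natCast]
          exact (hTb n).2)
        (ArithmeticFunction.vonMangoldt.residueClass_nonneg a)
      have himg : Real.exp '' Set.Ioi 0 = Set.Ioi 1 := by
        ext x
        simp only [Set.mem_image, Set.mem_Ioi]
        constructor
        · rintro ⟨y, hy, rfl⟩; exact Real.one_lt_exp_iff.2 hy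
        · intro hx; exact ⟨Real.log x, Real.log_pos hx, Real.exp_log (by linarith)⟩
      rw [← himg, integral_image_eq_integral_abs_deriv_smul measurableSet_Ioi
        (fun x _ ↦ (Real.hasDerivAt_exp x).hasDerivWithinAt) Real.exp_injective.injOn] at hLI
      have e1 : ∫ v in Set.Ioi (0 : ℝ), (E v : ℂ) * Complex.exp (-(s - 1) * v) =
          LSeries (fun n ↦ (residueClass a n : ℂ)) s / s := by
        rw [hLI, mul_div_cancel_left₀ _ hs0]
        refine integral_congr_ae (ae_of_all _ fun v ↦ ?_)
        simp only
        rw [abs_of_pos (Real.exp_pos _), Complex.real_smul, Complex.ofReal_exp, Complex.cpow_def_of_ne_zero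
          (Complex.exp_ne_zero _), ← Complex.ofReal_exp, ← Complex.ofReal_log (Real.exp_pos _).le,
          Real.log_exp, hE, hT]
        push_cast
        have : Complex.exp (v * -(s + 1)) = Complex.exp (-v) * Complex.exp (-(s-1) * v) * Complex.exp (-v) := by
          rw [← Complex.exp_add, ← Complex.exp_add]; congr 1; ring
        rw [this]
        have h2 : Complex.exp v * Complex.exp (-v) = 1 := by rw [← Complex.exp_add]; simp
        linear_combination (-(∑ k ∈ Finset.Icc 1 ⌊Real.exp v⌋₊, (residueClass a k : ℂ)) * Complex.exp (-v) * Complex.exp (-(s-1) * v)) * h2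
      have hsre : 0 < (s - 1).re := by simpa using hs
      have hIexp : IntegrableOn (fun v : ℝ ↦ Complex.exp (-(s - 1) * v)) (Set.Ioi 0) :=
        integrableOn_exp_mul_complex_Ioi (by simpa using hs) 0
      have e2 : ∫ v in Set.Ioi (0 : ℝ), (A : ℂ) * Complex.exp (-(s - 1) * v) = A / (s - 1) := by
        rw [integral_const_mul, integral_exp_mul_complex_Ioi (by simpa using hs)]
        simp
        rw [show 1 - s = -(s - 1) by ring, div_neg]
        field_simp
      have hIE : IntegrableOn (fun v : ℝ ↦ (E v : ℂ) * Complex.exp (-(s - 1) * v)) (Set.Ioi 0) := by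
        refine Integrable.bdd_mul (c := 6) hIexp (Complex.measurable_ofReal.comp hEm).aestronglyMeasurable
          (ae_of_all _ fun v ↦ ?_)
        rw [Complex.norm_real, Real.norm_eq_abs, abs_of_nonneg (hEb v).1]
        exact (hEb v).2
      have : ∫ v in Set.Ioi (0 : ℝ), ((E v - A : ℝ) : ℂ) * Complex.exp (-(s - 1) * v) =
          LSeries (fun n ↦ (residueClass a n : ℂ)) s / s - A / (s - 1) := by
        rw [← e1, ← e2, ← integral_sub hIE (hIexp.const_mul _)]
        refine integral_congr_ae (ae_of_all _ fun v ↦ ?_)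
        push_cast; ring
      rw [this]
      simp only at hL ⊢
      rw [hL]
      have hAc : ((q.totient : ℂ)⁻¹) = (A : ℂ) := by rw [hA]; push_cast; rfl
      rw [hAc]
      field_simp
      ring
    · intro η hη
      refine ⟨η / 6, by positivity, fun v hv w hvw hw ↦ ?_⟩
      have h1 : Real.exp (-w) * T ⌊Real.exp v⌋₊ ≤ E w :=
        mul_le_mul_of_nonneg_left (hTm (Nat.floor_mono (Real.exp_le_exp.2 hvw))) (Real.exp_pos _).le
      have h2 : Real.exp (-w) * T ⌊Real.exp v⌋₊ = Real.exp (-(w - v)) * E v := by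
        rw [hE]; simp only; rw [← mul_assoc, ← Real.exp_add]; congr 2; ring
      have h3 : 1 - η / 6 ≤ Real.exp (-(w - v)) := by
        linarith [Real.one_sub_le_exp_neg (w - v)]
      have := hEb v
      nlinarith
  have h1 := key.comp (Real.tendsto_log_atTop.comp tendsto_natCast_atTop_atTop)
  have h2 := h1.add_const A
  rw [zero_add] at h2
  refine h2.congr' ?_
  filter_upwards [eventually_gt_atTop 0] with n hn
  have hn' : (0 : ℝ) < n := by exact_mod_cast hn
  simp only [Function.comp, hE]
  rw [Real.exp_log hn', Real.exp_neg, Real.exp_log hn', Nat.floor_natCast]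
  ring

lemma th_le_vonMangoldt (n : ℕ) : th n ≤ vonMangoldt n := by
  unfold th
  split_ifs with h
  · rw [ArithmeticFunction.vonMangoldt_apply_prime h]
  · exact ArithmeticFunction.vonMangoldt_nonneg

lemma sum_vonMangoldt_sub_th :
    ∃ C > 0, ∀ n : ℕ, ∑ k ∈ Finset.Icc 1 n, (vonMangoldt k - th k) ≤ C * Real.sqrt n := by
  obtain ⟨C, hC⟩ := Chebyshev.psi_sub_theta_le_mul_sqrt
  refine ⟨max C 1, by positivity, fun n ↦ ?_⟩
  have h := hC n
  rw [Chebyshev.psi_sub_theta_eq_sum_not_prime, Nat.floor_natCast, Finset.sum_filter] at h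
  refine le_trans (le_of_eq ?_) (h.trans (mul_le_mul_of_nonneg_right (le_max_left _ _) (Real.sqrt_nonneg _)))
  refine Finset.sum_congr rfl fun k _ ↦ ?_
  unfold th
  split_ifs with h <;> simp_all [ArithmeticFunction.vonMangoldt_apply_prime]

/-- The prime number theorem in arithmetic progressions. -/
theorem exists_pnt_ap (W : ℕ) (hW : 0 < W) (η : ℝ) (hη : 0 < η) : ∃ C > 0, ∀ N b : ℕ,
    |∑ n ∈ Finset.Icc 1 N with n ≡ b [MOD W], th n -
      (if b.Coprime W then (N : ℝ) / W.totient else 0)| ≤ η * N + C := by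
  have : NeZero W := ⟨hW.ne'⟩
  suffices h : ∀ b : ℕ, ∃ C > 0, ∀ N : ℕ, |∑ n ∈ Finset.Icc 1 N with n ≡ b [MOD W], th n -
      (if b.Coprime W then (N : ℝ) / W.totient else 0)| ≤ η * N + C by
    choose C hC0 hC using h
    refine ⟨∑ b ∈ Finset.range W, C b, Finset.sum_pos (fun b _ ↦ hC0 b) ⟨0, by simpa using hW⟩,
      fun N b ↦ ?_⟩
    have h1 := hC (b % W) N
    have h2 : (b % W).Coprime W ↔ b.Coprime W := by
      rw [Nat.coprime_iff_gcd_eq_one, Nat.coprime_iff_gcd_eq_one, ← Nat.gcd_rec, Nat.gcd_comm]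
    have h3 : ∀ n, n ≡ b % W [MOD W] ↔ n ≡ b [MOD W] := fun n ↦ by
      simp [Nat.ModEq]
    simp only [h2, h3] at h1
    refine h1.trans (add_le_add_right ?_ _)
    exact Finset.single_le_sum (f := C) (fun i _ ↦ (hC0 i).le) (Finset.mem_range.2 (Nat.mod_lt _ hW))
  intro b
  by_cases hb : b.Coprime W
  · simp only [if_pos hb]
    have hu : IsUnit (b : ZMod W) := (ZMod.isUnit_iff_coprime b W).2 hb
    obtain ⟨C1, hC1, h1⟩ := sum_vonMangoldt_sub_th
    have hlim := tendsto_sum_residueClass hu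
    have hlim2 : Tendsto (fun n : ℕ ↦ C1 * (Real.sqrt n)⁻¹) atTop (𝓝 0) := by
      have : Tendsto (fun n : ℕ ↦ (Real.sqrt n)⁻¹) atTop (𝓝 0) :=
        (Real.tendsto_sqrt_atTop.comp tendsto_natCast_atTop_atTop).inv_tendsto_atTop
      simpa using this.const_mul C1
    rw [Metric.tendsto_atTop] at hlim hlim2
    obtain ⟨N1, hN1⟩ := hlim (η / 2) (by positivity)
    obtain ⟨N2, hN2⟩ := hlim2 (η / 2) (by positivity)
    set N0 := max (max N1 N2) 1 with hN0
    have hbound (N : ℕ) (hN : N0 ≤ N) : |∑ n ∈ Finset.Icc 1 N with n ≡ b [MOD W], th n -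
      (N : ℝ) / W.totient| ≤ η * N := by
      have hNpos : (0 : ℝ) < N := by
        have : 1 ≤ N := (le_max_right _ _).trans hN
        exact_mod_cast this
      have a1 := hN1 N (((le_max_left _ _).trans (le_max_left _ _)).trans hN)
      have a2 := hN2 N (((le_max_right _ _).trans (le_max_left _ _)).trans hN)
      rw [Real.dist_eq] at a1 a2
      rw [sub_zero] at a2
      have a2' := (le_abs_self _).trans a2.le
      have a3 : C1 * Real.sqrt N ≤ η / 2 * N := by
        have hs : 0 < Real.sqrt N := Real.sqrt_pos.2 hNpos
        have hss : Real.sqrt N * Real.sqrt N = N := Real.mul_self_sqrt hNpos.le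
        have := mul_le_mul_of_nonneg_right a2' hNpos.le
        calc C1 * Real.sqrt N = C1 * (Real.sqrt N)⁻¹ * (Real.sqrt N * Real.sqrt N) := by
              field_simp
          _ = C1 * (Real.sqrt N)⁻¹ * N := by rw [hss]
          _ ≤ _ := this
      have a4 : |∑ k ∈ Finset.Icc 1 N, residueClass (b : ZMod W) k - N / W.totient| ≤ η / 2 * N := by
        have := mul_le_mul_of_nonneg_right a1.le hNpos.le
        rw [← abs_of_pos hNpos, ← abs_mul, abs_of_pos hNpos, sub_mul,
          div_mul_cancel₀ _ hNpos.ne', inv_mul_eq_div] at this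
        exact this
      have a5 : |∑ n ∈ Finset.Icc 1 N with n ≡ b [MOD W], th n -
          ∑ k ∈ Finset.Icc 1 N, residueClass (b : ZMod W) k| ≤ η / 2 * N := by
        refine le_trans ?_ ((h1 N).trans a3)
        rw [Finset.sum_filter, ← Finset.sum_sub_distrib]
        refine (Finset.abs_sum_le_sum_abs _ _).trans (Finset.sum_le_sum fun k _ ↦ ?_)
        have hk := th_le_vonMangoldt k
        simp only [residueClass, Set.indicator_apply, Set.mem_ofPred_eq, ZMod.natCast_eq_natCast_iff]
        split_ifs
        · rw [abs_sub_comm, abs_of_nonneg (by linarith)]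
        · simp; exact hk
      have := abs_sub_le (∑ n ∈ Finset.Icc 1 N with n ≡ b [MOD W], th n)
        (∑ k ∈ Finset.Icc 1 N, residueClass (b : ZMod W) k) (N / W.totient)
      linarith
    refine ⟨∑ N ∈ Finset.range N0, |∑ n ∈ Finset.Icc 1 N with n ≡ b [MOD W], th n -
      (N : ℝ) / W.totient| + 1, by positivity, fun N ↦ ?_⟩
    have hs0 : 0 ≤ ∑ N ∈ Finset.range N0, |∑ n ∈ Finset.Icc 1 N with n ≡ b [MOD W], th n -
      (N : ℝ) / W.totient| := by positivity
    by_cases hN : N0 ≤ N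
    · linarith [hbound N hN]
    · have := Finset.single_le_sum (f := fun N : ℕ ↦ |∑ n ∈ Finset.Icc 1 N with n ≡ b [MOD W], th n -
        (N : ℝ) / W.totient|) (fun i _ ↦ abs_nonneg _) (Finset.mem_range.2 (not_le.1 hN))
      have h0 : 0 ≤ η * N := by positivity
      linarith
  · simp only [if_neg hb, sub_zero]
    refine ⟨∑ n ∈ Finset.range (W + 1), th n + 1,
      by have := Finset.sum_nonneg (fun n (_ : n ∈ Finset.range (W + 1)) ↦ th_nonneg n); linarith, fun N ↦ ?_⟩
    rw [abs_of_nonneg (Finset.sum_nonneg fun n _ ↦ th_nonneg n)]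
    have : ∑ n ∈ Finset.Icc 1 N with n ≡ b [MOD W], th n ≤ ∑ n ∈ Finset.range (W + 1), th n := by
      rw [← Finset.sum_filter_ne_zero]
      refine Finset.sum_le_sum_of_subset_of_nonneg (fun n hn ↦ ?_) fun n _ _ ↦ th_nonneg n
      rw [Finset.mem_filter] at hn
      obtain ⟨hn, h0⟩ := hn
      rw [Finset.mem_filter] at hn
      unfold th at h0
      split_ifs at h0 with hp
      · have hg : ¬ n.Coprime W := fun h ↦ hb (by
          rw [Nat.coprime_iff_gcd_eq_one] at h ⊢
          rw [← hn.2.gcd_eq]; exact h)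
        have := (Nat.Prime.dvd_iff_not_coprime hp).2 hg
        exact Finset.mem_range.2 (Nat.lt_succ_of_le (Nat.le_of_dvd hW this))
      · exact absurd rfl h0
    have h0 : 0 ≤ η * N := by positivity
    linarith

end Ternary

namespace Ternary
open ArithmeticFunction (vonMangoldt moebius)

lemma sum_Ioc_divisorsAntidiagonal {M : Type*} [AddCommMonoid M] (N : ℕ) (h : ℕ → ℕ → M) :
    ∑ n ∈ Finset.Ioc 0 N, ∑ x ∈ n.divisorsAntidiagonal, h x.1 x.2 =
      ∑ d ∈ Finset.Ioc 0 N, ∑ k ∈ Finset.Ioc 0 (N / d), h d k := by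
  rw [Finset.sum_sigma', Finset.sum_sigma']
  refine Finset.sum_nbij' (fun z ↦ ⟨z.2.1, z.2.2⟩) (fun z ↦ ⟨z.1 * z.2, (z.1, z.2)⟩) ?_ ?_ ?_ ?_ ?_
  · rintro ⟨n, d, k⟩ hz
    simp only [Finset.mem_sigma, Finset.mem_Ioc, Nat.mem_divisorsAntidiagonal] at hz ⊢
    obtain ⟨⟨h1, h2⟩, rfl, h3⟩ := hz
    have hd : 0 < d := Nat.pos_of_ne_zero fun h ↦ h3 (by simp [h])
    have hk : 0 < k := Nat.pos_of_ne_zero fun h ↦ h3 (by simp [h])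
    exact ⟨⟨hd, (Nat.le_mul_of_pos_right d hk).trans h2⟩, hk,
      (Nat.le_div_iff_mul_le hd).2 (by rwa [mul_comm])⟩
  · rintro ⟨d, k⟩ hz
    simp only [Finset.mem_sigma, Finset.mem_Ioc, Nat.mem_divisorsAntidiagonal] at hz ⊢
    obtain ⟨⟨h1, h2⟩, h3, h4⟩ := hz
    have := (Nat.le_div_iff_mul_le h1).1 h4
    exact ⟨⟨Nat.mul_pos h1 h3, by rwa [mul_comm]⟩, by trivial, (Nat.mul_pos h1 h3).ne'⟩
  · rintro ⟨n, d, k⟩ hz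
    simp only [Finset.mem_sigma, Nat.mem_divisorsAntidiagonal] at hz
    obtain ⟨-, rfl, -⟩ := hz
    rfl
  · rintro ⟨d, k⟩ _
    rfl
  · rintro ⟨n, d, k⟩ _
    rfl

lemma pmul_log_mul (f g : ArithmeticFunction ℝ) :
    (f * g).pmul ArithmeticFunction.log =
      f.pmul ArithmeticFunction.log * g + f * g.pmul ArithmeticFunction.log := by
  ext n
  simp only [ArithmeticFunction.pmul_apply, ArithmeticFunction.mul_apply, ArithmeticFunction.add_apply,
    ArithmeticFunction.log_apply]
  rw [Finset.sum_mul, ← Finset.sum_add_distrib]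
  refine Finset.sum_congr rfl fun x hx ↦ ?_
  obtain ⟨rfl, h0⟩ := Nat.mem_divisorsAntidiagonal.1 hx
  have h1 : (x.1 : ℝ) ≠ 0 := by exact_mod_cast left_ne_zero_of_mul h0
  have h2 : (x.2 : ℝ) ≠ 0 := by exact_mod_cast right_ne_zero_of_mul h0
  rw [Nat.cast_mul, Real.log_mul h1 h2]
  ring

lemma moebius_log_mul_zeta :
    (moebius : ArithmeticFunction ℝ).pmul ArithmeticFunction.log * (ArithmeticFunction.zeta : ArithmeticFunction ℝ) =
      -vonMangoldt := by
  have h := pmul_log_mul (moebius : ArithmeticFunction ℝ) (ArithmeticFunction.zeta : ArithmeticFunction ℝ)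
  rw [ArithmeticFunction.coe_moebius_mul_coe_zeta] at h
  have h1 : (1 : ArithmeticFunction ℝ).pmul ArithmeticFunction.log = 0 := by
    ext n
    rcases eq_or_ne n 1 with rfl | hn
    · simp
    · simp [ArithmeticFunction.one_apply_ne hn]
  have h2 : (ArithmeticFunction.zeta : ArithmeticFunction ℝ).pmul ArithmeticFunction.log = ArithmeticFunction.log := by
    ext n
    rcases eq_or_ne n 0 with rfl | hn
    · simp
    · simp
  rw [h1, h2, ArithmeticFunction.moebius_mul_log_eq_vonMangoldt] at h
  exact eq_neg_of_add_eq_zero_left h.symm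

lemma moebius_log_sq_mul_zeta :
    ((moebius : ArithmeticFunction ℝ).pmul ArithmeticFunction.log).pmul ArithmeticFunction.log *
      (ArithmeticFunction.zeta : ArithmeticFunction ℝ) =
      vonMangoldt * vonMangoldt - vonMangoldt.pmul ArithmeticFunction.log := by
  have h := pmul_log_mul ((moebius : ArithmeticFunction ℝ).pmul ArithmeticFunction.log)
    (ArithmeticFunction.zeta : ArithmeticFunction ℝ)
  have h2 : (ArithmeticFunction.zeta : ArithmeticFunction ℝ).pmul ArithmeticFunction.log = ArithmeticFunction.log := by
    ext n
    rcases eq_or_ne n 0 with rfl | hn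
    · simp
    · simp
  have h3 : (moebius : ArithmeticFunction ℝ).pmul ArithmeticFunction.log * ArithmeticFunction.log =
      -(vonMangoldt * vonMangoldt) := by
    have : (moebius : ArithmeticFunction ℝ).pmul ArithmeticFunction.log = -vonMangoldt * (moebius : ArithmeticFunction ℝ) := by
      rw [← moebius_log_mul_zeta, mul_assoc, ArithmeticFunction.coe_zeta_mul_coe_moebius, mul_one]
    rw [this, mul_assoc, ArithmeticFunction.moebius_mul_log_eq_vonMangoldt, neg_mul]
  rw [moebius_log_mul_zeta, h2, h3] at h
  have h4 : (-vonMangoldt).pmul ArithmeticFunction.log = -vonMangoldt.pmul ArithmeticFunction.log := by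
    ext n; simp
  rw [h4] at h
  linear_combination (exp := 1) -h

lemma sum_divisors_moebius (n : ℕ) :
    ∑ d ∈ n.divisors, (moebius d : ℝ) = if n = 1 then 1 else 0 := by
  have := congrArg (fun f : ArithmeticFunction ℝ ↦ f n)
    (ArithmeticFunction.coe_moebius_mul_coe_zeta (R := ℝ))
  simp only [ArithmeticFunction.coe_mul_zeta_apply, ArithmeticFunction.one_apply] at this
  simpa using this

lemma sum_divisors_moebius_log (n : ℕ) :
    ∑ d ∈ n.divisors, (moebius d : ℝ) * Real.log d = -vonMangoldt n := by
  have := congrArg (fun f : ArithmeticFunction ℝ ↦ f n) moebius_log_mul_zeta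
  simp only [ArithmeticFunction.coe_mul_zeta_apply, ArithmeticFunction.pmul_apply,
    ArithmeticFunction.log_apply, ArithmeticFunction.intCoe_apply] at this
  exact this

lemma sum_divisors_moebius_log_sq (n : ℕ) :
    ∑ d ∈ n.divisors, (moebius d : ℝ) * Real.log d ^ 2 =
      (vonMangoldt * vonMangoldt) n - vonMangoldt n * Real.log n := by
  have := congrArg (fun f : ArithmeticFunction ℝ ↦ f n) moebius_log_sq_mul_zeta
  simp only [ArithmeticFunction.coe_mul_zeta_apply, ArithmeticFunction.pmul_apply,
    ArithmeticFunction.log_apply, ArithmeticFunction.intCoe_apply] at this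
  refine (Finset.sum_congr rfl fun d _ ↦ ?_).trans this
  ring

/-- Selberg's identity. -/
lemma selberg_identity (y : ℝ) (n : ℕ) :
    ∑ d ∈ n.divisors, (moebius d : ℝ) * (y - Real.log d) ^ 2 =
      (if n = 1 then y ^ 2 else 0) + vonMangoldt n * (2 * y - Real.log n) +
        (vonMangoldt * vonMangoldt) n := by
  have e : ∀ d : ℕ, (moebius d : ℝ) * (y - Real.log d) ^ 2 = y ^ 2 * (moebius d : ℝ) -
      2 * y * ((moebius d : ℝ) * Real.log d) + (moebius d : ℝ) * Real.log d ^ 2 := fun d ↦ by ring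
  simp only [e]
  rw [Finset.sum_add_distrib, Finset.sum_sub_distrib, ← Finset.mul_sum, ← Finset.mul_sum,
    sum_divisors_moebius, sum_divisors_moebius_log, sum_divisors_moebius_log_sq]
  split_ifs <;> ring

lemma sum_vonMangoldt_le' (n : ℕ) : ∑ k ∈ Finset.Ioc 0 n, vonMangoldt k ≤ 6 * n := by
  have := sum_vonMangoldt_le n
  rwa [← Finset.Icc_add_one_left_eq_Ioc, zero_add]

lemma sum_vonMangoldt_div_le (M : ℕ) (hM : 1 ≤ M) :
    ∑ m ∈ Finset.Ioc 0 M, vonMangoldt m / m ≤ Real.log M + 6 := by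
  have hM' : (0 : ℝ) < M := by exact_mod_cast hM
  have h1 := ArithmeticFunction.sum_Ioc_mul_zeta_eq_sum vonMangoldt M
  rw [ArithmeticFunction.vonMangoldt_mul_zeta] at h1
  have h2 : ∑ n ∈ Finset.Ioc 0 M, ArithmeticFunction.log n ≤ M * Real.log M := by
    calc _ ≤ ∑ n ∈ Finset.Ioc 0 M, Real.log M := by
          refine Finset.sum_le_sum fun n hn ↦ ?_
          rw [Finset.mem_Ioc] at hn
          rw [ArithmeticFunction.log_apply]
          exact Real.log_le_log (by exact_mod_cast hn.1) (by exact_mod_cast hn.2)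
      _ = _ := by simp
  have h3 : M * ∑ m ∈ Finset.Ioc 0 M, vonMangoldt m / m ≤
      ∑ m ∈ Finset.Ioc 0 M, vonMangoldt m * ((M / m : ℕ) : ℝ) + ∑ m ∈ Finset.Ioc 0 M, vonMangoldt m := by
    rw [Finset.mul_sum, ← Finset.sum_add_distrib]
    refine Finset.sum_le_sum fun m hm ↦ ?_
    rw [Finset.mem_Ioc] at hm
    have hm0 : (0 : ℝ) < m := by exact_mod_cast hm.1
    have : (M : ℝ) / m ≤ ((M / m : ℕ) : ℝ) + 1 := by
      rw [← Nat.floor_div_eq_div (K := ℝ)]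
      exact (Nat.lt_floor_add_one _).le
    have := mul_le_mul_of_nonneg_left this (ArithmeticFunction.vonMangoldt_nonneg (n := m))
    calc _ = vonMangoldt m * (M / m) := by ring
      _ ≤ _ := by linarith
  have h4 := sum_vonMangoldt_le' M
  have : M * ∑ m ∈ Finset.Ioc 0 M, vonMangoldt m / m ≤ M * (Real.log M + 6) := by linarith
  exact le_of_mul_le_mul_left this hM'

lemma sum_vonMangoldt_mul_self_le (M : ℕ) (hM : 1 ≤ M) :
    ∑ n ∈ Finset.Ioc 0 M, (vonMangoldt * vonMangoldt) n ≤ 6 * M * (Real.log M + 6) := by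
  rw [ArithmeticFunction.sum_Ioc_mul_eq_sum_sum]
  calc _ ≤ ∑ n ∈ Finset.Ioc 0 M, 6 * M * (vonMangoldt n / n) := by
        refine Finset.sum_le_sum fun n hn ↦ ?_
        have h1 : ((M / n : ℕ) : ℝ) ≤ M / n := Nat.cast_div_le
        have h2 := (sum_vonMangoldt_le' (M / n)).trans (mul_le_mul_of_nonneg_left h1 (by norm_num))
        have := mul_le_mul_of_nonneg_left h2 (ArithmeticFunction.vonMangoldt_nonneg (n := n))
        calc _ ≤ _ := this
          _ = _ := by ring
    _ ≤ _ := by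
        rw [← Finset.mul_sum]
        exact mul_le_mul_of_nonneg_left (sum_vonMangoldt_div_le M hM) (by positivity)

lemma sum_inv_sqrt_le (M : ℕ) : ∑ d ∈ Finset.Ioc 0 M, (Real.sqrt d)⁻¹ ≤ 2 * Real.sqrt M := by
  induction M with
  | zero => simp
  | succ M ih =>
    rw [Finset.sum_Ioc_succ_top (Nat.zero_le _)]
    refine (add_le_add_left ih _).trans ?_
    have hs : 0 < Real.sqrt ((M + 1 : ℕ) : ℝ) := Real.sqrt_pos.2 (by positivity)
    have h1 : Real.sqrt ((M + 1 : ℕ) : ℝ) ^ 2 = M + 1 := by rw [Real.sq_sqrt (by positivity)]; push_cast; ring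
    have h2 : Real.sqrt (M : ℝ) ^ 2 = M := Real.sq_sqrt (by positivity)
    have h3 : (Real.sqrt ((M + 1 : ℕ) : ℝ))⁻¹ * Real.sqrt ((M + 1 : ℕ) : ℝ) = 1 := inv_mul_cancel₀ hs.ne'
    have : (2 * Real.sqrt M + (Real.sqrt ((M + 1 : ℕ) : ℝ))⁻¹) * Real.sqrt ((M + 1 : ℕ) : ℝ) ≤
      (2 * Real.sqrt ((M + 1 : ℕ) : ℝ)) * Real.sqrt ((M + 1 : ℕ) : ℝ) := by
      nlinarith [sq_nonneg (Real.sqrt ((M + 1 : ℕ) : ℝ) - Real.sqrt M)]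
    exact le_of_mul_le_mul_right this hs

lemma log_pow_le_sqrt {i : ℕ} (hi : i ≤ 2) {y : ℝ} (hy : 1 ≤ y) : Real.log y ^ i ≤ 16 * Real.sqrt y := by
  have hs1 : 1 ≤ Real.sqrt y := Real.one_le_sqrt.2 hy
  have hs2 : 1 ≤ Real.sqrt (Real.sqrt y) := Real.one_le_sqrt.2 hs1
  have h0 : 0 ≤ Real.log y := Real.log_nonneg hy
  have h1 : Real.log y ≤ 4 * Real.sqrt (Real.sqrt y) := by
    have e : Real.log y = 4 * Real.log (Real.sqrt (Real.sqrt y)) := by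
      rw [Real.log_sqrt (by positivity), Real.log_sqrt (by positivity)]; ring
    rw [e]
    have := Real.log_le_sub_one_of_pos (x := Real.sqrt (Real.sqrt y)) (by positivity)
    linarith
  have h2 : Real.sqrt (Real.sqrt y) ^ 2 = Real.sqrt y := Real.sq_sqrt (by positivity)
  interval_cases i
  · simp; linarith
  · rw [pow_one]; nlinarith
  · nlinarith

lemma sum_log_div_le {i : ℕ} (hi : i ≤ 2) {x : ℝ} (hx : 1 ≤ x) :
    ∑ d ∈ Finset.Ioc 0 ⌊x⌋₊, Real.log (x / d) ^ i ≤ 32 * x := by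
  calc _ ≤ ∑ d ∈ Finset.Ioc 0 ⌊x⌋₊, 16 * Real.sqrt x * (Real.sqrt d)⁻¹ := by
        refine Finset.sum_le_sum fun d hd ↦ ?_
        rw [Finset.mem_Ioc] at hd
        have hd0 : (0 : ℝ) < d := by exact_mod_cast hd.1
        have hdx : (d : ℝ) ≤ x := (Nat.le_floor_iff (by linarith)).1 hd.2
        refine (log_pow_le_sqrt hi ((one_le_div hd0).2 hdx)).trans_eq ?_
        rw [Real.sqrt_div (by linarith)]; ring
    _ ≤ 16 * Real.sqrt x * (2 * Real.sqrt ⌊x⌋₊) := by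
        rw [← Finset.mul_sum]
        exact mul_le_mul_of_nonneg_left (sum_inv_sqrt_le _) (by positivity)
    _ ≤ 16 * Real.sqrt x * (2 * Real.sqrt x) := by
        gcongr; exact Nat.floor_le (by linarith)
    _ = 32 * (Real.sqrt x * Real.sqrt x) := by ring
    _ = 32 * x := by rw [Real.mul_self_sqrt (by linarith)]

/-- The logarithmically weighted Moebius sum over integers prime to all elements of `P`. -/
noncomputable def muSum (P : Finset ℕ) (i : ℕ) (x : ℝ) : ℝ :=
  ∑ j ∈ Finset.Ioc 0 ⌊x⌋₊ with ∀ p ∈ P, ¬ p ∣ j, (moebius j : ℝ) / j * Real.log (x / j) ^ i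

lemma sum_divisors_moebius_log_pow_le {i : ℕ} (hi : i ≤ 2) {x : ℝ} (hx : 1 ≤ x) :
    |∑ n ∈ Finset.Ioc 0 ⌊x⌋₊, ∑ d ∈ n.divisors, (moebius d : ℝ) * (Real.log x - Real.log d) ^ i| ≤
      60 * x * (1 + Real.log x) ^ (i - 1) := by
  have hM : 1 ≤ ⌊x⌋₊ := (Nat.one_le_floor_iff x).2 hx
  have hMx : (⌊x⌋₊ : ℝ) ≤ x := Nat.floor_le (by linarith)
  have hlx : 0 ≤ Real.log x := Real.log_nonneg hx
  have hlx2 : Real.log x ≤ x := by linarith [Real.log_le_sub_one_of_pos (x := x) (by linarith)]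
  have hif (c : ℝ) : ∑ n ∈ Finset.Ioc 0 ⌊x⌋₊, (if n = 1 then c else 0) = c := by
    rw [Finset.sum_ite_eq' (Finset.Ioc 0 ⌊x⌋₊) 1 (fun _ ↦ c), if_pos (by simpa using hM)]
  have hL0 (n : ℕ) (hn : n ∈ Finset.Ioc 0 ⌊x⌋₊) : 0 ≤ Real.log n ∧ Real.log n ≤ Real.log x := by
    rw [Finset.mem_Ioc] at hn
    refine ⟨Real.log_natCast_nonneg n, Real.log_le_log (by exact_mod_cast hn.1) ?_⟩
    exact (Nat.cast_le.2 hn.2).trans hMx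
  have hpsi := sum_vonMangoldt_le' ⌊x⌋₊
  have hpsi0 : 0 ≤ ∑ k ∈ Finset.Ioc 0 ⌊x⌋₊, vonMangoldt k :=
    Finset.sum_nonneg fun _ _ ↦ ArithmeticFunction.vonMangoldt_nonneg
  interval_cases i
  · simp only [pow_zero, mul_one, sum_divisors_moebius, hif]
    simp; linarith
  · have e (n : ℕ) : ∑ d ∈ n.divisors, (moebius d : ℝ) * (Real.log x - Real.log d) ^ 1 =
        (if n = 1 then Real.log x else 0) + vonMangoldt n := by
      simp only [pow_one, mul_sub, Finset.sum_sub_distrib, sum_divisors_moebius_log,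
        ← Finset.sum_mul, sum_divisors_moebius]
      split_ifs <;> ring
    simp only [e, Finset.sum_add_distrib, hif]
    rw [abs_of_nonneg (by linarith)]
    simp; linarith
  · simp only [selberg_identity, Finset.sum_add_distrib, hif]
    have hmul0 : 0 ≤ ∑ n ∈ Finset.Ioc 0 ⌊x⌋₊, (vonMangoldt * vonMangoldt) n := by
      refine Finset.sum_nonneg fun n _ ↦ ?_
      rw [ArithmeticFunction.mul_apply]
      exact Finset.sum_nonneg fun _ _ ↦ mul_nonneg ArithmeticFunction.vonMangoldt_nonneg
        ArithmeticFunction.vonMangoldt_nonneg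
    have h1 := sum_vonMangoldt_mul_self_le ⌊x⌋₊ hM
    have h2 : 0 ≤ ∑ n ∈ Finset.Ioc 0 ⌊x⌋₊, vonMangoldt n * (2 * Real.log x - Real.log n) :=
      Finset.sum_nonneg fun n hn ↦ mul_nonneg ArithmeticFunction.vonMangoldt_nonneg
        (by linarith [hL0 n hn])
    have h3 : ∑ n ∈ Finset.Ioc 0 ⌊x⌋₊, vonMangoldt n * (2 * Real.log x - Real.log n) ≤
        6 * x * (2 * Real.log x) := by
      calc _ ≤ ∑ n ∈ Finset.Ioc 0 ⌊x⌋₊, vonMangoldt n * (2 * Real.log x) :=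
            Finset.sum_le_sum fun n hn ↦ mul_le_mul_of_nonneg_left
              (by linarith [hL0 n hn]) ArithmeticFunction.vonMangoldt_nonneg
        _ = (∑ n ∈ Finset.Ioc 0 ⌊x⌋₊, vonMangoldt n) * (2 * Real.log x) := by rw [Finset.sum_mul]
        _ ≤ _ := by
            refine mul_le_mul_of_nonneg_right ?_ (by linarith)
            linarith
    have h4 : 6 * (⌊x⌋₊ : ℝ) * (Real.log ⌊x⌋₊ + 6) ≤ 6 * x * (Real.log x + 6) := by
      have : Real.log ⌊x⌋₊ ≤ Real.log x := Real.log_le_log (by exact_mod_cast hM) hMx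
      have h0 := Real.log_natCast_nonneg ⌊x⌋₊
      gcongr
    rw [abs_of_nonneg (by positivity)]
    simp only [Nat.add_one_sub_one, pow_one]
    nlinarith [mul_nonneg (by linarith : (0:ℝ) ≤ x) hlx]

lemma muSum_empty_le {i : ℕ} (hi : i ≤ 2) {x : ℝ} (hx : 1 ≤ x) :
    |muSum ∅ i x| ≤ 100 * (1 + Real.log x) ^ (i - 1) := by
  have hx0 : 0 < x := by linarith
  have hlx : 0 ≤ Real.log x := Real.log_nonneg hx
  have h1 := sum_divisors_moebius_log_pow_le hi hx
  have h2 : ∑ n ∈ Finset.Ioc 0 ⌊x⌋₊, ∑ d ∈ n.divisors, (moebius d : ℝ) * (Real.log x - Real.log d) ^ i =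
      ∑ d ∈ Finset.Ioc 0 ⌊x⌋₊, (moebius d : ℝ) * (Real.log x - Real.log d) ^ i * ((⌊x⌋₊ / d : ℕ) : ℝ) := by
    have := sum_Ioc_divisorsAntidiagonal ⌊x⌋₊ fun d _ ↦ (moebius d : ℝ) * (Real.log x - Real.log d) ^ i
    simp only [Finset.sum_const, Nat.card_Ioc, tsub_zero, nsmul_eq_mul] at this
    rw [Finset.sum_congr rfl fun d _ ↦ mul_comm _ _, ← this]
    refine Finset.sum_congr rfl fun n _ ↦ ?_
    exact (Nat.sum_divisorsAntidiagonal fun d _ ↦ (moebius d : ℝ) * (Real.log x - Real.log d) ^ i).symm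
  have h3 : |x * muSum ∅ i x - ∑ d ∈ Finset.Ioc 0 ⌊x⌋₊, (moebius d : ℝ) * (Real.log x - Real.log d) ^ i *
      ((⌊x⌋₊ / d : ℕ) : ℝ)| ≤ 32 * x := by
    unfold muSum
    rw [Finset.filter_true_of_mem (by simp), Finset.mul_sum, ← Finset.sum_sub_distrib]
    refine (Finset.abs_sum_le_sum_abs _ _).trans (le_trans (Finset.sum_le_sum fun d hd ↦ ?_) (sum_log_div_le hi hx))
    rw [Finset.mem_Ioc] at hd
    have hd0 : (0 : ℝ) < d := by exact_mod_cast hd.1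
    have hdx : (d : ℝ) ≤ x := (Nat.le_floor_iff (by linarith)).1 hd.2
    have hlog : 0 ≤ Real.log (x / d) := Real.log_nonneg ((one_le_div hd0).2 hdx)
    rw [← Real.log_div hx0.ne' hd0.ne', ← Nat.floor_div_natCast]
    have e : x * ((moebius d : ℝ) / d * Real.log (x / d) ^ i) -
        (moebius d : ℝ) * Real.log (x / d) ^ i * (⌊x / d⌋₊ : ℝ) =
        (moebius d : ℝ) * (Real.log (x / d) ^ i * (x / d - ⌊x / d⌋₊)) := by ring
    rw [e, abs_mul, abs_mul, abs_of_nonneg (pow_nonneg hlog i)]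
    have hm : |(moebius d : ℝ)| ≤ 1 := by
      rw [← Int.cast_abs]; exact_mod_cast ArithmeticFunction.abs_moebius_le_one
    have hf : |x / d - (⌊x / d⌋₊ : ℝ)| ≤ 1 := by
      have := Nat.floor_le (a := x / d) (by positivity)
      have := Nat.lt_floor_add_one (x / d)
      rw [abs_le]; constructor <;> linarith
    calc _ ≤ 1 * (Real.log (x / d) ^ i * 1) := by gcongr
      _ = _ := by ring
  rw [← h2] at h3
  have h4 : x * |muSum ∅ i x| ≤ x * (100 * (1 + Real.log x) ^ (i - 1)) := by
    rw [← abs_of_pos hx0, ← abs_mul, abs_of_pos hx0]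
    have h5 := abs_sub_abs_le_abs_sub (x * muSum ∅ i x) (∑ n ∈ Finset.Ioc 0 ⌊x⌋₊, ∑ d ∈ n.divisors,
      (moebius d : ℝ) * (Real.log x - Real.log d) ^ i)
    have h6 : 1 ≤ (1 + Real.log x) ^ (i - 1) := one_le_pow₀ (by linarith)
    nlinarith
  exact le_of_mul_le_mul_left h4 hx0

lemma muSum_insert {P : Finset ℕ} (hP : ∀ p ∈ P, p.Prime) {p : ℕ} (hp : p.Prime) (hpP : p ∉ P)
    (i : ℕ) (x : ℝ) :
    muSum (insert p P) i x = muSum P i x + 1 / p * muSum (insert p P) i (x / p) := by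
  have hp0 : (p : ℝ) ≠ 0 := by exact_mod_cast hp.ne_zero
  have h1 : muSum P i x = muSum (insert p P) i x +
      ∑ j ∈ (Finset.Ioc 0 ⌊x⌋₊).filter (fun j ↦ (∀ r ∈ P, ¬ r ∣ j) ∧ p ∣ j),
        (moebius j : ℝ) / j * Real.log (x / j) ^ i := by
    unfold muSum
    rw [← Finset.sum_filter_add_sum_filter_not ((Finset.Ioc 0 ⌊x⌋₊).filter fun j ↦ ∀ r ∈ P, ¬ r ∣ j) (fun j ↦ ¬ p ∣ j),
      Finset.filter_filter, Finset.filter_filter]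
    congr 1
    · refine Finset.sum_congr (Finset.filter_congr fun j _ ↦ ?_) fun _ _ ↦ rfl
      simp [and_comm]
    · refine Finset.sum_congr (Finset.filter_congr fun j _ ↦ ?_) fun _ _ ↦ rfl
      simp
  have h2 : ∑ j ∈ (Finset.Ioc 0 ⌊x⌋₊).filter (fun j ↦ (∀ r ∈ P, ¬ r ∣ j) ∧ p ∣ j),
        (moebius j : ℝ) / j * Real.log (x / j) ^ i = -(1 / p * muSum (insert p P) i (x / p)) := by
    unfold muSum
    rw [Finset.mul_sum, ← Finset.sum_neg_distrib]
    symm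
    refine Finset.sum_of_injOn (p * ·) (fun a _ b _ h ↦ Nat.eq_of_mul_eq_mul_left hp.pos h) ?_ ?_ ?_
    · intro k hk
      rw [Finset.mem_coe, Finset.mem_filter, Finset.mem_Ioc, Nat.floor_div_natCast, Nat.le_div_iff_mul_le hp.pos] at hk
      show p * k ∈ _
      rw [Finset.mem_coe, Finset.mem_filter, Finset.mem_Ioc]
      refine ⟨⟨Nat.mul_pos hp.pos hk.1.1, by rw [mul_comm]; exact hk.1.2⟩, fun r hr hd ↦ ?_, dvd_mul_right _ _⟩
      rcases (hP r hr).dvd_mul.1 hd with h | h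
      · exact hpP (((Nat.prime_dvd_prime_iff_eq (hP r hr) hp).1 h) ▸ hr)
      · exact hk.2 r (Finset.mem_insert_of_mem hr) h
    · intro j hj hn
      rw [Finset.mem_filter, Finset.mem_Ioc] at hj
      obtain ⟨⟨hj0, hjx⟩, hjP, l, rfl⟩ := hj
      have hl : p ∣ l := by
        by_contra hl
        refine hn ⟨l, ?_, rfl⟩
        rw [Finset.mem_coe, Finset.mem_filter, Finset.mem_Ioc, Nat.floor_div_natCast, Nat.le_div_iff_mul_le hp.pos]
        refine ⟨⟨Nat.pos_of_mul_pos_left hj0, by rwa [mul_comm]⟩, fun r hr hd ↦ ?_⟩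
        rcases Finset.mem_insert.1 hr with rfl | hr
        · exact hl hd
        · exact hjP r hr (hd.mul_left _)
      have : moebius (p * l) = 0 := by
        rw [ArithmeticFunction.moebius_eq_zero_of_not_squarefree]
        intro hsq
        exact hp.not_isUnit (hsq p (Nat.mul_dvd_mul_left p hl))
      rw [this]; simp
    · intro k hk
      rw [Finset.mem_filter, Finset.mem_Ioc] at hk
      have hk0 : (k : ℝ) ≠ 0 := by exact_mod_cast hk.1.1.ne'
      have hc : p.Coprime k := (Nat.Prime.coprime_iff_not_dvd hp).2 (hk.2 p (Finset.mem_insert_self _ _))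
      have hmu : moebius (p * k) = -moebius k := by
        rw [ArithmeticFunction.isMultiplicative_moebius.map_mul_of_coprime hc,
          ArithmeticFunction.moebius_apply_prime hp]; ring
      show _ = (moebius (p * k) : ℝ) / ((p * k : ℕ) : ℝ) * Real.log (x / ((p * k : ℕ) : ℝ)) ^ i
      rw [hmu, Nat.cast_mul, div_div]
      push_cast
      field_simp
  rw [h1, h2]; ring

lemma muSum_eq_zero (P : Finset ℕ) (i : ℕ) {x : ℝ} (hx : x < 1) : muSum P i x = 0 := by
  unfold muSum
  rw [Nat.floor_eq_zero.2 hx]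
  simp

lemma muSum_le {i : ℕ} (hi : i ≤ 2) {X : ℝ} (hX : 1 ≤ X) (P : Finset ℕ) (hP : ∀ p ∈ P, p.Prime) :
    ∀ x : ℝ, 0 ≤ x → x ≤ X →
      |muSum P i x| ≤ 100 * (1 + Real.log X) ^ (i - 1) * ∏ p ∈ P, (1 - (p : ℝ)⁻¹)⁻¹ := by
  have hlX : 0 ≤ Real.log X := Real.log_nonneg hX
  induction P using Finset.induction_on with
  | empty =>
    intro x hx0 hx
    rw [Finset.prod_empty, mul_one]
    rcases lt_or_ge x 1 with h | h
    · rw [muSum_eq_zero _ _ h, abs_zero]; positivity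
    · have := Real.log_le_log (by linarith) hx
      have := Real.log_nonneg h
      refine (muSum_empty_le hi h).trans ?_
      gcongr
  | insert p P hpP ih =>
    rw [Finset.forall_mem_insert] at hP
    obtain ⟨hp, hP⟩ := hP
    have ih := ih hP
    have hp2 : (2 : ℝ) ≤ p := by exact_mod_cast hp.two_le
    have hpi : 0 < 1 - (p : ℝ)⁻¹ := by
      have : (p : ℝ)⁻¹ < 1 := inv_lt_one_of_one_lt₀ (by linarith)
      linarith
    rw [Finset.prod_insert hpP]
    set B := 100 * (1 + Real.log X) ^ (i - 1) * ∏ p ∈ P, (1 - (p : ℝ)⁻¹)⁻¹ with hB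
    have hB0 : 0 ≤ B := (abs_nonneg _).trans (ih 0 le_rfl (by linarith))
    have e : 100 * (1 + Real.log X) ^ (i - 1) * ((1 - (p : ℝ)⁻¹)⁻¹ * ∏ p ∈ P, (1 - (p : ℝ)⁻¹)⁻¹) =
        B * (1 - (p : ℝ)⁻¹)⁻¹ := by rw [hB]; ring
    rw [e]
    have key : ∀ n : ℕ, ∀ x : ℝ, 0 ≤ x → x ≤ X → x < 2 ^ n →
        |muSum (insert p P) i x| ≤ B * (1 - (p : ℝ)⁻¹)⁻¹ := by
      intro n
      induction n with
      | zero =>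
        intro x _ _ h
        rw [muSum_eq_zero _ _ (by simpa using h), abs_zero]
        positivity
      | succ n ihn =>
        intro x hx0 hxX hxn
        rw [muSum_insert hP hp hpP i x]
        have hxp : x / p ≤ x / 2 := by gcongr
        have h1 := ihn (x / p) (by positivity) (by linarith) (by rw [pow_succ] at hxn; linarith)
        have h2 := ih x hx0 hxX
        calc _ ≤ |muSum P i x| + |1 / (p : ℝ) * muSum (insert p P) i (x / p)| := abs_add_le _ _
          _ ≤ B + 1 / p * (B * (1 - (p : ℝ)⁻¹)⁻¹) := by
              rw [abs_mul, abs_of_nonneg (by positivity : (0 : ℝ) ≤ 1 / p)]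
              gcongr
          _ = B * (1 - (p : ℝ)⁻¹)⁻¹ * ((1 - (p : ℝ)⁻¹) + (p : ℝ)⁻¹) := by
              rw [mul_add, mul_assoc B _ (1 - (p : ℝ)⁻¹), inv_mul_cancel₀ hpi.ne']; ring
          _ = B * (1 - (p : ℝ)⁻¹)⁻¹ := by ring
    intro x hx0 hx
    obtain ⟨n, hn⟩ := pow_unbounded_of_one_lt x (one_lt_two (α := ℝ))
    exact key n x hx0 hx hn

lemma prod_primeFactors_inv (q : ℕ) (hq : 0 < q) :
    ∏ p ∈ q.primeFactors, (1 - (p : ℝ)⁻¹)⁻¹ = q / q.totient := by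
  have h := Nat.totient_eq_mul_prod_factors q
  have h' : (q.totient : ℝ) = q * ∏ p ∈ q.primeFactors, (1 - (p : ℝ)⁻¹) := by
    have := congrArg (fun r : ℚ ↦ (r : ℝ)) h
    push_cast at this
    exact this
  have hq0 : (q : ℝ) ≠ 0 := by exact_mod_cast hq.ne'
  have hphi : (q.totient : ℝ) ≠ 0 := by exact_mod_cast (Nat.totient_pos.2 hq).ne'
  rw [Finset.prod_inv_distrib, eq_div_iff hphi, h']
  rw [h'] at hphi
  rw [mul_comm (q : ℝ), ← mul_assoc, inv_mul_cancel₀ (right_ne_zero_of_mul hphi), one_mul]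

/-- Moebius sums over `j` coprime to `q`. -/
lemma muSum_primeFactors_le {i : ℕ} (hi : i ≤ 2) {x : ℝ} (hx : 1 ≤ x) (q : ℕ) (hq : 0 < q) :
    |∑ j ∈ Finset.Ioc 0 ⌊x⌋₊ with q.Coprime j, (moebius j : ℝ) / j * Real.log (x / j) ^ i| ≤
      100 * (1 + Real.log x) ^ (i - 1) * (q / q.totient) := by
  have := muSum_le hi hx q.primeFactors (fun p hp ↦ Nat.prime_of_mem_primeFactors hp) x (by linarith) le_rfl
  rw [prod_primeFactors_inv q hq] at this
  refine le_trans (le_of_eq ?_) this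
  unfold muSum
  congr 1
  refine Finset.sum_congr (Finset.filter_congr fun j _ ↦ ?_) fun _ _ ↦ rfl
  constructor
  · intro h p hp hd
    have hp' := Nat.prime_of_mem_primeFactors hp
    exact hp'.one_lt.ne' (Nat.eq_one_of_dvd_coprimes h (Nat.dvd_of_mem_primeFactors hp) hd)
  · intro h
    refine Nat.coprime_of_dvd fun p hp hd hj ↦ h p ?_ hj
    exact Nat.mem_primeFactors.2 ⟨hp, hd, hq.ne'⟩

end Ternary

namespace Ternary

lemma norm_ee_sub_one_le (x : ℝ) : ‖ee x - 1‖ ≤ 2 * Real.pi * |x| := by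
  have := Real.norm_exp_I_mul_ofReal_sub_one_le (x := 2 * Real.pi * x)
  rw [Real.norm_eq_abs, abs_mul, abs_of_pos (by positivity : (0 : ℝ) < 2 * Real.pi)] at this
  refine le_trans (le_of_eq ?_) this
  unfold ee
  push_cast
  ring_nf

lemma nd_intCast_div_ge {q : ℕ} (hq : 0 < q) {m : ℤ} (hm : ¬ (q : ℤ) ∣ m) :
    1 / (q : ℝ) ≤ nd ((m : ℝ) / q) := by
  have hq' : (0 : ℝ) < q := by exact_mod_cast hq
  have h1 : (m : ℝ) / q - round ((m : ℝ) / q) = ((m - round ((m : ℝ) / q) * q : ℤ) : ℝ) / q := by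
    push_cast; field_simp
  rw [nd, h1, abs_div, abs_of_pos hq']
  gcongr
  have : m - round ((m : ℝ) / q) * q ≠ 0 := fun h ↦ hm ⟨round ((m : ℝ) / q), by linarith⟩
  exact_mod_cast Int.one_le_abs this

lemma inv_nd_div_le {q b : ℕ} (hb : 0 < b) (hbq : b < q) :
    (nd ((b : ℝ) / q))⁻¹ ≤ q / b + q / (q - b) := by
  have hq' : (0 : ℝ) < q := by exact_mod_cast (hb.trans hbq)
  have hb' : (0 : ℝ) < b := by exact_mod_cast hb
  have hbq' : (b : ℝ) < q := by exact_mod_cast hbq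
  have h1 : 0 < (q : ℝ) / b := by positivity
  have h2 : 0 < (q : ℝ) / (q - b) := div_pos hq' (by linarith)
  have h3 : (b : ℝ) / q ≤ nd ((b : ℝ) / q) ∨ 1 - (b : ℝ) / q ≤ nd ((b : ℝ) / q) := by
    unfold nd
    rcases le_or_gt (round ((b : ℝ) / q)) 0 with h | h
    · left
      have : (round ((b : ℝ) / q) : ℝ) ≤ 0 := by exact_mod_cast h
      exact le_trans (by linarith) (le_abs_self _)
    · right
      have : (1 : ℝ) ≤ (round ((b : ℝ) / q) : ℝ) := by exact_mod_cast h
      exact le_trans (by linarith) (neg_le_abs _)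
  rcases h3 with h | h
  · have := inv_anti₀ (by positivity) h
    rw [inv_div] at this
    linarith
  · have e : 1 - (b : ℝ) / q = (q - b) / q := by field_simp
    rw [e] at h
    have := inv_anti₀ (div_pos (by linarith) hq') h
    rw [inv_div] at this
    linarith

lemma sum_inv_nd_div_le (q : ℕ) :
    ∑ b ∈ Finset.range q, (if b = 0 then 0 else (nd ((b : ℝ) / q))⁻¹) ≤ 2 * q * (1 + Real.log q) := by
  rcases Nat.eq_zero_or_pos q with rfl | hq
  · simp
  have hh : ∑ i ∈ Finset.range q, (q : ℝ) / (i + 1) ≤ q * (1 + Real.log q) := by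
    have := harmonic_le_one_add_log q
    rw [harmonic] at this
    push_cast at this
    simp only [div_eq_mul_inv]
    rw [← Finset.mul_sum]
    gcongr
  have h1 : ∑ b ∈ Finset.range q, (q : ℝ) / b ≤ ∑ i ∈ Finset.range q, (q : ℝ) / (i + 1) := by
    obtain ⟨k, rfl⟩ : ∃ k, q = k + 1 := ⟨q - 1, by omega⟩
    rw [Finset.sum_range_succ', Finset.sum_range_succ]
    push_cast
    simp only [div_zero]
    gcongr
    positivity
  have h2 : ∑ b ∈ Finset.range q, (q : ℝ) / (q - b) = ∑ i ∈ Finset.range q, (q : ℝ) / (i + 1) := by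
    rw [← Finset.sum_range_reflect]
    refine Finset.sum_congr rfl fun j hj ↦ ?_
    rw [Finset.mem_range] at hj
    congr 1
    rw [Nat.sub_sub, Nat.cast_sub (by omega)]; push_cast; ring
  calc _ ≤ ∑ b ∈ Finset.range q, ((q : ℝ) / b + q / (q - b)) := by
        refine Finset.sum_le_sum fun b hb ↦ ?_
        rw [Finset.mem_range] at hb
        have hb' : (b : ℝ) < q := by exact_mod_cast hb
        split_ifs with h0
        · have : 0 ≤ (q : ℝ) / (q - b) := div_nonneg (by positivity) (by linarith)
          positivity
        · exact inv_nd_div_le (by omega) hb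
    _ ≤ _ := by rw [Finset.sum_add_distrib]; linarith

lemma sum_inv_nd_mul_le (r : ℚ) :
    ∑ s ∈ Finset.range r.den, (if r.den ∣ s then 0 else (nd (s * r))⁻¹) ≤
      2 * r.den * (1 + Real.log r.den) := by
  set q := r.den with hq
  have hq0 : 0 < q := r.den_pos
  have hqz : (q : ℤ) ≠ 0 := by exact_mod_cast hq0.ne'
  have hqr : (q : ℝ) ≠ 0 := by exact_mod_cast hq0.ne'
  set e : ℕ → ℕ := fun s ↦ ((s * r.num) % q).toNat with he
  have hcop : IsCoprime (q : ℤ) r.num := (Int.isCoprime_iff_gcd_eq_one.2 (by simpa [Int.gcd] using r.reduced)).symm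
  have hes (s : ℕ) : ((e s : ℕ) : ℤ) = (s * r.num) % q := Int.toNat_of_nonneg (Int.emod_nonneg _ hqz)
  have hlt (s : ℕ) : e s < q := by
    have := Int.emod_lt_of_pos (s * r.num) (by exact_mod_cast hq0 : (0 : ℤ) < q)
    rw [← hes] at this; exact_mod_cast this
  have hinj : Set.InjOn e (Finset.range q) := by
    intro a ha b hb h
    have h1 : ((a : ℤ) * r.num) % q = (b * r.num) % q := by rw [← hes, ← hes, h]
    have h2 : (q : ℤ) ∣ (a - b) * r.num := by
      have := Int.ModEq.dvd (show ((b : ℤ) * r.num) ≡ (a * r.num) [ZMOD q] from h1.symm)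
      rwa [← sub_mul] at this
    have h3 := hcop.dvd_of_dvd_mul_right h2
    rw [Finset.mem_coe, Finset.mem_range] at ha hb
    have h4 : (a : ℤ) - b = 0 := by
      refine Int.eq_zero_of_abs_lt_dvd h3 ?_
      rw [abs_lt]; constructor <;> omega
    omega
  have hf (s : ℕ) : (if q ∣ s then 0 else (nd (s * r))⁻¹) =
      (if e s = 0 then 0 else (nd ((e s : ℝ) / q))⁻¹) := by
    have h1 : q ∣ s ↔ e s = 0 := by
      rw [← Int.natCast_dvd_natCast, ← Nat.cast_inj (R := ℤ), hes, Nat.cast_zero, ← Int.dvd_iff_emod_eq_zero]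
      exact ⟨fun h ↦ h.mul_right _, fun h ↦ hcop.dvd_of_dvd_mul_right h⟩
    have h2 : (s : ℝ) * r = (e s : ℝ) / q + ((s * r.num / q : ℤ) : ℝ) := by
      have h3 : (s : ℝ) * r.num = e s + q * ((s * r.num / q : ℤ) : ℝ) := by
        have := Int.emod_add_mul_ediv (s * r.num) q
        rw [← hes] at this
        exact_mod_cast this.symm
      have h4 : (r : ℝ) = r.num / q := Rat.cast_def r
      rw [h4, ← mul_div_assoc, h3]; field_simp
    rw [h2, nd_add_int]
    simp only [h1]
  calc _ = ∑ s ∈ Finset.range q, (fun b : ℕ ↦ if b = 0 then 0 else (nd ((b : ℝ) / q))⁻¹) (e s) :=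
        Finset.sum_congr rfl fun s _ ↦ hf s
    _ = ∑ b ∈ (Finset.range q).image e, (if b = 0 then 0 else (nd ((b : ℝ) / q))⁻¹) :=
        by rw [Finset.sum_image hinj]
    _ ≤ ∑ b ∈ Finset.range q, (if b = 0 then 0 else (nd ((b : ℝ) / q))⁻¹) := by
        refine Finset.sum_le_sum_of_subset_of_nonneg ?_ fun b _ _ ↦ ?_
        · intro b hb
          obtain ⟨s, _, rfl⟩ := Finset.mem_image.1 hb
          exact Finset.mem_range.2 (hlt s)
        · split_ifs
          · exact le_rfl
          · exact inv_nonneg.2 (nd_nonneg _)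
    _ ≤ _ := sum_inv_nd_div_le q

lemma sum_range_mul_periodic {q : ℕ} (f : ℕ → ℝ) (hf : ∀ s, f (q + s) = f s) (m : ℕ) :
    ∑ s ∈ Finset.range (q * m), f s = m * ∑ s ∈ Finset.range q, f s := by
  have hf' : ∀ m s, f (q * m + s) = f s := by
    intro m
    induction m with
    | zero => simp
    | succ m ih => intro s; rw [mul_add, mul_one, add_comm (q * m), add_assoc, hf, ih]
  induction m with
  | zero => simp
  | succ m ih =>
    rw [mul_add, mul_one, Finset.sum_range_add, ih, Finset.sum_congr rfl fun s _ ↦ hf' m s]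
    push_cast; ring

lemma sum_inv_nd_le (r : ℚ) (D : ℕ) :
    ∑ d ∈ Finset.Ioc 0 D with ¬ r.den ∣ d, (nd (d * r))⁻¹ ≤
      2 * (D + r.den) * (1 + Real.log r.den) := by
  set q := r.den with hq
  have hq0 : 0 < q := r.den_pos
  have hqr : (0 : ℝ) < q := by exact_mod_cast hq0
  have h0 (s : ℕ) : 0 ≤ (if q ∣ s then 0 else (nd (s * r))⁻¹) := by
    split_ifs
    · exact le_rfl
    · exact inv_nonneg.2 (nd_nonneg _)
  calc _ = ∑ d ∈ Finset.Ioc 0 D, (if q ∣ d then 0 else (nd (d * r))⁻¹) := by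
        rw [Finset.sum_filter]
        exact Finset.sum_congr rfl fun d _ ↦ by split_ifs <;> simp_all
    _ ≤ ∑ d ∈ Finset.range (q * (D / q + 1)), (if q ∣ d then 0 else (nd (d * r))⁻¹) := by
        refine Finset.sum_le_sum_of_subset_of_nonneg ?_ fun b _ _ ↦ h0 b
        intro d hd
        rw [Finset.mem_Ioc] at hd
        rw [Finset.mem_range]
        exact hd.2.trans_lt (Nat.lt_mul_div_succ D hq0)
    _ = ((D / q + 1 : ℕ) : ℝ) * ∑ d ∈ Finset.range q, (if q ∣ d then 0 else (nd (d * r))⁻¹) := by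
        refine sum_range_mul_periodic (fun d : ℕ ↦ if q ∣ d then 0 else (nd (d * r))⁻¹) (fun s ↦ ?_) _
        have e : ((q + s : ℕ) : ℝ) * r = s * r + (r.num : ℤ) := by
          have h4 : (r : ℝ) = r.num / q := Rat.cast_def r
          rw [h4]; push_cast; field_simp; ring
        simp only [e, nd_add_int, Nat.dvd_add_right (dvd_refl q)]
    _ ≤ (D / q + 1) * (2 * q * (1 + Real.log q)) := by
        have h1 : ((D / q + 1 : ℕ) : ℝ) ≤ D / q + 1 := by push_cast; gcongr; exact Nat.cast_div_le
        have h2 := sum_inv_nd_mul_le r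
        exact mul_le_mul h1 h2 (Finset.sum_nonneg fun b _ ↦ h0 b) (by positivity)
    _ = _ := by field_simp

lemma sum_Ioc_ee (M : ℕ) (x : ℝ) :
    ∑ k ∈ Finset.Ioc 0 M, ee (k * x) = ee x * ∑ k ∈ Finset.range M, ee (k * x) := by
  rw [← Finset.Icc_add_one_left_eq_Ioc, zero_add, ← Finset.Ico_add_one_right_eq_Icc,
    Finset.sum_Ico_eq_sum_range, Finset.mul_sum, Nat.add_sub_cancel]
  refine Finset.sum_congr rfl fun k _ ↦ ?_
  rw [← ee_add]; congr 1; push_cast; ring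

lemma norm_sum_Ioc_ee_le (M : ℕ) (x : ℝ) (hx : 0 < nd x) :
    ‖∑ k ∈ Finset.Ioc 0 M, ee (k * x)‖ ≤ (nd x)⁻¹ := by
  rw [sum_Ioc_ee, norm_mul, norm_ee, one_mul]
  refine (norm_geom_le M x hx).trans ?_
  rw [one_div, mul_inv]
  have := inv_pos.2 hx
  linarith

lemma norm_sum_Ioc_ee_le' (M : ℕ) (x : ℝ) : ‖∑ k ∈ Finset.Ioc 0 M, ee (k * x)‖ ≤ M := by
  refine (norm_sum_le _ _).trans ?_
  simp [norm_ee]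

/-- The integral of `ee (t * β)` over `0 ≤ t ≤ N`. -/
noncomputable def eeInt (N β : ℝ) : ℂ :=
  if β = 0 then (N : ℂ) else (ee (N * β) - 1) / (2 * Real.pi * β * Complex.I)

lemma norm_two_pi_mul_I (β : ℝ) : ‖(2 * Real.pi * β * Complex.I : ℂ)‖ = 2 * Real.pi * |β| := by
  simp [abs_of_pos Real.pi_pos]

lemma norm_eeInt_le {N : ℝ} (hN : 0 ≤ N) (β : ℝ) : ‖eeInt N β‖ ≤ N := by
  unfold eeInt
  split_ifs with h
  · simp [abs_of_nonneg hN]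
  · have hβ : 0 < |β| := abs_pos.2 h
    have hpi := Real.pi_pos
    rw [norm_div, norm_two_pi_mul_I, div_le_iff₀ (by positivity)]
    refine (norm_ee_sub_one_le _).trans_eq ?_
    rw [abs_mul, abs_of_nonneg hN]; ring

lemma abs_mul_norm_eeInt_le (N β : ℝ) : |β| * ‖eeInt N β‖ ≤ 1 := by
  unfold eeInt
  split_ifs with h
  · simp [h]
  · have hβ : 0 < |β| := abs_pos.2 h
    have hpi := Real.pi_gt_three
    have h2 : ‖ee (N * β) - 1‖ ≤ 2 := by
      refine (norm_sub_le _ _).trans ?_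
      rw [norm_ee]; norm_num
    rw [norm_div, norm_two_pi_mul_I, mul_div_assoc', div_le_iff₀ (by positivity)]
    nlinarith

lemma norm_ee_div_sub_le {θ : ℝ} (h0 : θ ≠ 0) (hθ : |θ| ≤ 1 / 2) :
    ‖ee θ / (ee θ - 1) - 1 / (2 * Real.pi * θ * Complex.I)‖ ≤ 5 := by
  set z : ℂ := 2 * Real.pi * θ * Complex.I with hz
  have hzn : ‖z‖ = 2 * Real.pi * |θ| := norm_two_pi_mul_I θ
  have hθ0 : 0 < |θ| := abs_pos.2 h0
  have hpi := Real.pi_pos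
  have hz0 : 0 < ‖z‖ := by rw [hzn]; positivity
  have hz0' : z ≠ 0 := norm_pos_iff.1 hz0
  have hee : ee θ = Complex.exp z := by unfold ee; rw [hz]
  have h1 : 4 * |θ| ≤ ‖ee θ - 1‖ := by rw [← nd_eq_abs hθ]; exact four_nd_le θ
  have h1' : ee θ - 1 ≠ 0 := norm_pos_iff.1 (lt_of_lt_of_le (by positivity) h1)
  have h2 : ‖Complex.exp (-z) - 1 - -z‖ ≤ 3 * ‖z‖ ^ 2 := by
    rcases le_or_gt ‖z‖ 1 with h | h
    · have := Complex.norm_exp_sub_one_sub_id_le (x := -z) (by rwa [norm_neg])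
      rw [norm_neg] at this
      nlinarith [sq_nonneg ‖z‖]
    · have e : Complex.exp (-z) = ee (-θ) := by unfold ee; rw [hz]; push_cast; ring_nf
      calc _ ≤ ‖Complex.exp (-z)‖ + ‖(1 : ℂ)‖ + ‖-z‖ := (norm_sub_le _ _).trans (by gcongr; exact norm_sub_le _ _)
        _ = 2 + ‖z‖ := by rw [e, norm_ee, norm_one, norm_neg]; ring
        _ ≤ _ := by nlinarith
  have e : ee θ / (ee θ - 1) - 1 / z = ee θ * (Complex.exp (-z) - 1 - -z) / ((ee θ - 1) * z) := by
    have : ee θ * Complex.exp (-z) = 1 := by rw [hee, ← Complex.exp_add]; simp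
    rw [mul_sub, mul_sub, this]
    field_simp
    ring
  rw [e, norm_div, norm_mul, norm_mul, norm_ee, one_mul, div_le_iff₀ (mul_pos (norm_pos_iff.2 h1') hz0)]
  have h3 : ‖z‖ ^ 2 * 3 ≤ 5 * (4 * |θ|) * ‖z‖ := by
    rw [hzn]
    have := Real.pi_lt_d2
    nlinarith [mul_pos hθ0 hθ0, mul_pos hpi (mul_pos hθ0 hθ0)]
  nlinarith

lemma norm_sum_sub_eeInt_le {N : ℝ} (hN : 0 ≤ N) {d : ℕ} (hd : 0 < d) {β : ℝ} (h : |d * β| ≤ 1 / 2) :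
    ‖∑ k ∈ Finset.Ioc 0 ⌊N / d⌋₊, ee (k * (d * β)) - eeInt N β / d‖ ≤ 11 := by
  have hd' : (0 : ℝ) < d := by exact_mod_cast hd
  have hf1 := Nat.floor_le (a := N / d) (by positivity)
  have hf2 := Nat.lt_floor_add_one (N / d)
  set M := ⌊N / d⌋₊ with hM
  unfold eeInt
  split_ifs with hβ
  · simp only [hβ, mul_zero, ee_zero, Finset.sum_const, Nat.card_Ioc, tsub_zero, nsmul_eq_mul, mul_one]
    have e : (M : ℂ) - (N : ℂ) / d = ((M - N / d : ℝ) : ℂ) := by push_cast; ring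
    rw [e, Complex.norm_real, Real.norm_eq_abs, abs_le]
    constructor <;> linarith
  · set θ := d * β with hθ
    have hθ0 : θ ≠ 0 := mul_ne_zero hd'.ne' hβ
    have hθ' : 0 < |θ| := abs_pos.2 hθ0
    have h1 : 4 * |θ| ≤ ‖ee θ - 1‖ := by rw [← nd_eq_abs h]; exact four_nd_le θ
    have h1' : ee θ - 1 ≠ 0 := norm_pos_iff.1 (lt_of_lt_of_le (by positivity) h1)
    have e1 : ∑ k ∈ Finset.Ioc 0 M, ee (k * θ) = ee θ / (ee θ - 1) * (ee (M * θ) - 1) := by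
      rw [sum_Ioc_ee]
      simp only [ee_natMul]
      rw [geom_sum_eq (sub_ne_zero.1 h1')]
      ring
    set z : ℂ := 2 * Real.pi * θ * Complex.I with hz
    have hz0 : ‖z‖ = 2 * Real.pi * |θ| := norm_two_pi_mul_I θ
    have hdc : (d : ℂ) ≠ 0 := by exact_mod_cast hd.ne'
    have e2 : (ee (N * β) - 1) / (2 * Real.pi * β * Complex.I) / d = (ee (N * β) - 1) * (1 / z) := by
      rw [hz, hθ, div_div, mul_one_div]; push_cast; congr 1; ring
    have e3 : ee (N * β) = ee (M * θ) * ee ((N / d - M) * θ) := by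
      rw [← ee_add]; congr 1; rw [hθ]; field_simp; ring
    have e4 : ∑ k ∈ Finset.Ioc 0 M, ee (k * θ) - (ee (N * β) - 1) / (2 * Real.pi * β * Complex.I) / d =
        (ee θ / (ee θ - 1) - 1 / z) * (ee (M * θ) - 1) -
          ee (M * θ) * (ee ((N / d - M) * θ) - 1) * (1 / z) := by
      rw [e1, e2, e3]; ring
    rw [e4]
    have h5 := norm_ee_div_sub_le hθ0 h
    have h6 : ‖ee (M * θ) - 1‖ ≤ 2 := by
      refine (norm_sub_le _ _).trans ?_
      rw [norm_ee]; norm_num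
    have h7 : ‖ee (M * θ) * (ee ((N / d - M) * θ) - 1) * (1 / z)‖ ≤ 1 := by
      have hpi := Real.pi_pos
      rw [norm_mul, norm_mul, norm_ee, one_mul, norm_div, norm_one, hz0, mul_one_div,
        div_le_iff₀ (by positivity), one_mul]
      refine (norm_ee_sub_one_le _).trans ?_
      rw [abs_mul]
      have : |N / d - M| ≤ 1 := by rw [abs_le]; constructor <;> linarith
      calc _ ≤ 2 * Real.pi * (1 * |θ|) := by gcongr
        _ = _ := by ring
    have h8 : ‖(ee θ / (ee θ - 1) - 1 / z) * (ee (M * θ) - 1)‖ ≤ 5 * 2 := by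
      rw [norm_mul]
      gcongr
    exact (norm_sub_le _ _).trans ((add_le_add h8 h7).trans (by norm_num))

lemma exists_le_totient (m : ℕ) : ∃ Q : ℕ, ∀ q > Q, m ≤ q.totient := by
  obtain ⟨C, hC1, hC⟩ := exists_prod_primes_le
  obtain ⟨Q, hQ⟩ := exists_nat_ge (2 * C * (m : ℝ) ^ 10)
  refine ⟨Q, fun q hq ↦ ?_⟩
  by_contra! hlt
  have hq0 : 0 < q := by omega
  have hqr : (1 : ℝ) ≤ q := by exact_mod_cast hq0
  have h1 := hC q.primeFactors fun p hp ↦ Nat.prime_of_mem_primeFactors hp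
  have h2 := prod_primeFactors_inv q hq0
  have h3 : ∏ p ∈ q.primeFactors, (1 - 1 / (p : ℝ)) = q.totient / q := by
    rw [← inv_inj, ← Finset.prod_inv_distrib, inv_div, ← h2]
    exact Finset.prod_congr rfl fun p _ ↦ by rw [one_div]
  have h4 : (q.primeFactors.card : ℝ) + 1 ≤ 2 * q := by
    have : q.primeFactors.card ≤ q := by
      have h : q.primeFactors ⊆ Finset.Icc 1 q := fun p hp ↦ Finset.mem_Icc.2
        ⟨(Nat.prime_of_mem_primeFactors hp).one_le, Nat.le_of_mem_primeFactors hp⟩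
      simpa using Finset.card_le_card h
    have : (q.primeFactors.card : ℝ) ≤ q := by exact_mod_cast this
    linarith
  rw [h3, div_pow, mul_div_assoc', le_div_iff₀ (by positivity), one_mul] at h1
  have h5 : (q.totient : ℝ) ^ 10 ≤ (m : ℝ) ^ 10 := by
    have : (q.totient : ℝ) ≤ m := by exact_mod_cast hlt.le
    gcongr
  have h6 : (q : ℝ) * (q : ℝ) ^ 9 ≤ (q : ℝ) * (2 * C * (m : ℝ) ^ 10) := by
    calc (q : ℝ) * (q : ℝ) ^ 9 = (q : ℝ) ^ 10 := by ring
      _ ≤ _ := h1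
      _ ≤ C * (2 * q) * (m : ℝ) ^ 10 := by gcongr
      _ = _ := by ring
  have h7 := le_of_mul_le_mul_left h6 (by linarith)
  have h8 : (q : ℝ) ≤ (q : ℝ) ^ 9 := le_self_pow₀ hqr (by norm_num)
  have h9 : (Q : ℝ) < q := by exact_mod_cast hq
  linarith

end Ternary

namespace Ternary
open ArithmeticFunction (vonMangoldt moebius)

lemma abs_moebius_le (d : ℕ) : |(moebius d : ℝ)| ≤ 1 := by
  rw [← Int.cast_abs]; exact_mod_cast ArithmeticFunction.abs_moebius_le_one

lemma norm_moebius_mul_le {d : ℕ} (t : ℝ) (z : ℂ) :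
    ‖(((moebius d : ℝ) * t ^ 2 : ℝ) : ℂ) * z‖ ≤ t ^ 2 * ‖z‖ := by
  rw [norm_mul, Complex.norm_real, Real.norm_eq_abs, abs_mul, abs_of_nonneg (sq_nonneg t)]
  have := abs_moebius_le d
  calc _ ≤ 1 * t ^ 2 * ‖z‖ := by gcongr
    _ = _ := by ring

/-- Type I sums: the contribution of large `d`. -/
lemma norm_typeI_tail_le {N D : ℕ} (hD : 1 ≤ D) (hDN : D ≤ N) (α : ℝ) :
    ‖∑ d ∈ Finset.Ioc D N, (((moebius d : ℝ) * Real.log ((N : ℝ) / d) ^ 2 : ℝ) : ℂ) *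
      ∑ k ∈ Finset.Ioc 0 (N / d), ee (k * (d * α))‖ ≤ N * Real.log ((N : ℝ) / D) ^ 3 := by
  have hD' : (0 : ℝ) < D := by exact_mod_cast hD
  have hN' : (0 : ℝ) < N := by exact_mod_cast hD.trans hDN
  have hl : 0 ≤ Real.log ((N : ℝ) / D) :=
    Real.log_nonneg ((one_le_div hD').2 (by exact_mod_cast hDN))
  have hsum : ∀ M : ℕ, D ≤ M → ∑ d ∈ Finset.Ioc D M, (d : ℝ)⁻¹ ≤ Real.log M - Real.log D := by
    intro M hM
    induction M, hM using Nat.le_induction with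
    | base => simp
    | succ M hM ih =>
      have hM' : (0 : ℝ) < M := by exact_mod_cast hD.trans hM
      rw [Finset.sum_Ioc_succ_top hM]
      have := Real.log_le_sub_one_of_pos (x := (M : ℝ) / ((M + 1 : ℕ) : ℝ)) (by positivity)
      rw [Real.log_div hM'.ne' (by positivity)] at this
      have e : (M : ℝ) / ((M + 1 : ℕ) : ℝ) - 1 = -((M + 1 : ℕ) : ℝ)⁻¹ := by
        push_cast; field_simp; ring
      linarith
  calc _ ≤ ∑ d ∈ Finset.Ioc D N, Real.log ((N : ℝ) / D) ^ 2 * (N * (d : ℝ)⁻¹) := by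
        refine (norm_sum_le _ _).trans (Finset.sum_le_sum fun d hd ↦ ?_)
        rw [Finset.mem_Ioc] at hd
        have hd0 : (0 : ℝ) < d := by exact_mod_cast (by omega : 0 < d)
        refine (norm_moebius_mul_le _ _).trans ?_
        have h1 : ‖∑ k ∈ Finset.Ioc 0 (N / d), ee (k * (d * α))‖ ≤ N * (d : ℝ)⁻¹ :=
          (norm_sum_Ioc_ee_le' _ _).trans Nat.cast_div_le
        have h2 : 0 ≤ Real.log ((N : ℝ) / d) :=
          Real.log_nonneg ((one_le_div hd0).2 (by exact_mod_cast hd.2))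
        have h3 : Real.log ((N : ℝ) / d) ≤ Real.log ((N : ℝ) / D) := by
          have : (D : ℝ) ≤ d := by exact_mod_cast hd.1.le
          exact Real.log_le_log (by positivity) (by gcongr)
        gcongr
    _ = Real.log ((N : ℝ) / D) ^ 2 * N * ∑ d ∈ Finset.Ioc D N, (d : ℝ)⁻¹ := by
        rw [Finset.mul_sum]; exact Finset.sum_congr rfl fun d _ ↦ by ring
    _ ≤ Real.log ((N : ℝ) / D) ^ 2 * N * Real.log ((N : ℝ) / D) := by
        rw [Real.log_div hN'.ne' hD'.ne']
        rw [Real.log_div hN'.ne' hD'.ne'] at hl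
        gcongr
        exact hsum N hDN
    _ = _ := by ring

lemma log_div_le_of_mem {N d : ℕ} (hd : 0 < d) (hdN : d ≤ N) :
    0 ≤ Real.log ((N : ℝ) / d) ∧ Real.log ((N : ℝ) / d) ≤ Real.log N := by
  have hd0 : (0 : ℝ) < d := by exact_mod_cast hd
  have hN : (0 : ℝ) < N := by exact_mod_cast hd.trans_le hdN
  refine ⟨Real.log_nonneg ((one_le_div hd0).2 (by exact_mod_cast hdN)), ?_⟩
  refine Real.log_le_log (by positivity) (div_le_self hN.le (by exact_mod_cast hd))

/-- Type I sums: the contribution of `d` not divisible by the denominator of the approximation. -/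
lemma norm_typeI_not_dvd_le {N D : ℕ} (hDN : D ≤ N) {α : ℝ} {r : ℚ}
    (hr : |α - r| ≤ 1 / ((2 * D + 1) * r.den)) :
    ‖∑ d ∈ Finset.Ioc 0 D with ¬ r.den ∣ d, (((moebius d : ℝ) * Real.log ((N : ℝ) / d) ^ 2 : ℝ) : ℂ) *
      ∑ k ∈ Finset.Ioc 0 (N / d), ee (k * (d * α))‖ ≤
      4 * Real.log N ^ 2 * (D + r.den) * (1 + Real.log r.den) := by
  have hq0 : (0 : ℝ) < r.den := by exact_mod_cast r.den_pos
  calc _ ≤ ∑ d ∈ Finset.Ioc 0 D with ¬ r.den ∣ d, Real.log N ^ 2 * (2 * (nd (d * r))⁻¹) := by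
        refine (norm_sum_le _ _).trans (Finset.sum_le_sum fun d hd ↦ ?_)
        rw [Finset.mem_filter, Finset.mem_Ioc] at hd
        obtain ⟨⟨hd0, hdD⟩, hqd⟩ := hd
        refine (norm_moebius_mul_le _ _).trans ?_
        obtain ⟨h1, h2⟩ := log_div_le_of_mem hd0 (hdD.trans hDN)
        have h3 : 1 / (r.den : ℝ) ≤ nd (d * r) := by
          have e : (d : ℝ) * r = ((d * r.num : ℤ) : ℝ) / r.den := by
            rw [show (r : ℝ) = r.num / r.den from Rat.cast_def r]; push_cast; ring
          rw [e]
          refine nd_intCast_div_ge r.den_pos fun h ↦ hqd ?_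
          have hcop : IsCoprime (r.den : ℤ) r.num :=
            (Int.isCoprime_iff_gcd_eq_one.2 (by simpa [Int.gcd] using r.reduced)).symm
          exact_mod_cast hcop.dvd_of_dvd_mul_right h
        have h4 : nd (d * r) ≤ nd (d * α) + 1 / (2 * r.den) := by
          have e : (d : ℝ) * r = d * α - d * (α - r) := by ring
          rw [e]
          refine (nd_sub_le _ _).trans (add_le_add le_rfl ((nd_le_abs _).trans ?_))
          rw [abs_mul, Nat.abs_cast]
          have hdD' : (d : ℝ) ≤ D := by exact_mod_cast hdD
          calc (d : ℝ) * |α - r| ≤ D * (1 / ((2 * D + 1) * r.den)) := by gcongr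
            _ ≤ 1 / (2 * r.den) := by
              rw [mul_one_div, div_le_div_iff₀ (by positivity) (by positivity)]
              nlinarith
        have h5 : nd (d * r) / 2 ≤ nd (d * α) := by
          have : 1 / (2 * (r.den : ℝ)) = 1 / r.den / 2 := by field_simp
          linarith
        have h6 : 0 < nd (d * r) := lt_of_lt_of_le (by positivity) h3
        have h7 : ‖∑ k ∈ Finset.Ioc 0 (N / d), ee (k * (d * α))‖ ≤ 2 * (nd (d * r))⁻¹ := by
          refine (norm_sum_Ioc_ee_le _ _ (by linarith)).trans ?_
          refine (inv_anti₀ (by linarith) h5).trans_eq ?_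
          rw [inv_div]; ring
        gcongr
    _ = 2 * Real.log N ^ 2 * ∑ d ∈ Finset.Ioc 0 D with ¬ r.den ∣ d, (nd (d * r))⁻¹ := by
        rw [Finset.mul_sum]; exact Finset.sum_congr rfl fun d _ ↦ by ring
    _ ≤ 2 * Real.log N ^ 2 * (2 * (D + r.den) * (1 + Real.log r.den)) := by
        gcongr; exact sum_inv_nd_le r D
    _ = _ := by ring

lemma abs_sum_moebius_dvd_le {N D q : ℕ} (hD : 1 ≤ D) (hDN : D ≤ N) (hq : 0 < q) :
    |∑ d ∈ Finset.Ioc 0 D with q ∣ d, (moebius d : ℝ) * Real.log ((N : ℝ) / d) ^ 2 / d| ≤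
      100 * ((Real.log ((N : ℝ) / D) + 1) ^ 2 + Real.log D) / q.totient := by
  have hD' : (0 : ℝ) < D := by exact_mod_cast hD
  have hN' : (0 : ℝ) < N := by exact_mod_cast hD.trans hDN
  have hq' : (0 : ℝ) < q := by exact_mod_cast hq
  have hl : 0 ≤ Real.log ((N : ℝ) / D) :=
    Real.log_nonneg ((one_le_div hD').2 (by exact_mod_cast hDN))
  have hlD : 0 ≤ Real.log D := Real.log_natCast_nonneg D
  have hphi : (0 : ℝ) < q.totient := by exact_mod_cast Nat.totient_pos.2 hq
  set l := Real.log ((N : ℝ) / D) with hldef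
  set x : ℝ := (D : ℝ) / q with hx
  have hfl : ⌊x⌋₊ = D / q := Nat.floor_div_eq_div (K := ℝ) D q
  set m : ℕ → ℝ := fun i ↦ ∑ j ∈ Finset.Ioc 0 ⌊x⌋₊ with q.Coprime j,
    (moebius j : ℝ) / j * Real.log (x / j) ^ i with hm
  have e : ∑ d ∈ Finset.Ioc 0 D with q ∣ d, (moebius d : ℝ) * Real.log ((N : ℝ) / d) ^ 2 / d =
      (moebius q : ℝ) / q * (l ^ 2 * m 0 + 2 * l * m 1 + m 2) := by
    have e1 : l ^ 2 * m 0 + 2 * l * m 1 + m 2 = ∑ j ∈ Finset.Ioc 0 ⌊x⌋₊ with q.Coprime j,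
        (moebius j : ℝ) / j * Real.log ((N : ℝ) / ((q * j : ℕ) : ℝ)) ^ 2 := by
      rw [hm]
      simp only [Finset.mul_sum]
      rw [← Finset.sum_add_distrib, ← Finset.sum_add_distrib]
      refine Finset.sum_congr rfl fun j hj ↦ ?_
      rw [Finset.mem_filter, Finset.mem_Ioc] at hj
      have hj0 : (0 : ℝ) < j := by exact_mod_cast hj.1.1
      have : (N : ℝ) / ((q * j : ℕ) : ℝ) = (N / D) * (x / j) := by
        rw [hx]; push_cast; field_simp
      rw [this, Real.log_mul (by positivity) (by rw [hx]; positivity), ← hldef]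
      ring
    rw [e1, Finset.mul_sum]
    symm
    refine Finset.sum_of_injOn (q * ·) (fun a _ b _ h ↦ Nat.eq_of_mul_eq_mul_left hq h) ?_ ?_ ?_
    · intro k hk
      rw [Finset.mem_coe, Finset.mem_filter, Finset.mem_Ioc, hfl, Nat.le_div_iff_mul_le hq] at hk
      show q * k ∈ _
      rw [Finset.mem_coe, Finset.mem_filter, Finset.mem_Ioc]
      exact ⟨⟨Nat.mul_pos hq hk.1.1, by rw [mul_comm]; exact hk.1.2⟩, dvd_mul_right _ _⟩
    · intro j hj hn
      rw [Finset.mem_filter, Finset.mem_Ioc] at hj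
      obtain ⟨⟨hj0, hjx⟩, k, rfl⟩ := hj
      have hk : ¬ q.Coprime k := by
        intro hk
        refine hn ⟨k, ?_, rfl⟩
        rw [Finset.mem_coe, Finset.mem_filter, Finset.mem_Ioc, hfl, Nat.le_div_iff_mul_le hq]
        exact ⟨⟨Nat.pos_of_mul_pos_left hj0, by rwa [mul_comm]⟩, hk⟩
      have : moebius (q * k) = 0 := by
        rw [ArithmeticFunction.moebius_eq_zero_of_not_squarefree]
        intro hsq
        exact hk (Nat.coprime_of_squarefree_mul hsq)
      rw [this]; simp
    · intro k hk
      rw [Finset.mem_filter, Finset.mem_Ioc] at hk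
      show _ = (moebius (q * k) : ℝ) * Real.log ((N : ℝ) / ((q * k : ℕ) : ℝ)) ^ 2 / ((q * k : ℕ) : ℝ)
      rw [ArithmeticFunction.isMultiplicative_moebius.map_mul_of_coprime hk.2]
      push_cast
      field_simp
  have hm0 : ∀ i ≤ 2, |m i| ≤ 100 * (1 + Real.log D) ^ (i - 1) * (q / q.totient) := by
    intro i hi
    rcases lt_or_ge x 1 with h | h
    · have : m i = 0 := by
        show (∑ j ∈ Finset.Ioc 0 ⌊x⌋₊ with q.Coprime j, (moebius j : ℝ) / j * Real.log (x / j) ^ i) = 0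
        rw [Nat.floor_eq_zero.2 h]; simp
      rw [this, abs_zero]
      positivity
    · refine (muSum_primeFactors_le hi h q hq).trans ?_
      have h1 : 0 ≤ Real.log x := Real.log_nonneg h
      have h2 : Real.log x ≤ Real.log D := Real.log_le_log (by linarith) (div_le_self hD'.le (by exact_mod_cast hq))
      gcongr
  have h0 := hm0 0 (by norm_num)
  have h1 := hm0 1 (by norm_num)
  have h2 := hm0 2 (by norm_num)
  simp only [Nat.zero_sub, Nat.sub_self, pow_zero, mul_one, Nat.add_one_sub_one, pow_one] at h0 h1 h2
  rw [e, abs_mul, abs_div, abs_of_pos hq']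
  have h3 : |l ^ 2 * m 0 + 2 * l * m 1 + m 2| ≤ 100 * ((l + 1) ^ 2 + Real.log D) * (q / q.totient) := by
    calc _ ≤ |l ^ 2 * m 0| + |2 * l * m 1| + |m 2| := abs_add_three _ _ _
      _ = l ^ 2 * |m 0| + 2 * l * |m 1| + |m 2| := by
          rw [abs_mul, abs_mul, abs_of_nonneg (by positivity : 0 ≤ l ^ 2), abs_of_nonneg (by positivity : 0 ≤ 2 * l)]
      _ ≤ l ^ 2 * (100 * (q / q.totient)) + 2 * l * (100 * (q / q.totient)) +
          100 * (1 + Real.log D) * (q / q.totient) := by gcongr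
      _ = _ := by ring
  calc _ ≤ 1 / (q : ℝ) * (100 * ((l + 1) ^ 2 + Real.log D) * (q / q.totient)) := by
        have := abs_moebius_le q
        gcongr
    _ = _ := by field_simp

/-- Type I sums: the contribution of `d` divisible by the denominator of the approximation. -/
lemma norm_typeI_dvd_le {N D : ℕ} (hD : 1 ≤ D) (hDN : D ≤ N) {α : ℝ} {r : ℚ}
    (hr : |α - r| ≤ 1 / ((2 * D + 1) * r.den)) :
    ‖∑ d ∈ Finset.Ioc 0 D with r.den ∣ d, (((moebius d : ℝ) * Real.log ((N : ℝ) / d) ^ 2 : ℝ) : ℂ) *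
      ∑ k ∈ Finset.Ioc 0 (N / d), ee (k * (d * α))‖ ≤
      11 * Real.log N ^ 2 * D + ‖eeInt N (α - r)‖ *
        (100 * ((Real.log ((N : ℝ) / D) + 1) ^ 2 + Real.log D) / r.den.totient) := by
  have hq0 : (0 : ℝ) < r.den := by exact_mod_cast r.den_pos
  set β := α - r with hβ
  have e : ∑ d ∈ Finset.Ioc 0 D with r.den ∣ d, (((moebius d : ℝ) * Real.log ((N : ℝ) / d) ^ 2 : ℝ) : ℂ) *
      ∑ k ∈ Finset.Ioc 0 (N / d), ee (k * (d * α)) =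
      ∑ d ∈ Finset.Ioc 0 D with r.den ∣ d, (((moebius d : ℝ) * Real.log ((N : ℝ) / d) ^ 2 : ℝ) : ℂ) *
        (∑ k ∈ Finset.Ioc 0 ⌊(N : ℝ) / d⌋₊, ee (k * (d * β)) - eeInt N β / d) +
      eeInt N β * ((∑ d ∈ Finset.Ioc 0 D with r.den ∣ d,
        (moebius d : ℝ) * Real.log ((N : ℝ) / d) ^ 2 / d : ℝ) : ℂ) := by
    rw [Complex.ofReal_sum, Finset.mul_sum, ← Finset.sum_add_distrib]
    refine Finset.sum_congr rfl fun d hd ↦ ?_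
    rw [Finset.mem_filter] at hd
    obtain ⟨-, m, rfl⟩ := hd
    have h1 : ∀ k : ℕ, ee (k * ((r.den * m : ℕ) * α)) = ee (k * ((r.den * m : ℕ) * β)) := by
      intro k
      have : (k : ℝ) * ((r.den * m : ℕ) * α) = k * ((r.den * m : ℕ) * β) + ((k * m * r.num : ℤ) : ℝ) := by
        rw [hβ, show (r : ℝ) = r.num / r.den from Rat.cast_def r]; push_cast; field_simp; ring
      rw [this, ee_add_int]
    rw [Nat.floor_div_eq_div (K := ℝ)]
    simp only [h1]
    push_cast
    ring
  rw [e]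
  refine (norm_add_le _ _).trans (add_le_add ?_ ?_)
  · calc _ ≤ ∑ d ∈ Finset.Ioc 0 D with r.den ∣ d, Real.log N ^ 2 * 11 := by
          refine (norm_sum_le _ _).trans (Finset.sum_le_sum fun d hd ↦ ?_)
          rw [Finset.mem_filter, Finset.mem_Ioc] at hd
          obtain ⟨⟨hd0, hdD⟩, -⟩ := hd
          refine (norm_moebius_mul_le _ _).trans ?_
          obtain ⟨h1, h2⟩ := log_div_le_of_mem hd0 (hdD.trans hDN)
          have h3 : |(d : ℝ) * β| ≤ 1 / 2 := by
            rw [abs_mul, Nat.abs_cast]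
            have hdD' : (d : ℝ) ≤ D := by exact_mod_cast hdD
            have hden : (1 : ℝ) ≤ r.den := by exact_mod_cast r.den_pos
            calc (d : ℝ) * |β| ≤ D * (1 / ((2 * D + 1) * r.den)) := by gcongr
              _ ≤ 1 / 2 := by
                rw [mul_one_div, div_le_div_iff₀ (by positivity) (by positivity)]
                nlinarith [(Nat.cast_nonneg D : (0 : ℝ) ≤ D)]
          have h4 := norm_sum_sub_eeInt_le (Nat.cast_nonneg N) hd0 h3
          gcongr
      _ ≤ 11 * Real.log N ^ 2 * D := by
          rw [Finset.sum_const, nsmul_eq_mul]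
          have : (((Finset.Ioc 0 D).filter (fun d ↦ r.den ∣ d)).card : ℝ) ≤ D := by
            exact_mod_cast (Finset.card_filter_le _ _).trans (by simp)
          calc _ ≤ (D : ℝ) * (Real.log N ^ 2 * 11) := by gcongr
            _ = _ := by ring
  · rw [norm_mul, Complex.norm_real, Real.norm_eq_abs]
    gcongr
    exact abs_sum_moebius_dvd_le hD hDN r.den_pos

/-- Type I sums, for a general cut off `D`. -/
lemma norm_typeI_le {N D : ℕ} (hD : 1 ≤ D) (hDN : D ≤ N) {α : ℝ} {r : ℚ}
    (hr : |α - r| ≤ 1 / ((2 * D + 1) * r.den)) (hden : r.den ≤ 2 * D) :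
    ‖∑ d ∈ Finset.Ioc 0 N, (((moebius d : ℝ) * Real.log ((N : ℝ) / d) ^ 2 : ℝ) : ℂ) *
      ∑ k ∈ Finset.Ioc 0 (N / d), ee (k * (d * α))‖ ≤
      N * Real.log ((N : ℝ) / D) ^ 3 + 35 * Real.log N ^ 2 * (Real.log N + 1) * D +
        ‖eeInt N (α - r)‖ * (100 * ((Real.log ((N : ℝ) / D) + 1) ^ 2 + Real.log N) / r.den.totient) := by
  have hD' : (0 : ℝ) < D := by exact_mod_cast hD
  have hN' : (0 : ℝ) < N := by exact_mod_cast hD.trans hDN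
  have hDN' : (D : ℝ) ≤ N := by exact_mod_cast hDN
  have hL : 0 ≤ Real.log N := Real.log_natCast_nonneg N
  set F : ℕ → ℂ := fun d ↦ (((moebius d : ℝ) * Real.log ((N : ℝ) / d) ^ 2 : ℝ) : ℂ) *
      ∑ k ∈ Finset.Ioc 0 (N / d), ee (k * (d * α)) with hF
  have e : ∑ d ∈ Finset.Ioc 0 N, F d = ∑ d ∈ Finset.Ioc 0 D with r.den ∣ d, F d +
      ∑ d ∈ Finset.Ioc 0 D with ¬ r.den ∣ d, F d + ∑ d ∈ Finset.Ioc D N, F d := by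
    rw [Finset.sum_filter_add_sum_filter_not, Finset.sum_Ioc_consecutive _ (Nat.zero_le _) hDN]
  have h1 := norm_typeI_dvd_le hD hDN hr
  have h2 := norm_typeI_not_dvd_le hDN hr
  have h3 := norm_typeI_tail_le hD hDN α
  have h4 : 4 * Real.log N ^ 2 * (D + r.den) * (1 + Real.log r.den) ≤
      24 * Real.log N ^ 2 * (Real.log N + 1) * D := by
    have h5 : (r.den : ℝ) ≤ 2 * D := by exact_mod_cast hden
    have h6 : Real.log r.den ≤ 1 + Real.log N := by
      have hp : (0 : ℝ) < r.den := by exact_mod_cast r.den_pos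
      calc _ ≤ Real.log (2 * N) := Real.log_le_log hp (by linarith)
        _ = Real.log 2 + Real.log N := Real.log_mul (by norm_num) hN'.ne'
        _ ≤ _ := by linarith [Real.log_two_lt_d9]
    have h7 : 0 ≤ Real.log r.den := Real.log_natCast_nonneg _
    calc _ ≤ 4 * Real.log N ^ 2 * (D + 2 * D) * (1 + (1 + Real.log N)) := by gcongr
      _ ≤ 4 * Real.log N ^ 2 * (D + 2 * D) * (2 * (Real.log N + 1)) := by gcongr; linarith
      _ = _ := by ring
  have h8 : 11 * Real.log N ^ 2 * D ≤ 11 * Real.log N ^ 2 * (Real.log N + 1) * D := by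
    have : 0 ≤ 11 * Real.log N ^ 2 * D * Real.log N := by positivity
    linarith
  have h9 : ‖eeInt N (α - r)‖ * (100 * ((Real.log ((N : ℝ) / D) + 1) ^ 2 + Real.log D) / r.den.totient) ≤
      ‖eeInt N (α - r)‖ * (100 * ((Real.log ((N : ℝ) / D) + 1) ^ 2 + Real.log N) / r.den.totient) := by
    have : Real.log D ≤ Real.log N := Real.log_le_log hD' hDN'
    gcongr
  rw [e]
  refine (norm_add₃_le).trans ?_
  linarith

/-- Type I sums on minor arcs. -/
lemma exists_typeI_le {η : ℝ} (hη : 0 < η) : ∃ Q : ℕ, ∀ Q' ≥ Q, ∃ N0 : ℕ, ∀ N ≥ N0, ∀ α : ℝ,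
    (∀ q : ℕ, 1 ≤ q → q ≤ Q' → (Q' : ℝ) / N ≤ nd (q * α)) →
    ‖∑ d ∈ Finset.Ioc 0 N, (((moebius d : ℝ) * Real.log ((N : ℝ) / d) ^ 2 : ℝ) : ℂ) *
      ∑ k ∈ Finset.Ioc 0 (N / d), ee (k * (d * α))‖ ≤ η * N * Real.log N := by
  obtain ⟨m, hm⟩ := exists_nat_gt (800 / η)
  obtain ⟨Q1, hQ1⟩ := exists_le_totient m
  obtain ⟨Q2, hQ2⟩ := exists_nat_ge (800 * Q1 / η)
  refine ⟨max 1 (max Q1 Q2), fun Q hQ ↦ ?_⟩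
  have hQ1le : Q1 ≤ Q := le_trans (le_trans (le_max_left _ _) (le_max_right _ _)) hQ
  have hQ2le : Q2 ≤ Q := le_trans (le_trans (le_max_right _ _) (le_max_right _ _)) hQ
  have hQpos : 1 ≤ Q := le_trans (le_max_left _ _) hQ
  have hLN : Tendsto (fun N : ℕ ↦ Real.log N) atTop atTop :=
    Real.tendsto_log_atTop.comp tendsto_natCast_atTop_atTop
  have ev1 : ∀ᶠ L : ℝ in atTop, 8 ≤ L ∧ 160 / η ≤ L ∧ 4 * (64 * Real.log L ^ 3) ≤ η * L ∧
      (4 * Real.log L + 1) ^ 2 ≤ L ∧ 0 ≤ Real.log L := by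
    have a2 := (Real.isLittleO_pow_log_id_atTop (n := 3)).bound (by positivity : 0 < η / 256)
    have a3 := (Real.isLittleO_pow_log_id_atTop (n := 2)).bound (by norm_num : (0 : ℝ) < 1 / 25)
    filter_upwards [eventually_ge_atTop 8, eventually_ge_atTop (160 / η), a2, a3,
      Real.tendsto_log_atTop.eventually_ge_atTop 1] with L h1 h2 h3 h4 h5
    simp only [Real.norm_eq_abs, id] at h3 h4
    rw [abs_of_nonneg (by positivity), abs_of_nonneg (by linarith)] at h3 h4
    refine ⟨h1, h2, by linarith, ?_, by linarith⟩
    nlinarith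
  have ev2 : ∀ᶠ N : ℕ in atTop, 2 * Real.log N ^ 3 ≤ N := by
    have a2 := (Real.isLittleO_pow_log_id_atTop (n := 3)).bound (by norm_num : (0 : ℝ) < 1 / 2)
    filter_upwards [tendsto_natCast_atTop_atTop.eventually a2, hLN.eventually_ge_atTop 0] with N h h0
    simp only [Real.norm_eq_abs, id, Nat.abs_cast] at h
    rw [abs_of_nonneg (by positivity)] at h
    linarith
  obtain ⟨N0, hN0⟩ := eventually_atTop.1 ((hLN.eventually ev1).and ev2)
  refine ⟨N0, fun N hN α hα ↦ ?_⟩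
  obtain ⟨⟨hL8, hLη, hL3, hL2, hLL⟩, hNL⟩ := hN0 N hN
  set L := Real.log N with hL
  have hL0 : 0 < L := by linarith
  have hN' : (0 : ℝ) < N := by
    rcases Nat.eq_zero_or_pos N with h | h
    · rw [hL, h] at hL0; simp at hL0
    · exact_mod_cast h
  set D := ⌊(N : ℝ) / L ^ 3⌋₊ with hDdef
  have hDle : (D : ℝ) ≤ N / L ^ 3 := Nat.floor_le (by positivity)
  have h2 : 2 ≤ (N : ℝ) / L ^ 3 := by rw [le_div_iff₀ (by positivity)]; linarith
  have hD1 : 1 ≤ D := Nat.le_floor (by push_cast; linarith)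
  have hDge : (N : ℝ) / L ^ 3 ≤ 2 * D := by
    have := Nat.lt_floor_add_one ((N : ℝ) / L ^ 3)
    have h' : (1 : ℝ) ≤ D := by exact_mod_cast hD1
    linarith
  have hD' : (0 : ℝ) < D := by exact_mod_cast hD1
  have hDN : D ≤ N := by
    have : (D : ℝ) ≤ N := hDle.trans (div_le_self hN'.le (one_le_pow₀ (by linarith)))
    exact_mod_cast this
  have hl0 : 0 ≤ Real.log ((N : ℝ) / D) := Real.log_nonneg ((one_le_div hD').2 (by exact_mod_cast hDN))
  have hl : Real.log ((N : ℝ) / D) ≤ 4 * Real.log L := by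
    have : (N : ℝ) / D ≤ L ^ 4 := by
      rw [div_le_iff₀ hD']
      rw [div_le_iff₀ (by positivity)] at hDge
      have : 2 * D * L ^ 3 ≤ L * D * L ^ 3 := by gcongr; linarith
      calc (N : ℝ) ≤ 2 * D * L ^ 3 := hDge
        _ ≤ L * D * L ^ 3 := this
        _ = _ := by ring
    calc _ ≤ Real.log (L ^ 4) := Real.log_le_log (by positivity) this
      _ = _ := by rw [Real.log_pow]; norm_num
  obtain ⟨r, hr1, hr2⟩ := Real.exists_rat_abs_sub_le_and_den_le α (n := 2 * D) (by omega)
  push_cast at hr1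
  refine (norm_typeI_le hD1 hDN hr1 hr2).trans ?_
  have hden : (0 : ℝ) < r.den := by exact_mod_cast r.den_pos
  have hphi : (0 : ℝ) < r.den.totient := by exact_mod_cast Nat.totient_pos.2 r.den_pos
  have b1 : (N : ℝ) * Real.log ((N : ℝ) / D) ^ 3 ≤ η / 4 * N * L := by
    have : Real.log ((N : ℝ) / D) ^ 3 ≤ η / 4 * L := by
      calc _ ≤ (4 * Real.log L) ^ 3 := by gcongr
        _ ≤ _ := by linarith
    calc _ ≤ N * (η / 4 * L) := by gcongr
      _ = _ := by ring
  have b2 : 35 * L ^ 2 * (L + 1) * D ≤ η / 4 * N * L := by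
    calc _ ≤ 35 * L ^ 2 * (L + 1) * (N / L ^ 3) := by gcongr
      _ = 35 * N * ((L + 1) / L) := by field_simp
      _ ≤ 35 * N * (9 / 8) := by
          have : (L + 1) / L ≤ 9 / 8 := by
            rw [div_le_div_iff₀ hL0 (by norm_num)]; linarith
          gcongr
      _ ≤ N * (η / 4 * L) := by
          rw [div_le_iff₀ hη] at hLη
          nlinarith
      _ = _ := by ring
  have hΦ : ‖eeInt N (α - r)‖ / r.den.totient ≤ η * N / 800 := by
    rw [div_le_iff₀ hphi]
    rcases le_or_gt r.den Q1 with h | h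
    · have c1 := hα r.den r.den_pos (h.trans hQ1le)
      have c2 : nd (r.den * α) ≤ r.den * |α - r| := by
        have e : (r.den : ℝ) * α - r.num = r.den * (α - r) := by
          rw [show (r : ℝ) = r.num / r.den from Rat.cast_def r]; field_simp
        have := nd_le (r.den * α) r.num
        rwa [e, abs_mul, abs_of_pos hden] at this
      have c3 : (r.den : ℝ) ≤ Q1 := by exact_mod_cast h
      have c4 := abs_mul_norm_eeInt_le N (α - r)
      have c5 : (Q : ℝ) / N ≤ Q1 * |α - r| := by
        refine (c1.trans c2).trans ?_
        gcongr
      rw [div_le_iff₀ hN'] at c5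
      have c6 : 800 * (Q1 : ℝ) ≤ Q * η := by
        have : (Q2 : ℝ) ≤ Q := by exact_mod_cast hQ2le
        rw [div_le_iff₀ hη] at hQ2
        calc _ ≤ _ := hQ2
          _ ≤ _ := by gcongr
      have hQp : (0 : ℝ) < Q := by exact_mod_cast hQpos
      have c7 : Q * ‖eeInt N (α - r)‖ ≤ Q1 * N := by
        calc _ ≤ Q1 * |α - r| * N * ‖eeInt N (α - r)‖ := by gcongr
          _ = Q1 * N * (|α - r| * ‖eeInt N (α - r)‖) := by ring
          _ ≤ Q1 * N * 1 := by gcongr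
          _ = _ := by ring
      have c8 : Q * ‖eeInt N (α - r)‖ ≤ Q * (η * N / 800) := by
        have : 800 * (Q1 : ℝ) * N ≤ Q * η * N := by gcongr
        linarith
      have c9 := le_of_mul_le_mul_left c8 hQp
      have c10 : (1 : ℝ) ≤ r.den.totient := by exact_mod_cast Nat.totient_pos.2 r.den_pos
      calc _ ≤ η * N / 800 * 1 := by linarith
        _ ≤ _ := by gcongr
    · have c1 := norm_eeInt_le (Nat.cast_nonneg N) (α - r)
      have c2 : (m : ℝ) ≤ r.den.totient := by exact_mod_cast hQ1 _ h
      rw [div_lt_iff₀ hη] at hm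
      calc _ ≤ (N : ℝ) := c1
        _ ≤ N * (m * η / 800) := le_mul_of_one_le_right hN'.le (by linarith)
        _ ≤ N * (r.den.totient * η / 800) := by gcongr
        _ = _ := by ring
  have b3 : ‖eeInt N (α - r)‖ * (100 * ((Real.log ((N : ℝ) / D) + 1) ^ 2 + L) / r.den.totient) ≤ η / 4 * N * L := by
    have c1 : (Real.log ((N : ℝ) / D) + 1) ^ 2 ≤ L := le_trans (by gcongr) hL2
    calc _ ≤ ‖eeInt N (α - r)‖ * (100 * (L + L) / r.den.totient) := by gcongr
      _ = ‖eeInt N (α - r)‖ / r.den.totient * (200 * L) := by ring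
      _ ≤ η * N / 800 * (200 * L) := by gcongr
      _ = _ := by ring
  have : 0 ≤ η / 4 * N * L := by positivity
  linarith

/-- The exponential sum over primes up to `X`, with logarithmic weights. -/
noncomputable def thSum (X : ℕ) (x : ℝ) : ℂ := ∑ k ∈ Finset.Ioc 0 X, (th k : ℂ) * ee (k * x)

lemma norm_th_mul_ee (k : ℕ) (x : ℝ) : ‖(th k : ℂ) * ee x‖ = th k := by
  rw [norm_mul, norm_ee, mul_one, Complex.norm_real, Real.norm_eq_abs, abs_of_nonneg (th_nonneg k)]

lemma sum_th_le (n : ℕ) : ∑ k ∈ Finset.Ioc 0 n, th k ≤ 6 * n :=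
  (Finset.sum_le_sum fun k _ ↦ th_le_vonMangoldt k).trans (sum_vonMangoldt_le' n)

lemma norm_thSum_le (X : ℕ) (x : ℝ) : ‖thSum X x‖ ≤ 6 * X := by
  refine (norm_sum_le _ _).trans ?_
  simp only [norm_th_mul_ee]
  exact sum_th_le X

/-- The prime number theorem in short intervals, upper bound. -/
lemma exists_sum_th_Ioc_le {η : ℝ} (hη : 0 < η) : ∃ C > 0, ∀ a b : ℕ, a ≤ b →
    ∑ k ∈ Finset.Ioc a b, th k ≤ (b - a) + η * b + C := by
  obtain ⟨C, hC, h⟩ := exists_pnt_ap 1 one_pos (η / 2) (by positivity)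
  refine ⟨2 * C, by positivity, fun a b hab ↦ ?_⟩
  have key : ∀ n : ℕ, |∑ k ∈ Finset.Ioc 0 n, th k - n| ≤ η / 2 * n + C := by
    intro n
    have := h n 0
    rw [Finset.filter_true_of_mem fun _ _ ↦ Nat.modEq_one] at this
    rw [← Finset.Icc_add_one_left_eq_Ioc, zero_add]
    simpa using this
  have h1 := Finset.sum_Ioc_consecutive th (Nat.zero_le a) hab
  have h2 := abs_le.1 (key a)
  have h3 := abs_le.1 (key b)
  have h4 : (a : ℝ) ≤ b := by exact_mod_cast hab
  have h5 : η / 2 * a ≤ η / 2 * b := by gcongr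
  linarith [h2.1, h3.2]

lemma exists_spaced_subset {ι : Type} [DecidableEq ι] (s : Finset ι) (x : ι → ℝ) {δ : ℝ} (hδ : 0 < δ) :
    ∃ t ⊆ s, (∀ i ∈ t, ∀ j ∈ t, i ≠ j → δ ≤ nd (x i - x j)) ∧
      ∀ i ∈ s, ∃ j ∈ t, nd (x i - x j) < δ := by
  induction s using Finset.induction_on with
  | empty => exact ⟨∅, by simp⟩
  | insert m s hm ih =>
    obtain ⟨t, hts, ht1, ht2⟩ := ih
    by_cases h : ∃ j ∈ t, nd (x m - x j) < δ
    · refine ⟨t, hts.trans (Finset.subset_insert _ _), ht1, fun i hi ↦ ?_⟩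
      rcases Finset.mem_insert.1 hi with rfl | hi
      · exact h
      · exact ht2 i hi
    · push Not at h
      refine ⟨insert m t, Finset.insert_subset_insert _ hts, ?_, ?_⟩
      · intro i hi j hj hij
        rcases Finset.mem_insert.1 hi with hi | hi <;> rcases Finset.mem_insert.1 hj with hj | hj
        · exact absurd (hi.trans hj.symm) hij
        · rw [hi]; exact h j hj
        · rw [hj, ← nd_neg, neg_sub]; exact h i hi
        · exact ht1 i hi j hj hij
      · intro i hi
        rcases Finset.mem_insert.1 hi with hi | hi
        · exact ⟨m, Finset.mem_insert_self _ _, by rw [hi, sub_self]; simpa [nd] using hδ⟩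
        · obtain ⟨j, hj, h'⟩ := ht2 i hi
          exact ⟨j, Finset.mem_insert_of_mem hj, h'⟩

/-- Large values of exponential sums over primes are rare. -/
lemma exists_card_large_th : ∃ C : ℝ, 0 < C ∧ ∀ (ι : Type) (s : Finset ι) (x : ι → ℝ) (L : ℕ) (κ : ℝ),
    2 ≤ L → 0 < κ → (∀ i ∈ s, ∀ j ∈ s, i ≠ j → 1 / (L : ℝ) ≤ nd (x i - x j)) →
    ∀ a : ℕ → ℂ, (∀ n, ‖a n‖ ≤ th n) → (∀ n, a n ≠ 0 → L < n ^ 2) →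
    (∀ i ∈ s, κ * L ≤ ‖expSum a L (x i)‖) → (s.card : ℝ) ≤ C * κ ^ (-(5 / 2) : ℝ) := by
  obtain ⟨C, hC, h⟩ := exists_largeValues_prime
  refine ⟨(6 * C) ^ (5 / 4 : ℝ), by positivity, ?_⟩
  intro ι s x L κ hL hκ hs a ha1 ha2 hlarge
  rcases s.eq_empty_or_nonempty with rfl | hne
  · simp; positivity
  have hc : (0 : ℝ) < s.card := by exact_mod_cast hne.card_pos
  have hL' : (0 : ℝ) < L := by exact_mod_cast (by omega : 0 < L)
  have hlog : 0 < Real.log L := Real.log_pos (by exact_mod_cast hL)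
  have h1 := h ι s x L (by omega) hs a fun n hn ↦ ⟨by
    by_contra hp
    have := ha1 n
    rw [th, if_neg hp] at this
    exact hn (norm_le_zero_iff.1 this), ha2 n hn⟩
  have h2 : s.card * (κ * L) ^ 2 ≤ ∑ i ∈ s, ‖expSum a L (x i)‖ ^ 2 := by
    rw [← nsmul_eq_mul, ← Finset.sum_const]
    refine Finset.sum_le_sum fun i hi ↦ ?_
    have := hlarge i hi
    gcongr
  have h3 : ∑ n ∈ Finset.range (L + 1), ‖a n‖ ^ 2 ≤ 6 * L * Real.log L := by
    calc _ ≤ ∑ n ∈ Finset.range (L + 1), th n * Real.log L := by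
          refine Finset.sum_le_sum fun n hn ↦ ?_
          rw [Finset.mem_range] at hn
          have b1 := ha1 n
          have b2 : th n ≤ Real.log L := by
            rcases Nat.eq_zero_or_pos n with rfl | h0
            · simp [th, hlog.le]
            · exact (th_le_log n).trans (Real.log_le_log (by exact_mod_cast h0) (by exact_mod_cast (by omega : n ≤ L)))
          rw [sq]
          exact mul_le_mul b1 (b1.trans b2) (norm_nonneg _) (th_nonneg n)
      _ = (∑ n ∈ Finset.Ioc 0 L, th n) * Real.log L := by
          rw [← Finset.sum_mul, Finset.sum_range_succ', ← Finset.Icc_add_one_left_eq_Ioc, zero_add,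
            ← Finset.Ico_add_one_right_eq_Icc, Finset.sum_Ico_eq_sum_range, Nat.add_sub_cancel]
          simp only [th, Nat.not_prime_zero, if_false, zero_add, add_comm]
      _ ≤ _ := by
          gcongr; exact sum_th_le L
  have h4 : (s.card : ℝ) * (κ * L) ^ 2 * Real.log L ≤
      C * (s.card : ℝ) ^ (1 / 5 : ℝ) * L * (6 * L * Real.log L) := by
    calc _ ≤ _ := mul_le_mul_of_nonneg_right h2 hlog.le
      _ ≤ _ := h1
      _ ≤ _ := by gcongr
  have e1 : (s.card : ℝ) ^ (1 / 5 : ℝ) * (s.card : ℝ) ^ (4 / 5 : ℝ) = s.card := by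
    rw [← Real.rpow_add hc, show (1 / 5 + 4 / 5 : ℝ) = 1 by norm_num, Real.rpow_one]
  have hc5 : 0 < (s.card : ℝ) ^ (1 / 5 : ℝ) := by positivity
  have h5 : (s.card : ℝ) ^ (4 / 5 : ℝ) * κ ^ 2 ≤ 6 * C := by
    have : ((s.card : ℝ) ^ (1 / 5 : ℝ) * L ^ 2 * Real.log L) * ((s.card : ℝ) ^ (4 / 5 : ℝ) * κ ^ 2) ≤
        ((s.card : ℝ) ^ (1 / 5 : ℝ) * L ^ 2 * Real.log L) * (6 * C) := by
      calc _ = ((s.card : ℝ) ^ (1 / 5 : ℝ) * (s.card : ℝ) ^ (4 / 5 : ℝ)) * (κ * L) ^ 2 * Real.log L := by ring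
        _ ≤ C * (s.card : ℝ) ^ (1 / 5 : ℝ) * L * (6 * L * Real.log L) := by rw [e1]; exact h4
        _ = _ := by ring
    exact le_of_mul_le_mul_left this (by positivity)
  have h6 : (s.card : ℝ) ^ (4 / 5 : ℝ) ≤ 6 * C * κ ^ (-2 : ℝ) := by
    rw [Real.rpow_neg hκ.le, Real.rpow_two, ← div_eq_mul_inv, le_div_iff₀ (by positivity)]
    exact h5
  calc (s.card : ℝ) = ((s.card : ℝ) ^ (4 / 5 : ℝ)) ^ (5 / 4 : ℝ) := by
        rw [← Real.rpow_mul hc.le, show (4 / 5 * (5 / 4) : ℝ) = 1 by norm_num, Real.rpow_one]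
    _ ≤ (6 * C * κ ^ (-2 : ℝ)) ^ (5 / 4 : ℝ) := by gcongr
    _ = _ := by
        rw [Real.mul_rpow (by positivity) (by positivity), ← Real.rpow_mul hκ.le,
          show (-2 * (5 / 4) : ℝ) = -(5 / 2) by norm_num]

/-- On minor arcs, few primes `m` in a dyadic block have `m * α` close to a given `c * α`. -/
lemma exists_sum_th_close_le {κ : ℝ} (hκ : 0 < κ) (hκ1 : κ ≤ 1) : ∃ Q : ℕ, ∀ Q' ≥ Q, ∃ M0 : ℕ, ∀ M ≥ M0, ∀ N : ℕ,
    4 * M ^ 2 ≤ N → ∀ α : ℝ, (∀ q : ℕ, 1 ≤ q → q ≤ Q' → (Q' : ℝ) / N ≤ nd (q * α)) →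
    ∀ c ∈ Finset.Ioc M (2 * M),
    ∑ m ∈ (Finset.Ioc M (2 * M)).filter (fun m : ℕ ↦ nd (m * α - c * α) < 1 / ((N / M : ℕ) : ℝ)), th m ≤ κ * M := by
  obtain ⟨C, hC, hBT⟩ := exists_brunTitchmarsh
  have hlim : Tendsto (fun q : ℕ ↦ C * (q : ℝ) ^ (-(4 / 5) : ℝ)) atTop (nhds 0) := by
    have := ((tendsto_rpow_neg_atTop (by norm_num : (0 : ℝ) < 4 / 5)).comp
      tendsto_natCast_atTop_atTop).const_mul C
    simpa using this
  obtain ⟨Q1, hQ1⟩ := eventually_atTop.1 (hlim.eventually (ge_mem_nhds hκ))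
  obtain ⟨C2, hC2, hshort⟩ := exists_sum_th_Ioc_le (η := κ / 12) (by positivity)
  obtain ⟨Q2, hQ2⟩ := exists_nat_ge (16 * Q1 / κ)
  refine ⟨max 1 (max Q1 Q2), fun Q hQ ↦ ?_⟩
  have hQ1le : Q1 ≤ Q := le_trans (le_trans (le_max_left _ _) (le_max_right _ _)) hQ
  have hQ2le : Q2 ≤ Q := le_trans (le_trans (le_max_right _ _) (le_max_right _ _)) hQ
  have hQpos : 1 ≤ Q := le_trans (le_max_left _ _) hQ
  obtain ⟨M0, hM0⟩ := exists_nat_ge ((C2 + 2) * 4 / κ)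
  refine ⟨max 1 M0, fun M hM N hMN α hα c hc ↦ ?_⟩
  have hM1 : 1 ≤ M := le_trans (le_max_left _ _) hM
  have hM' : (0 : ℝ) < M := by exact_mod_cast hM1
  have hMbig : (C2 + 2) * 4 ≤ κ * M := by
    have : (M0 : ℝ) ≤ M := by exact_mod_cast (le_trans (le_max_right _ _) hM)
    rw [div_le_iff₀ hκ] at hM0
    nlinarith
  set L := N / M with hL
  have hL4 : 4 * M ≤ L := (Nat.le_div_iff_mul_le hM1).2 (by nlinarith)
  have hL' : (4 * M : ℝ) ≤ L := by exact_mod_cast hL4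
  have hL0 : (0 : ℝ) < L := by linarith
  have hN' : (0 : ℝ) < N := by
    have : 0 < N := by nlinarith
    exact_mod_cast this
  have hNL : (N : ℝ) ≤ 2 * M * L := by
    have h1 : N < M * (L + 1) := by rw [hL]; exact Nat.lt_mul_div_succ N hM1
    have h2 : N ≤ 2 * M * L := by nlinarith
    exact_mod_cast h2
  obtain ⟨r, hr1, hr2⟩ := Real.exists_rat_abs_sub_le_and_den_le α (n := 2 * M) (by omega)
  push_cast at hr1
  set q := r.den with hq
  have hq0 : (0 : ℝ) < q := by exact_mod_cast r.den_pos
  set β := α - r with hβ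
  rw [Finset.mem_Ioc] at hc
  have hαβ (h : ℤ) : (h : ℝ) * α = h * β + ((h * r.num : ℤ) : ℝ) / q := by
    rw [hβ, show (r : ℝ) = r.num / r.den from Rat.cast_def r]; push_cast; ring
  have hclose : ∀ m ∈ Finset.Ioc M (2 * M), nd (m * α - c * α) < 1 / (L : ℝ) →
      (q : ℤ) ∣ (m : ℤ) - c ∧ |((m : ℝ) - c) * β| < 1 / L := by
    intro m hm hlt
    rw [Finset.mem_Ioc] at hm
    set h : ℤ := (m : ℤ) - c with hh
    have hhr : (h : ℝ) = m - c := by rw [hh]; push_cast; ring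
    have hab : |(h : ℝ)| ≤ M := by
      have : |h| ≤ (M : ℤ) := by rw [abs_le]; constructor <;> omega
      exact_mod_cast this
    have hb : |(h : ℝ) * β| ≤ 1 / (2 * q) := by
      rw [abs_mul]
      calc |(h : ℝ)| * |β| ≤ M * (1 / ((2 * M + 1) * q)) := by gcongr
        _ ≤ 1 / (2 * q) := by
          rw [mul_one_div, div_le_div_iff₀ (by positivity) (by positivity)]
          nlinarith
    have e : (m : ℝ) * α - c * α = h * β + ((h * r.num : ℤ) : ℝ) / q := by
      rw [← hαβ, hhr]; ring
    rw [e] at hlt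
    have hdvd : (q : ℤ) ∣ h := by
      by_contra hnd
      have hcop : IsCoprime (q : ℤ) r.num :=
        (Int.isCoprime_iff_gcd_eq_one.2 (by simpa [Int.gcd] using r.reduced)).symm
      have h1 := nd_intCast_div_ge r.den_pos (m := h * r.num) fun hd ↦ hnd (hcop.dvd_of_dvd_mul_right hd)
      have h2 := nd_sub_le (h * β + ((h * r.num : ℤ) : ℝ) / q) (h * β)
      rw [add_sub_cancel_left] at h2
      have h3 := nd_le_abs (h * β)
      have h4 : 1 / (2 * (q : ℝ)) = 1 / q / 2 := by field_simp
      have h5 : 1 / (L : ℝ) ≤ 1 / (2 * q) := by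
        have : (q : ℝ) ≤ 2 * M := by exact_mod_cast hr2
        gcongr; linarith
      linarith
    refine ⟨hdvd, ?_⟩
    obtain ⟨t, ht⟩ := hdvd
    have e2 : ((h * r.num : ℤ) : ℝ) / q = ((t * r.num : ℤ) : ℝ) := by
      rw [ht]; push_cast; field_simp
    rw [e2, nd_add_int, nd_eq_abs] at hlt
    · rwa [← hhr]
    · refine hb.trans ?_
      have : (1 : ℝ) ≤ q := by exact_mod_cast r.den_pos
      gcongr; linarith
  rcases le_or_gt q Q1 with hqQ | hqQ
  · have c1 := hα q r.den_pos (hqQ.trans hQ1le)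
    have c2 : nd (q * α) ≤ q * |β| := by
      have e : (q : ℝ) * α - r.num = q * β := by
        rw [hβ, show (r : ℝ) = r.num / r.den from Rat.cast_def r, ← hq]; field_simp
      have := nd_le (q * α) r.num
      rwa [e, abs_mul, abs_of_pos hq0] at this
    have c3 : (q : ℝ) ≤ Q1 := by exact_mod_cast hqQ
    have c5 : (Q : ℝ) ≤ Q1 * |β| * N := by
      rw [← div_le_iff₀ hN']
      refine (c1.trans c2).trans ?_
      gcongr
    have hQp : (0 : ℝ) < Q := by exact_mod_cast hQpos
    have c6 : 16 * (Q1 : ℝ) ≤ Q * κ := by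
      have : (Q2 : ℝ) ≤ Q := by exact_mod_cast hQ2le
      rw [div_le_iff₀ hκ] at hQ2
      exact hQ2.trans (by gcongr)
    set t := ⌊κ * M / 8⌋₊ with ht
    have htle : (t : ℝ) ≤ κ * M / 8 := Nat.floor_le (by positivity)
    have hmem : ∀ m ∈ (Finset.Ioc M (2 * M)).filter (fun m : ℕ ↦ nd (m * α - c * α) < 1 / (L : ℝ)),
        m ∈ Finset.Ioc (c - (t + 1)) (c + t) := by
      intro m hm
      rw [Finset.mem_filter] at hm
      obtain ⟨-, h1⟩ := hclose m hm.1 hm.2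
      rw [abs_mul] at h1
      have h2 : |(m : ℝ) - c| ≤ κ * M / 8 := by
        have h3 : |(m : ℝ) - c| * Q ≤ Q * (κ * M / 8) := by
          calc _ ≤ |(m : ℝ) - c| * (Q1 * |β| * (2 * M * L)) := by gcongr; exact c5.trans (by gcongr)
            _ = (|(m : ℝ) - c| * |β|) * L * (2 * Q1 * M) := by ring
            _ ≤ (1 / L) * L * (2 * Q1 * M) := by gcongr
            _ = 16 * Q1 * M / 8 := by field_simp; ring
            _ ≤ Q * κ * M / 8 := by gcongr
            _ = _ := by ring
        rw [mul_comm] at h3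
        exact le_of_mul_le_mul_left h3 hQp
      have h3 : ((m : ℤ) - c).natAbs ≤ t := by
        refine Nat.le_floor ?_
        rw [Nat.cast_natAbs]
        push_cast
        exact h2
      rw [Finset.mem_Ioc] at hm ⊢
      omega
    calc _ ≤ ∑ m ∈ Finset.Ioc (c - (t + 1)) (c + t), th m :=
          Finset.sum_le_sum_of_subset_of_nonneg hmem fun _ _ _ ↦ th_nonneg _
      _ ≤ ((c + t : ℕ) - (c - (t + 1) : ℕ) : ℝ) + κ / 12 * (c + t : ℕ) + C2 := hshort _ _ (by omega)
      _ ≤ (2 * t + 1) + κ / 12 * (3 * M) + C2 := by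
          have h1 : (((c + t : ℕ) : ℝ)) ≤ 2 * t + 1 + ((c - (t + 1) : ℕ) : ℝ) := by
            have : c + t ≤ 2 * t + 1 + (c - (t + 1)) := by omega
            exact_mod_cast this
          have h : t ≤ M := by
            have : (t : ℝ) ≤ M := by nlinarith
            exact_mod_cast this
          have h2 : ((c + t : ℕ) : ℝ) ≤ 3 * M := by
            have : c + t ≤ 3 * M := by omega
            exact_mod_cast this
          have : κ / 12 * ((c + t : ℕ) : ℝ) ≤ κ / 12 * (3 * M) := by gcongr
          linarith
      _ ≤ κ * M := by linarith
  · calc _ ≤ ∑ m ∈ Finset.Ioc M (2 * M) with m ≡ c [MOD q], th m := by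
          refine Finset.sum_le_sum_of_subset_of_nonneg ?_ fun _ _ _ ↦ th_nonneg _
          intro m hm
          rw [Finset.mem_filter] at hm ⊢
          refine ⟨hm.1, ?_⟩
          have := (hclose m hm.1 hm.2).1
          exact ((Nat.modEq_iff_dvd).2 this).symm
      _ ≤ C * M * (q : ℝ) ^ (-(4 / 5) : ℝ) := hBT M q c hM1 r.den_pos (by omega)
      _ = C * (q : ℝ) ^ (-(4 / 5) : ℝ) * M := by ring
      _ ≤ κ * M := by
          gcongr; exact hQ1 q hqQ.le

/-- `α` lies on the minor arcs of level `Q` for sums of length `N`. -/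
def Minor (Q N : ℕ) (α : ℝ) : Prop := ∀ q : ℕ, 1 ≤ q → q ≤ Q → (Q : ℝ) / N ≤ nd (q * α)

/-- The coefficients `th` restricted to `√L < n ≤ X`. -/
noncomputable def thTail (X L n : ℕ) : ℂ := if n ≤ X ∧ L < n ^ 2 then (th n : ℂ) else 0

lemma norm_thTail_le (X L n : ℕ) : ‖thTail X L n‖ ≤ th n := by
  rw [thTail]
  split_ifs
  · rw [Complex.norm_real, Real.norm_eq_abs, abs_of_nonneg (th_nonneg n)]
  · rw [norm_zero]; exact th_nonneg n

lemma norm_thSum_sub_expSum_le {X L : ℕ} (hX : X ≤ L) (x : ℝ) :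
    ‖thSum X x - expSum (thTail X L) L x‖ ≤ 6 * (Nat.sqrt L : ℕ) := by
  have h1 : expSum (thTail X L) L x =
      ∑ k ∈ (Finset.Ioc 0 X).filter (fun k ↦ L < k ^ 2), (th k : ℂ) * ee (k * x) := by
    rw [expSum]
    simp only [thTail, ite_mul, zero_mul]
    rw [← Finset.sum_filter]
    refine Finset.sum_congr ?_ fun _ _ ↦ rfl
    ext k
    simp only [Finset.mem_filter, Finset.mem_range, Finset.mem_Ioc]
    constructor
    · rintro ⟨-, h2, h3⟩
      exact ⟨⟨Nat.pos_of_ne_zero fun h ↦ by simp [h] at h3, h2⟩, h3⟩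
    · rintro ⟨⟨-, h2⟩, h3⟩
      exact ⟨by omega, h2, h3⟩
  rw [h1, thSum, ← Finset.sum_filter_add_sum_filter_not (Finset.Ioc 0 X) (fun k ↦ L < k ^ 2),
    add_sub_cancel_left]
  refine (norm_sum_le _ _).trans ?_
  simp only [norm_th_mul_ee]
  refine le_trans (Finset.sum_le_sum_of_subset_of_nonneg ?_ fun _ _ _ ↦ th_nonneg _) (sum_th_le _)
  intro k hk
  rw [Finset.mem_filter, Finset.mem_Ioc] at hk
  rw [Finset.mem_Ioc]
  exact ⟨hk.1.1, Nat.le_sqrt.2 (by nlinarith [hk.2])⟩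

/-- On minor arcs, the sums over primes along multiples of `α` are rarely large. -/
lemma exists_sum_th_bad_le {κ : ℝ} (hκ : 0 < κ) : ∃ Q : ℕ, ∀ Q' ≥ Q, ∃ M0 : ℕ, ∀ M ≥ M0,
    ∀ N : ℕ, 4 * M ^ 2 ≤ N → ∀ α : ℝ, Minor Q' N α → ∀ X ≤ N / M,
    ∑ m ∈ (Finset.Ioc M (2 * M)).filter (fun m : ℕ ↦ κ * ((N / M : ℕ) : ℝ) ≤ ‖thSum X (m * α)‖), th m
      ≤ κ * M := by
  obtain ⟨C, hC, hcard⟩ := exists_card_large_th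
  set R := C * (κ / 2) ^ (-(5 / 2) : ℝ) with hR
  have hR0 : 0 < R := by positivity
  obtain ⟨Q, hQ⟩ := exists_sum_th_close_le (κ := min 1 (κ / R)) (by positivity) (min_le_left _ _)
  refine ⟨Q, fun Q' hQ' ↦ ?_⟩
  obtain ⟨M1, hM1⟩ := hQ Q' hQ'
  set B := ⌈12 / κ⌉₊ with hB
  refine ⟨max 1 (max M1 (B * B)), fun M hM N hMN α hα X hX ↦ ?_⟩
  have hMpos : 1 ≤ M := le_trans (le_max_left _ _) hM
  have hMM1 : M1 ≤ M := le_trans (le_trans (le_max_left _ _) (le_max_right _ _)) hM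
  have hMB : B * B ≤ M := le_trans (le_trans (le_max_right _ _) (le_max_right _ _)) hM
  have hM' : (0 : ℝ) < M := by exact_mod_cast hMpos
  have hclose := hM1 M hMM1 N hMN α hα
  set L := N / M with hL
  have hL4 : 4 * M ≤ L := (Nat.le_div_iff_mul_le hMpos).2 (by nlinarith)
  have hL0 : (0 : ℝ) < L := by exact_mod_cast (by omega : 0 < L)
  have hsqrt : 12 * ((Nat.sqrt L : ℕ) : ℝ) ≤ κ * L := by
    have h1 : B ≤ Nat.sqrt L := Nat.le_sqrt.2 (by omega)
    have h2 : (12 : ℝ) ≤ κ * B := by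
      have := Nat.le_ceil (12 / κ)
      rw [div_le_iff₀ hκ] at this
      linarith
    have h3 : ((Nat.sqrt L : ℕ) : ℝ) * (Nat.sqrt L : ℕ) ≤ L := by exact_mod_cast Nat.sqrt_le L
    have h4 : (B : ℝ) ≤ (Nat.sqrt L : ℕ) := by exact_mod_cast h1
    calc _ ≤ κ * (Nat.sqrt L : ℕ) * (Nat.sqrt L : ℕ) := by
          gcongr; exact h2.trans (by gcongr)
      _ ≤ _ := by rw [mul_assoc]; gcongr
  set s := (Finset.Ioc M (2 * M)).filter (fun m : ℕ ↦ κ * (L : ℝ) ≤ ‖thSum X (m * α)‖) with hs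
  obtain ⟨t, hts, ht1, ht2⟩ := exists_spaced_subset s (fun m : ℕ ↦ (m : ℝ) * α) (δ := 1 / (L : ℝ))
    (by positivity)
  have htR : (t.card : ℝ) ≤ R := by
    refine hcard ℕ t (fun m : ℕ ↦ (m : ℝ) * α) L (κ / 2) (by omega) (by positivity) ht1
      (thTail X L) (norm_thTail_le X L) ?_ ?_
    · intro n hn
      by_contra h
      exact hn (by rw [thTail, if_neg fun h' ↦ h h'.2])
    · intro i hi
      have h1 := (Finset.mem_filter.1 (hts hi)).2
      have h2 := norm_thSum_sub_expSum_le hX ((i : ℝ) * α)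
      have h3 := norm_sub_norm_le (thSum X (i * α)) (expSum (thTail X L) L (i * α))
      linarith
  have hnn : ∀ m j : ℕ, 0 ≤ if nd ((m : ℝ) * α - j * α) < 1 / (L : ℝ) then th m else 0 := by
    intro m j
    split_ifs
    · exact th_nonneg m
    · exact le_rfl
  have hcover : ∀ m ∈ s, th m ≤ ∑ j ∈ t,
      if nd ((m : ℝ) * α - j * α) < 1 / (L : ℝ) then th m else 0 := by
    intro m hm
    obtain ⟨j, hj, hlt⟩ := ht2 m hm
    have := Finset.single_le_sum (fun j _ ↦ hnn m j) hj
    rwa [if_pos hlt] at this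
  calc ∑ m ∈ s, th m ≤ ∑ m ∈ Finset.Ioc M (2 * M), ∑ j ∈ t,
        if nd ((m : ℝ) * α - j * α) < 1 / (L : ℝ) then th m else 0 := by
        exact (Finset.sum_le_sum hcover).trans (Finset.sum_le_sum_of_subset_of_nonneg
          (Finset.filter_subset _ _) fun m _ _ ↦ Finset.sum_nonneg fun j _ ↦ hnn m j)
    _ = ∑ j ∈ t, ∑ m ∈ (Finset.Ioc M (2 * M)).filter
          (fun m : ℕ ↦ nd ((m : ℝ) * α - j * α) < 1 / (L : ℝ)), th m := by
        rw [Finset.sum_comm]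
        exact Finset.sum_congr rfl fun j _ ↦ (Finset.sum_filter _ _).symm
    _ ≤ ∑ j ∈ t, min 1 (κ / R) * M :=
        Finset.sum_le_sum fun j hj ↦ hclose j (Finset.mem_filter.1 (hts hj)).1
    _ = t.card * (min 1 (κ / R) * M) := by rw [Finset.sum_const, nsmul_eq_mul]
    _ ≤ R * ((κ / R) * M) := by gcongr; exact min_le_right _ _
    _ = κ * M := by field_simp

/-- The type II estimate for a dyadic block. -/
lemma exists_block_le {η : ℝ} (hη : 0 < η) : ∃ Q : ℕ, ∀ Q' ≥ Q, ∃ M0 : ℕ, ∀ M ≥ M0,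
    ∀ N : ℕ, 4 * M ^ 2 ≤ N → ∀ α : ℝ, Minor Q' N α →
    ∑ m ∈ Finset.Ioc M (2 * M), th m * ‖thSum (N / m) (m * α)‖ ≤ η * N := by
  obtain ⟨k0, hk0⟩ := exists_nat_ge (60 / η)
  obtain ⟨k, hk1, hk⟩ : ∃ k : ℕ, 1 ≤ k ∧ 60 / η ≤ k :=
    ⟨max 1 k0, le_max_left _ _, hk0.trans (by exact_mod_cast le_max_right _ _)⟩
  have hk' : (1 : ℝ) ≤ k := by exact_mod_cast hk1
  have hkpos : (0 : ℝ) < k := by linarith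
  obtain ⟨Q, hQ⟩ := exists_sum_th_bad_le (κ := 1 / (k : ℝ) ^ 2) (by positivity)
  obtain ⟨C, hC, hshort⟩ := exists_sum_th_Ioc_le (η := 1 / (k : ℝ)) (by positivity)
  obtain ⟨M2, hM2⟩ := exists_nat_ge ((C + 1) * k)
  refine ⟨Q, fun Q' hQ' ↦ ?_⟩
  obtain ⟨M1, hM1⟩ := hQ Q' hQ'
  refine ⟨max 1 (max M1 M2), fun M hM N hMN α hα ↦ ?_⟩
  have hMpos : 1 ≤ M := le_trans (le_max_left _ _) hM
  have hMM1 : M1 ≤ M := le_trans (le_trans (le_max_left _ _) (le_max_right _ _)) hM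
  have hMM2 : M2 ≤ M := le_trans (le_trans (le_max_right _ _) (le_max_right _ _)) hM
  have hM' : (0 : ℝ) < M := by exact_mod_cast hMpos
  have hbad := hM1 M hMM1 N hMN α hα
  have hLN : ((N / M : ℕ) : ℝ) * M ≤ N := by exact_mod_cast Nat.div_mul_le_self N M
  have hmono : ∀ m ∈ Finset.Ioc M (2 * M), N / m ≤ N / M := fun m hm ↦
    Nat.div_le_div_left (Finset.mem_Ioc.1 hm).1.le hMpos
  set L := N / M with hL
  have hL4 : 4 * M ≤ L := (Nat.le_div_iff_mul_le hMpos).2 (by nlinarith)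
  have hLpos : 0 < L := by omega
  have hL0 : (0 : ℝ) < L := by exact_mod_cast hLpos
  have hLC : (C + 1) * k ≤ L := hM2.trans (by exact_mod_cast (by omega : M2 ≤ L))
  have hLC' : C + 1 ≤ L / k := by rwa [le_div_iff₀ hkpos]
  have hgrid : ∀ i ∈ Finset.range (k + 1), i * L / k ≤ L := fun i hi ↦ by
    rw [Finset.mem_range] at hi
    exact Nat.div_le_of_le_mul (Nat.mul_le_mul_right L (by omega))
  have hpt : ∀ m ∈ Finset.Ioc M (2 * M), th m * ‖thSum (N / m) (m * α)‖ ≤ th m * (4 * L / k) +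
      ∑ i ∈ Finset.range (k + 1),
        if 1 / (k : ℝ) ^ 2 * L ≤ ‖thSum (i * L / k) (m * α)‖ then th m * (6 * L) else 0 := by
    intro m hm
    have hX := hmono m hm
    set X := N / m with hXdef
    have hX' : (X : ℝ) ≤ L := by exact_mod_cast hX
    have hnn : ∀ j ∈ Finset.range (k + 1), 0 ≤
        if 1 / (k : ℝ) ^ 2 * L ≤ ‖thSum (j * L / k) (m * α)‖ then th m * (6 * L) else 0 := by
      intro j _
      have := th_nonneg m
      split_ifs <;> positivity
    set i := X * k / L with hi
    have hik : i ≤ k := Nat.div_le_of_le_mul (Nat.mul_le_mul_right k hX)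
    have hi1 : i * L ≤ X * k := Nat.div_mul_le_self _ _
    have hi2 : X * k < (i + 1) * L := by
      rw [mul_comm (i + 1)]; exact Nat.lt_mul_div_succ _ hLpos
    set Y := i * L / k with hY
    have hY1 : Y ≤ X := Nat.div_le_of_le_mul (by rw [mul_comm k]; exact hi1)
    have hY2 : i * L < k * (Y + 1) := Nat.lt_mul_div_succ _ hk1
    by_cases hbig : 1 / (k : ℝ) ^ 2 * L ≤ ‖thSum Y (m * α)‖
    · have h1 := Finset.single_le_sum hnn (Finset.mem_range.2 (by omega : i < k + 1))
      rw [if_pos hbig] at h1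
      have h2 : ‖thSum X (m * α)‖ ≤ 6 * L := (norm_thSum_le _ _).trans (by gcongr)
      have h3 := mul_le_mul_of_nonneg_left h2 (th_nonneg m)
      have h4 : 0 ≤ th m * (4 * L / k) := mul_nonneg (th_nonneg m) (by positivity)
      linarith
    · have h1 : ‖thSum X (m * α) - thSum Y (m * α)‖ ≤ ∑ n ∈ Finset.Ioc Y X, th n := by
        rw [thSum, thSum, ← Finset.sum_Ioc_consecutive _ (Nat.zero_le Y) hY1, add_sub_cancel_left]
        refine (norm_sum_le _ _).trans (le_of_eq ?_)
        simp only [norm_th_mul_ee]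
      have h2 := hshort Y X hY1
      have h3 : ((X : ℝ) - Y) ≤ L / k + 1 := by
        have e : X * k ≤ k * (Y + 1) + L := by nlinarith
        have e' : (X : ℝ) * k ≤ k * (Y + 1) + L := by exact_mod_cast e
        have : (X : ℝ) ≤ (k * (Y + 1) + L) / k := by rwa [le_div_iff₀ hkpos]
        rw [add_div, mul_div_cancel_left₀ _ hkpos.ne'] at this
        linarith
      have h4 : 1 / (k : ℝ) * X ≤ L / k := by rw [one_div_mul_eq_div]; gcongr
      have h5 : 1 / (k : ℝ) ^ 2 * L ≤ L / k := by
        rw [one_div_mul_eq_div]; gcongr; nlinarith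
      have h6 := norm_sub_norm_le (thSum X (m * α)) (thSum Y (m * α))
      have h7 : ‖thSum X (m * α)‖ ≤ 4 * L / k := by
        rw [mul_div_assoc]; linarith
      have h8 := mul_le_mul_of_nonneg_left h7 (th_nonneg m)
      have h9 := Finset.sum_nonneg hnn
      linarith
  have hthM : ∑ m ∈ Finset.Ioc M (2 * M), th m ≤ 12 * M := by
    calc _ ≤ ∑ m ∈ Finset.Ioc 0 (2 * M), th m := Finset.sum_le_sum_of_subset_of_nonneg
          (Finset.Ioc_subset_Ioc_left (Nat.zero_le _)) fun _ _ _ ↦ th_nonneg _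
      _ ≤ 6 * (2 * M : ℕ) := sum_th_le _
      _ = _ := by push_cast; ring
  calc _ ≤ ∑ m ∈ Finset.Ioc M (2 * M), (th m * (4 * L / k) + ∑ i ∈ Finset.range (k + 1),
        if 1 / (k : ℝ) ^ 2 * L ≤ ‖thSum (i * L / k) (m * α)‖ then th m * (6 * L) else 0) :=
        Finset.sum_le_sum hpt
    _ = (∑ m ∈ Finset.Ioc M (2 * M), th m) * (4 * L / k) + ∑ i ∈ Finset.range (k + 1),
        (∑ m ∈ (Finset.Ioc M (2 * M)).filter
          (fun m : ℕ ↦ 1 / (k : ℝ) ^ 2 * L ≤ ‖thSum (i * L / k) (m * α)‖), th m) * (6 * L) := by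
        rw [Finset.sum_add_distrib, Finset.sum_mul, Finset.sum_comm]
        congr 1
        refine Finset.sum_congr rfl fun i _ ↦ ?_
        rw [Finset.sum_mul, Finset.sum_filter]
    _ ≤ 12 * M * (4 * L / k) + ∑ i ∈ Finset.range (k + 1), (1 / (k : ℝ) ^ 2 * M) * (6 * L) := by
        gcongr with i hi
        exact hbad _ (hgrid i hi)
    _ = (L * M) * (48 / k + 6 * (k + 1) / k ^ 2) := by
        rw [Finset.sum_const, Finset.card_range, nsmul_eq_mul]; push_cast; field_simp; ring
    _ ≤ N * (60 / k) := by
        have : 48 / (k : ℝ) + 6 * (k + 1) / k ^ 2 ≤ 60 / k := by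
          rw [div_add_div _ _ hkpos.ne' (by positivity), div_le_div_iff₀ (by positivity) hkpos]
          nlinarith [pow_pos hkpos 3, pow_pos hkpos 2]
        gcongr
    _ ≤ N * η := by
        have : 60 / (k : ℝ) ≤ η := by rw [div_le_iff₀ hkpos]; rw [div_le_iff₀ hη] at hk; linarith
        gcongr
    _ = _ := mul_comm _ _

lemma th_mul_norm_thSum_le (N : ℕ) {m : ℕ} (x : ℝ) :
    th m * ‖thSum (N / m) x‖ ≤ 6 * N * (vonMangoldt m / m) := by
  calc _ ≤ vonMangoldt m * (6 * ((N / m : ℕ) : ℝ)) := by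
        gcongr
        · exact th_le_vonMangoldt m
        · exact norm_thSum_le _ _
    _ ≤ vonMangoldt m * (6 * ((N : ℝ) / m)) := by
        have := ArithmeticFunction.vonMangoldt_nonneg (n := m)
        gcongr
        exact Nat.cast_div_le
    _ = _ := by ring

/-- The type II estimate. -/
lemma exists_typeII_le {η : ℝ} (hη : 0 < η) : ∃ Q : ℕ, ∀ Q' ≥ Q, ∃ N0 : ℕ, ∀ N ≥ N0,
    ∀ α : ℝ, Minor Q' N α →
    ∑ m ∈ Finset.Ioc 0 (Nat.sqrt N), th m * ‖thSum (N / m) (m * α)‖ ≤ η * N * Real.log N := by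
  obtain ⟨Q, hQ⟩ := exists_block_le (η := η / 4) (by positivity)
  refine ⟨Q, fun Q' hQ' ↦ ?_⟩
  obtain ⟨M0, hM0⟩ := hQ Q' hQ'
  set A := max 1 M0 with hA
  have hA1 : 1 ≤ A := le_max_left _ _
  have hlim : Tendsto (fun N : ℕ ↦ η / 2 * Real.log N) atTop atTop :=
    (Real.tendsto_log_atTop.comp tendsto_natCast_atTop_atTop).const_mul_atTop (by positivity)
  obtain ⟨N1, hN1⟩ := eventually_atTop.1 (hlim.eventually_ge_atTop (6 * (Real.log A + 6) + 72))
  refine ⟨max (A * A) N1, fun N hN α hα ↦ ?_⟩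
  have hAN : A * A ≤ N := le_trans (le_max_left _ _) hN
  have hlogN := hN1 N (le_trans (le_max_right _ _) hN)
  set U := Nat.sqrt N with hU
  have hAU : A ≤ U := Nat.le_sqrt.2 hAN
  have hUU : U * U ≤ N := Nat.sqrt_le N
  have hU0 : (0 : ℝ) < U := by exact_mod_cast (by omega : 0 < U)
  have hN0 : 0 < N := by nlinarith
  set G : ℕ → ℝ := fun m ↦ th m * ‖thSum (N / m) (m * α)‖ with hG
  have hG1 : ∀ m, G m ≤ 6 * N * (vonMangoldt m / m) := fun m ↦ th_mul_norm_thSum_le N _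
  have hstart : ∑ m ∈ Finset.Ioc 0 A, G m ≤ 6 * N * (Real.log A + 6) := by
    refine (Finset.sum_le_sum fun m _ ↦ hG1 m).trans ?_
    rw [← Finset.mul_sum]
    gcongr
    exact sum_vonMangoldt_div_le A hA1
  have hblocks : ∀ j : ℕ, 2 ^ j * A ≤ U →
      ∑ m ∈ Finset.Ioc 0 (2 ^ j * A), G m ≤ 6 * N * (Real.log A + 6) + j * (η / 4 * N) := by
    intro j
    induction j with
    | zero => intro _; simpa using hstart
    | succ j ih =>
      intro hj
      have e : 2 ^ (j + 1) * A = 2 * (2 ^ j * A) := by ring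
      rw [e] at hj ⊢
      have h1 := ih (by omega)
      have h2 := hM0 (2 ^ j * A) (le_trans (le_max_right 1 M0) (Nat.le_mul_of_pos_left _ (by positivity)))
        N (le_trans (by nlinarith [Nat.mul_le_mul hj hj]) hUU) α hα
      rw [← Finset.sum_Ioc_consecutive G (Nat.zero_le (2 ^ j * A)) (by omega)]
      push_cast
      linarith
  set J := Nat.log 2 (U / A) with hJ
  have hUA : U / A ≠ 0 := (Nat.div_pos hAU hA1).ne'
  have hJ1 : 2 ^ J * A ≤ U := (Nat.le_div_iff_mul_le hA1).1 (Nat.pow_log_le_self 2 hUA)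
  have hJ2 : U < 2 ^ (J + 1) * A := (Nat.div_lt_iff_lt_mul hA1).1 (Nat.lt_pow_succ_log_self (by norm_num) _)
  have hJlog : (J : ℝ) ≤ 2 * Real.log N := by
    have h1 : 2 ^ J ≤ N := by nlinarith [Nat.le_mul_of_pos_right (2 ^ J) hA1]
    have h2 : Real.log ((2 : ℝ) ^ J) ≤ Real.log N := Real.log_le_log (by positivity) (by exact_mod_cast h1)
    rw [Real.log_pow] at h2
    have h3 := Real.log_two_gt_d9
    have h4 : (0 : ℝ) ≤ J := Nat.cast_nonneg J
    nlinarith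
  have hrest : ∑ m ∈ Finset.Ioc (2 ^ J * A) U, G m ≤ 72 * N := by
    calc _ ≤ ∑ m ∈ Finset.Ioc (2 ^ J * A) U, 12 * N / U * vonMangoldt m := by
          refine Finset.sum_le_sum fun m hm ↦ (hG1 m).trans ?_
          rw [Finset.mem_Ioc] at hm
          have h1 : (U : ℝ) ≤ 2 * m := by
            have : U ≤ 2 * m := by rw [pow_succ] at hJ2; nlinarith [hm.1]
            exact_mod_cast this
          have h2 : (0 : ℝ) < m := by linarith
          have h3 := ArithmeticFunction.vonMangoldt_nonneg (n := m)
          rw [div_mul_eq_mul_div, ← mul_div_assoc, div_le_div_iff₀ h2 hU0]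
          calc 6 * N * vonMangoldt m * U ≤ 6 * N * vonMangoldt m * (2 * m) := by gcongr
            _ = _ := by ring
      _ ≤ ∑ m ∈ Finset.Ioc 0 U, 12 * N / U * vonMangoldt m :=
          Finset.sum_le_sum_of_subset_of_nonneg (Finset.Ioc_subset_Ioc_left (Nat.zero_le _)) fun m _ _ ↦ by
            have h3 := ArithmeticFunction.vonMangoldt_nonneg (n := m)
            positivity
      _ ≤ 12 * N / U * (6 * U) := by
          rw [← Finset.mul_sum]
          gcongr
          exact sum_vonMangoldt_le' U
      _ = _ := by field_simp; ring
  have h1 := hblocks J hJ1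
  rw [← Finset.sum_Ioc_consecutive G (Nat.zero_le (2 ^ J * A)) hJ1]
  have hN' : (0 : ℝ) < N := by exact_mod_cast hN0
  have h2 : (J : ℝ) * (η / 4 * N) ≤ 2 * Real.log N * (η / 4 * N) := by gcongr
  have h3 := mul_le_mul_of_nonneg_right hlogN hN'.le
  linarith

/-- The exponential sum with von Mangoldt weights. -/
noncomputable def lamSum (X : ℕ) (x : ℝ) : ℂ :=
  ∑ k ∈ Finset.Ioc 0 X, (vonMangoldt k : ℂ) * ee (k * x)

lemma log_mul_lamSum {N : ℕ} (hN : 1 ≤ N) (α : ℝ) :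
    ∑ d ∈ Finset.Ioc 0 N, (((moebius d : ℝ) * Real.log ((N : ℝ) / d) ^ 2 : ℝ) : ℂ) *
        ∑ k ∈ Finset.Ioc 0 (N / d), ee (k * (d * α)) =
      ((Real.log N ^ 2 : ℝ) : ℂ) * ee α + (Real.log N : ℂ) * lamSum N α +
      ∑ n ∈ Finset.Ioc 0 N, ((vonMangoldt n * (Real.log N - Real.log n) : ℝ) : ℂ) * ee (n * α) +
      ∑ d ∈ Finset.Ioc 0 N, ∑ k ∈ Finset.Ioc 0 (N / d),
        ((vonMangoldt d * vonMangoldt k : ℝ) : ℂ) * ee (k * (d * α)) := by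
  have e : ∀ (f : ℕ → ℕ → ℝ) (n : ℕ),
      ((∑ x ∈ n.divisorsAntidiagonal, f x.1 x.2 : ℝ) : ℂ) * ee (n * α) =
        ∑ x ∈ n.divisorsAntidiagonal, (f x.1 x.2 : ℂ) * ee (x.2 * (x.1 * α)) := by
    intro f n
    push_cast
    rw [Finset.sum_mul]
    refine Finset.sum_congr rfl fun x hx ↦ ?_
    rw [← (Nat.mem_divisorsAntidiagonal.1 hx).1]
    congr 2
    push_cast; ring
  have h1 : ∑ d ∈ Finset.Ioc 0 N, (((moebius d : ℝ) * Real.log ((N : ℝ) / d) ^ 2 : ℝ) : ℂ) *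
        ∑ k ∈ Finset.Ioc 0 (N / d), ee (k * (d * α)) =
      ∑ n ∈ Finset.Ioc 0 N,
        ((∑ d ∈ n.divisors, (moebius d : ℝ) * (Real.log N - Real.log d) ^ 2 : ℝ) : ℂ) * ee (n * α) := by
    have : ∀ n : ℕ, ∑ d ∈ n.divisors, (moebius d : ℝ) * (Real.log N - Real.log d) ^ 2 =
        ∑ x ∈ n.divisorsAntidiagonal, (moebius x.1 : ℝ) * (Real.log N - Real.log x.1) ^ 2 := fun n ↦
      (Nat.sum_divisorsAntidiagonal (fun d _ : ℕ ↦ (moebius d : ℝ) * (Real.log N - Real.log d) ^ 2)).symm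
    simp only [this]
    simp only [e (fun d _ ↦ (moebius d : ℝ) * (Real.log N - Real.log d) ^ 2)]
    rw [sum_Ioc_divisorsAntidiagonal N fun d k : ℕ ↦
      (((moebius d : ℝ) * (Real.log N - Real.log d) ^ 2 : ℝ) : ℂ) * ee (k * (d * α))]
    refine Finset.sum_congr rfl fun d hd ↦ ?_
    rw [Finset.mem_Ioc] at hd
    rw [Real.log_div (by exact_mod_cast (by omega : N ≠ 0)) (by exact_mod_cast hd.1.ne'), Finset.mul_sum]
  rw [h1]
  have h2 : ∀ n : ℕ, ((∑ d ∈ n.divisors, (moebius d : ℝ) * (Real.log N - Real.log d) ^ 2 : ℝ) : ℂ) *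
      ee (n * α) = (if n = 1 then ((Real.log N ^ 2 : ℝ) : ℂ) * ee α else 0) +
        (Real.log N : ℂ) * ((vonMangoldt n : ℂ) * ee (n * α)) +
        ((vonMangoldt n * (Real.log N - Real.log n) : ℝ) : ℂ) * ee (n * α) +
        ∑ x ∈ n.divisorsAntidiagonal,
          ((vonMangoldt x.1 * vonMangoldt x.2 : ℝ) : ℂ) * ee (x.2 * (x.1 * α)) := by
    intro n
    rw [selberg_identity, ← e fun d k ↦ vonMangoldt d * vonMangoldt k, ArithmeticFunction.mul_apply]
    by_cases hn : n = 1
    · subst hn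
      simp only [if_true, Nat.cast_one, one_mul]
      push_cast
      ring
    · simp only [hn, if_false]
      push_cast
      ring
  simp only [h2]
  rw [Finset.sum_add_distrib, Finset.sum_add_distrib, Finset.sum_add_distrib, ← Finset.mul_sum,
    sum_Ioc_divisorsAntidiagonal N fun d k : ℕ ↦
      ((vonMangoldt d * vonMangoldt k : ℝ) : ℂ) * ee (k * (d * α)),
    Finset.sum_ite_eq', if_pos (by rw [Finset.mem_Ioc]; omega)]
  rfl

lemma sum_vonMangoldt_mul_log_le (N : ℕ) :
    ∑ n ∈ Finset.Ioc 0 N, vonMangoldt n * (Real.log N - Real.log n) ≤ 6 * N := by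
  induction N with
  | zero => simp
  | succ N ih =>
    rw [Finset.sum_Ioc_succ_top (Nat.zero_le N), sub_self, mul_zero, add_zero]
    rcases Nat.eq_zero_or_pos N with rfl | hN
    · simp
    have hN' : (0 : ℝ) < N := by exact_mod_cast hN
    have h1 : Real.log (N + 1 : ℕ) - Real.log N ≤ 1 / N := by
      rw [← Real.log_div (by positivity) hN'.ne']
      refine (Real.log_le_sub_one_of_pos (by positivity)).trans (le_of_eq ?_)
      push_cast; field_simp; ring
    have h2 : ∑ n ∈ Finset.Ioc 0 N, vonMangoldt n * (Real.log (N + 1 : ℕ) - Real.log n) =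
        ∑ n ∈ Finset.Ioc 0 N, vonMangoldt n * (Real.log N - Real.log n) +
        (∑ n ∈ Finset.Ioc 0 N, vonMangoldt n) * (Real.log (N + 1 : ℕ) - Real.log N) := by
      rw [Finset.sum_mul, ← Finset.sum_add_distrib]
      exact Finset.sum_congr rfl fun n _ ↦ by ring
    rw [h2]
    have h3 : 0 ≤ ∑ n ∈ Finset.Ioc 0 N, vonMangoldt n :=
      Finset.sum_nonneg fun n _ ↦ ArithmeticFunction.vonMangoldt_nonneg
    have h4 : (∑ n ∈ Finset.Ioc 0 N, vonMangoldt n) * (Real.log (N + 1 : ℕ) - Real.log N) ≤ 6 := by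
      calc _ ≤ (∑ n ∈ Finset.Ioc 0 N, vonMangoldt n) * (1 / N) := by gcongr
        _ ≤ 6 * N * (1 / N) := by gcongr; exact sum_vonMangoldt_le' N
        _ = 6 := by field_simp
    push_cast
    push_cast at h4
    linarith

lemma exists_sum_vonMangoldt_sub_th_div_le :
    ∃ C > 0, ∀ N : ℕ, ∑ m ∈ Finset.Ioc 0 N, (vonMangoldt m - th m) / m ≤ C := by
  obtain ⟨C, hC, h⟩ := sum_vonMangoldt_sub_th
  refine ⟨3 * C, by positivity, ?_⟩
  set D : ℕ → ℝ := fun n ↦ ∑ k ∈ Finset.Ioc 0 n, (vonMangoldt k - th k) with hD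
  have hD1 : ∀ n, D n ≤ C * Real.sqrt n := by
    intro n
    have := h n
    rwa [← zero_add 1, Finset.Icc_add_one_left_eq_Ioc] at this
  have key : ∀ N : ℕ, ∑ m ∈ Finset.Ioc 0 (N + 1), (vonMangoldt m - th m) / m ≤
      D (N + 1) / (N + 1 : ℕ) + 2 * C * (1 - 1 / Real.sqrt (N + 1 : ℕ)) := by
    intro N
    induction N with
    | zero => simp [hD]
    | succ N ih =>
      rw [Finset.sum_Ioc_succ_top (Nat.zero_le _)]
      set M := N + 1 with hM
      have hM0 : (0 : ℝ) < M := by rw [hM]; positivity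
      have hDM : D (M + 1) = D M + (vonMangoldt (M + 1) - th (M + 1)) :=
        Finset.sum_Ioc_succ_top (Nat.zero_le _) _
      have e1 : D (M + 1) / (M + 1 : ℕ) =
          D M / (M + 1 : ℕ) + (vonMangoldt (M + 1) - th (M + 1)) / (M + 1 : ℕ) := by
        rw [hDM, add_div]
      set u := Real.sqrt M with hu
      set v := Real.sqrt (M + 1 : ℕ) with hv
      have hu0 : 0 < u := Real.sqrt_pos.2 hM0
      have huv : u ≤ v := Real.sqrt_le_sqrt (by push_cast; linarith)
      have hu2 : u ^ 2 = M := Real.sq_sqrt hM0.le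
      have hv2 : v ^ 2 = (M + 1 : ℕ) := Real.sq_sqrt (by positivity)
      have hv0 : 0 < v := hu0.trans_le huv
      have hvu : v ^ 2 - u ^ 2 = 1 := by rw [hu2, hv2]; push_cast; ring
      have h1 : D M / M - D M / (M + 1 : ℕ) ≤ 2 * C * (1 / u - 1 / v) := by
        have h2 := hD1 M
        rw [← hu] at h2
        rw [← hu2, ← hv2]
        have e2 : D M / u ^ 2 - D M / v ^ 2 = D M / (u ^ 2 * v ^ 2) := by
          field_simp
          rw [hvu, mul_one]
        have e3 : 1 / u - 1 / v = 1 / (u * v * (v + u)) := by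
          have : (v - u) * (v + u) = 1 := by linarith [sq_sub_sq v u, mul_comm (v - u) (v + u)]
          field_simp
          linarith
        rw [e2, e3, mul_one_div, div_le_div_iff₀ (by positivity) (by positivity)]
        calc D M * (u * v * (v + u)) ≤ C * u * (u * v * (v + v)) := by gcongr
          _ = _ := by ring
      rw [e1]
      linarith
  intro N
  rcases N with - | N
  · simp; positivity
  refine (key N).trans ?_
  have h0 : (0 : ℝ) < (N + 1 : ℕ) := by positivity
  have h1 : 0 < Real.sqrt (N + 1 : ℕ) := Real.sqrt_pos.2 h0
  have h2 : D (N + 1) / (N + 1 : ℕ) ≤ C * (1 / Real.sqrt (N + 1 : ℕ)) := by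
    calc _ ≤ C * Real.sqrt (N + 1 : ℕ) / (N + 1 : ℕ) := by gcongr; exact hD1 _
      _ = _ := by
        rw [div_eq_iff h0.ne']
        nth_rw 3 [← Real.sq_sqrt h0.le]
        field_simp
  have h3 : 1 / Real.sqrt (N + 1 : ℕ) ≤ 1 := by
    rw [div_le_one h1]; exact Real.one_le_sqrt.2 (by push_cast; linarith [(Nat.cast_nonneg N : (0 : ℝ) ≤ N)])
  have h4 : 0 < 1 / Real.sqrt (N + 1 : ℕ) := by positivity
  nlinarith

lemma sum_hyperbola_comm {R : Type*} [AddCommMonoid R] (N U : ℕ) (hU : N < (U + 1) * (U + 1))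
    (f : ℕ → ℕ → R) :
    ∑ m ∈ Finset.Ioc U N, ∑ k ∈ Finset.Ioc 0 (N / m), f m k =
      ∑ k ∈ Finset.Ioc 0 U, ∑ m ∈ Finset.Ioc U (N / k), f m k := by
  refine Finset.sum_comm' fun m k ↦ ?_
  simp only [Finset.mem_Ioc]
  constructor
  · rintro ⟨⟨h1, h2⟩, h3, h4⟩
    rw [Nat.le_div_iff_mul_le (by omega)] at h4
    refine ⟨⟨h1, ?_⟩, h3, ?_⟩
    · rw [Nat.le_div_iff_mul_le h3]; linarith
    · by_contra h
      have := Nat.mul_le_mul (Nat.succ_le_of_lt h1) (Nat.succ_le_of_lt (not_le.1 h))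
      rw [Nat.succ_eq_add_one] at this
      nlinarith
  · rintro ⟨⟨h1, h2⟩, h3, h4⟩
    rw [Nat.le_div_iff_mul_le h3] at h2
    refine ⟨⟨h1, by nlinarith⟩, h3, ?_⟩
    rw [Nat.le_div_iff_mul_le (by omega)]
    linarith

lemma norm_sum_th_mul_th_le (N : ℕ) (α : ℝ) :
    ‖∑ d ∈ Finset.Ioc 0 N, ∑ k ∈ Finset.Ioc 0 (N / d), ((th d * th k : ℝ) : ℂ) * ee (k * (d * α))‖ ≤
      2 * ∑ m ∈ Finset.Ioc 0 (Nat.sqrt N), th m * ‖thSum (N / m) (m * α)‖ + 36 * N := by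
  set U := Nat.sqrt N with hU
  have hUU : U * U ≤ N := Nat.sqrt_le N
  have hUN : U ≤ N := Nat.sqrt_le_self N
  have e1 : ∀ d X : ℕ, ∑ k ∈ Finset.Ioc 0 X, ((th d * th k : ℝ) : ℂ) * ee (k * (d * α)) =
      (th d : ℂ) * thSum X (d * α) := by
    intro d X
    rw [thSum, Finset.mul_sum]
    exact Finset.sum_congr rfl fun k _ ↦ by push_cast; ring
  have hn : ∀ d : ℕ, ‖(th d : ℂ)‖ = th d := fun d ↦ by
    rw [Complex.norm_real, Real.norm_eq_abs, abs_of_nonneg (th_nonneg d)]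
  rw [← Finset.sum_Ioc_consecutive _ (Nat.zero_le U) hUN,
    sum_hyperbola_comm N U (Nat.lt_succ_sqrt N)]
  have h1 : ‖∑ d ∈ Finset.Ioc 0 U, ∑ k ∈ Finset.Ioc 0 (N / d), ((th d * th k : ℝ) : ℂ) * ee (k * (d * α))‖
      ≤ ∑ m ∈ Finset.Ioc 0 U, th m * ‖thSum (N / m) (m * α)‖ := by
    refine (norm_sum_le _ _).trans (Finset.sum_le_sum fun d _ ↦ ?_)
    rw [e1, norm_mul, hn]
  have h2 : ‖∑ k ∈ Finset.Ioc 0 U, ∑ m ∈ Finset.Ioc U (N / k), ((th m * th k : ℝ) : ℂ) * ee (k * (m * α))‖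
      ≤ ∑ m ∈ Finset.Ioc 0 U, (th m * ‖thSum (N / m) (m * α)‖ + th m * (6 * U)) := by
    refine (norm_sum_le _ _).trans (Finset.sum_le_sum fun k hk ↦ ?_)
    rw [Finset.mem_Ioc] at hk
    have hle : U ≤ N / k := (Nat.le_div_iff_mul_le hk.1).2 (by nlinarith)
    have e2 : ∑ m ∈ Finset.Ioc U (N / k), ((th m * th k : ℝ) : ℂ) * ee (k * (m * α)) =
        (th k : ℂ) * (thSum (N / k) (k * α) - thSum U (k * α)) := by
      rw [thSum, thSum, ← Finset.sum_Ioc_consecutive _ (Nat.zero_le U) hle, add_sub_cancel_left,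
        Finset.mul_sum]
      refine Finset.sum_congr rfl fun m _ ↦ ?_
      rw [show (k : ℝ) * (m * α) = m * (k * α) by ring]
      push_cast; ring
    rw [e2, norm_mul, hn, ← mul_add]
    have := th_nonneg k
    gcongr
    exact (norm_sub_le _ _).trans (by gcongr; exact norm_thSum_le _ _)
  have h3 : ∑ m ∈ Finset.Ioc 0 U, th m * (6 * (U : ℝ)) ≤ 36 * N := by
    rw [← Finset.sum_mul]
    calc _ ≤ 6 * (U : ℝ) * (6 * U) := by gcongr; exact sum_th_le U
      _ = 36 * ((U * U : ℕ) : ℝ) := by push_cast; ring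
      _ ≤ _ := by gcongr
  rw [Finset.sum_add_distrib] at h2
  exact (norm_add_le _ _).trans (by linarith)

lemma exists_norm_sum_vonMangoldt_mul_le : ∃ C > 0, ∀ (N : ℕ) (α : ℝ),
    ‖∑ d ∈ Finset.Ioc 0 N, ∑ k ∈ Finset.Ioc 0 (N / d),
        ((vonMangoldt d * vonMangoldt k : ℝ) : ℂ) * ee (k * (d * α))‖ ≤
      2 * ∑ m ∈ Finset.Ioc 0 (Nat.sqrt N), th m * ‖thSum (N / m) (m * α)‖ + C * N := by
  obtain ⟨C, hC, h⟩ := exists_sum_vonMangoldt_sub_th_div_le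
  refine ⟨12 * C + 36, by positivity, fun N α ↦ ?_⟩
  have hΛ : ∀ n, 0 ≤ vonMangoldt n := fun n ↦ ArithmeticFunction.vonMangoldt_nonneg
  have hsub : ∀ n, 0 ≤ vonMangoldt n - th n := fun n ↦ sub_nonneg.2 (th_le_vonMangoldt n)
  have hsum : ∑ d ∈ Finset.Ioc 0 N, ∑ k ∈ Finset.Ioc 0 (N / d),
      (vonMangoldt d - th d) * vonMangoldt k ≤ 6 * C * N := by
    calc _ ≤ ∑ d ∈ Finset.Ioc 0 N, 6 * N * ((vonMangoldt d - th d) / d) := by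
          refine Finset.sum_le_sum fun d _ ↦ ?_
          rw [← Finset.mul_sum]
          calc _ ≤ (vonMangoldt d - th d) * (6 * ((N : ℝ) / d)) := by
                have := hsub d
                gcongr
                exact (sum_vonMangoldt_le' _).trans (by gcongr; exact Nat.cast_div_le)
            _ = _ := by ring
      _ ≤ 6 * N * C := by rw [← Finset.mul_sum]; gcongr; exact h N
      _ = _ := by ring
  have hsum' : ∑ d ∈ Finset.Ioc 0 N, ∑ k ∈ Finset.Ioc 0 (N / d),
      vonMangoldt d * (vonMangoldt k - th k) ≤ 6 * C * N := by
    refine le_trans (le_of_eq ?_) hsum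
    refine (Finset.sum_comm' fun d k ↦ ?_).trans
      (Finset.sum_congr rfl fun d _ ↦ Finset.sum_congr rfl fun k _ ↦ mul_comm _ _)
    simp only [Finset.mem_Ioc]
    constructor <;> rintro ⟨⟨h1, h2⟩, h3, h4⟩ <;>
    · first | rw [Nat.le_div_iff_mul_le h1] at h4 | rw [Nat.le_div_iff_mul_le h3] at h2
      refine ⟨⟨?_, ?_⟩, ?_, ?_⟩ <;>
        first | assumption | (rw [Nat.le_div_iff_mul_le (by assumption)]; linarith) | nlinarith
  have h1 : ‖∑ d ∈ Finset.Ioc 0 N, ∑ k ∈ Finset.Ioc 0 (N / d),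
        ((vonMangoldt d * vonMangoldt k : ℝ) : ℂ) * ee (k * (d * α)) -
      ∑ d ∈ Finset.Ioc 0 N, ∑ k ∈ Finset.Ioc 0 (N / d), ((th d * th k : ℝ) : ℂ) * ee (k * (d * α))‖
      ≤ 6 * C * N + 6 * C * N := by
    refine le_trans ?_ (add_le_add hsum hsum')
    simp only [← Finset.sum_sub_distrib, ← Finset.sum_add_distrib]
    refine (norm_sum_le _ _).trans (Finset.sum_le_sum fun d _ ↦ ?_)
    refine (norm_sum_le _ _).trans (Finset.sum_le_sum fun k _ ↦ ?_)
    rw [← sub_mul, norm_mul, norm_ee, mul_one, ← Complex.ofReal_sub, Complex.norm_real, Real.norm_eq_abs]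
    have a1 := th_nonneg d
    have a2 := th_nonneg k
    have a3 := hsub d
    have a4 := hsub k
    rw [abs_of_nonneg (by nlinarith)]
    nlinarith [mul_nonneg a3 a4]
  have h2 := norm_sum_th_mul_th_le N α
  have h3 := norm_le_norm_add_norm_sub' (∑ d ∈ Finset.Ioc 0 N, ∑ k ∈ Finset.Ioc 0 (N / d),
        ((vonMangoldt d * vonMangoldt k : ℝ) : ℂ) * ee (k * (d * α)))
      (∑ d ∈ Finset.Ioc 0 N, ∑ k ∈ Finset.Ioc 0 (N / d), ((th d * th k : ℝ) : ℂ) * ee (k * (d * α)))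
  linarith

/-- Vinogradov's estimate: exponential sums over primes are small on the minor arcs. -/
lemma exists_minor_le {η : ℝ} (hη : 0 < η) : ∃ Q : ℕ, ∀ Q' ≥ Q, ∃ N0 : ℕ, ∀ N ≥ N0,
    ∀ α : ℝ, Minor Q' N α → ‖thSum N α‖ ≤ η * N := by
  obtain ⟨QI, hI⟩ := exists_typeI_le (η := η / 8) (by positivity)
  obtain ⟨QII, hII⟩ := exists_typeII_le (η := η / 8) (by positivity)
  obtain ⟨C, hC, hB⟩ := exists_norm_sum_vonMangoldt_mul_le
  obtain ⟨C1, hC1, hth⟩ := sum_vonMangoldt_sub_th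
  refine ⟨max QI QII, fun Q hQ ↦ ?_⟩
  obtain ⟨NI, hNI⟩ := hI Q (le_trans (le_max_left _ _) hQ)
  obtain ⟨NII, hNII⟩ := hII Q (le_trans (le_max_right _ _) hQ)
  have hlim : Tendsto (fun N : ℕ ↦ η / 8 * Real.log N) atTop atTop :=
    (Real.tendsto_log_atTop.comp tendsto_natCast_atTop_atTop).const_mul_atTop (by positivity)
  have hlim2 : Tendsto (fun N : ℕ ↦ η / 2 * Real.sqrt N) atTop atTop :=
    (Real.tendsto_sqrt_atTop.comp tendsto_natCast_atTop_atTop).const_mul_atTop (by positivity)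
  obtain ⟨N1, hN1⟩ := eventually_atTop.1 (hlim.eventually_ge_atTop (4 + 6 + C))
  obtain ⟨N2, hN2⟩ := eventually_atTop.1 (hlim2.eventually_ge_atTop C1)
  refine ⟨max (max NI NII) (max (max N1 N2) 2), fun N hN α hα ↦ ?_⟩
  simp only [ge_iff_le, max_le_iff] at hN
  obtain ⟨⟨hNI', hNII'⟩, ⟨hN1', hN2'⟩, hN2le⟩ := hN
  have hN0 : (0 : ℝ) < N := by exact_mod_cast (by omega : 0 < N)
  have hlog : 0 < Real.log N := Real.log_pos (by exact_mod_cast hN2le)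
  have b1 := hNI N hNI' α hα
  have b2 := hNII N hNII' α hα
  have b3 := hB N α
  have b4 := hN1 N hN1'
  have b5 := hN2 N hN2'
  have b6 := sum_vonMangoldt_mul_log_le N
  have id := log_mul_lamSum (by omega : 1 ≤ N) α
  set T := ∑ d ∈ Finset.Ioc 0 N, (((moebius d : ℝ) * Real.log ((N : ℝ) / d) ^ 2 : ℝ) : ℂ) *
        ∑ k ∈ Finset.Ioc 0 (N / d), ee (k * (d * α))
  set B := ∑ d ∈ Finset.Ioc 0 N, ∑ k ∈ Finset.Ioc 0 (N / d),
        ((vonMangoldt d * vonMangoldt k : ℝ) : ℂ) * ee (k * (d * α))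
  set E := ∑ n ∈ Finset.Ioc 0 N, ((vonMangoldt n * (Real.log N - Real.log n) : ℝ) : ℂ) * ee (n * α)
    with hE
  have b7 : ‖E‖ ≤ 6 * N := by
    refine (norm_sum_le _ _).trans (le_trans (Finset.sum_le_sum fun n hn ↦ ?_) b6)
    rw [Finset.mem_Ioc] at hn
    have : Real.log n ≤ Real.log N :=
      Real.log_le_log (by exact_mod_cast hn.1) (by exact_mod_cast hn.2)
    rw [norm_mul, norm_ee, mul_one, Complex.norm_real, Real.norm_eq_abs, abs_of_nonneg]
    exact mul_nonneg ArithmeticFunction.vonMangoldt_nonneg (by linarith)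
  have b8 : ‖((Real.log N ^ 2 : ℝ) : ℂ) * ee α‖ ≤ 4 * N := by
    rw [norm_mul, norm_ee, mul_one, Complex.norm_real, Real.norm_eq_abs, abs_of_nonneg (by positivity)]
    have h1 : Real.log N ≤ 2 * Real.sqrt N := by
      have h2 := Real.log_le_self (Real.sqrt_nonneg (N : ℝ))
      rw [Real.log_sqrt hN0.le] at h2
      linarith
    calc Real.log N ^ 2 ≤ (2 * Real.sqrt N) ^ 2 := by gcongr
      _ = _ := by rw [mul_pow, Real.sq_sqrt hN0.le]; norm_num
  have b9 : ‖(Real.log N : ℂ) * lamSum N α‖ ≤ ‖T‖ + 4 * N + 6 * N + ‖B‖ := by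
    have : (Real.log N : ℂ) * lamSum N α = T - ((Real.log N ^ 2 : ℝ) : ℂ) * ee α - E - B := by
      rw [id]; ring
    rw [this]
    calc _ ≤ ‖T - ((Real.log N ^ 2 : ℝ) : ℂ) * ee α - E‖ + ‖B‖ := norm_sub_le _ _
      _ ≤ ‖T - ((Real.log N ^ 2 : ℝ) : ℂ) * ee α‖ + ‖E‖ + ‖B‖ := by gcongr; exact norm_sub_le _ _
      _ ≤ ‖T‖ + ‖((Real.log N ^ 2 : ℝ) : ℂ) * ee α‖ + ‖E‖ + ‖B‖ := by gcongr; exact norm_sub_le _ _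
      _ ≤ _ := by gcongr
  have b10 : ‖lamSum N α‖ ≤ η / 2 * N := by
    rw [norm_mul, Complex.norm_real, Real.norm_eq_abs, abs_of_pos hlog] at b9
    have h1 : (4 + 6 + C) * N ≤ η / 8 * Real.log N * N := by gcongr
    refine le_of_mul_le_mul_left ?_ hlog
    linarith
  have b11 : ‖lamSum N α - thSum N α‖ ≤ η / 2 * N := by
    have h1 := hth N
    have h2 : ‖lamSum N α - thSum N α‖ ≤ ∑ k ∈ Finset.Icc 1 N, (vonMangoldt k - th k) := by
      rw [lamSum, thSum, ← Finset.sum_sub_distrib, ← zero_add 1, Finset.Icc_add_one_left_eq_Ioc]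
      refine (norm_sum_le _ _).trans (Finset.sum_le_sum fun k _ ↦ ?_)
      rw [← sub_mul, norm_mul, norm_ee, mul_one, ← Complex.ofReal_sub, Complex.norm_real,
        Real.norm_eq_abs, abs_of_nonneg (sub_nonneg.2 (th_le_vonMangoldt k))]
    refine h2.trans (h1.trans ?_)
    calc C1 * Real.sqrt N ≤ η / 2 * Real.sqrt N * Real.sqrt N := by gcongr
      _ = _ := by rw [mul_assoc, Real.mul_self_sqrt hN0.le]
  have b12 := norm_le_norm_add_norm_sub (lamSum N α) (thSum N α)
  linarith

end Ternary

namespace Ternary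

/-- The normalised indicator function of the integers coprime to `D`. -/
noncomputable def wt (D n : ℕ) : ℝ := if n.Coprime D then (D : ℝ) / D.totient else 0

lemma wt_nonneg (D n : ℕ) : 0 ≤ wt D n := by
  rw [wt]; split_ifs <;> positivity

lemma wt_le {D : ℕ} (hD : 0 < D) (n : ℕ) : wt D n ≤ D := by
  have h : (1 : ℝ) ≤ D.totient := by exact_mod_cast Nat.totient_pos.2 hD
  rw [wt]
  split_ifs
  · exact div_le_self (Nat.cast_nonneg D) h
  · exact Nat.cast_nonneg D

lemma wt_mod (D n : ℕ) : wt D (n % D) = wt D n := by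
  simp only [wt, Nat.Coprime, ← Nat.gcd_rec, Nat.gcd_comm n D]

lemma wt_add_self (D n : ℕ) : wt D (n + D) = wt D n := by
  rw [← wt_mod, Nat.add_mod_right, wt_mod]

lemma wt_congr {D D' : ℕ} (hD : 0 < D) (hD' : 0 < D') (h : D.primeFactors = D'.primeFactors) (n : ℕ) :
    wt D n = wt D' n := by
  have h1 : n.Coprime D ↔ n.Coprime D' := by
    rcases Nat.eq_zero_or_pos n with rfl | hn
    · rw [Nat.coprime_zero_left, Nat.coprime_zero_left]
      have := Nat.primeFactors_eq_empty (n := D)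
      have := Nat.primeFactors_eq_empty (n := D')
      grind
    · rw [← Nat.disjoint_primeFactors hn.ne' hD.ne', ← Nat.disjoint_primeFactors hn.ne' hD'.ne', h]
  rw [wt, wt, ← prod_primeFactors_inv D hD, ← prod_primeFactors_inv D' hD', h]
  simp only [h1]

/-- The exponential sum with weights `wt D`. -/
noncomputable def wtSum (D X : ℕ) (x : ℝ) : ℂ := ∑ k ∈ Finset.Ioc 0 X, (wt D k : ℂ) * ee (k * x)

lemma norm_wtSum_mul_nd_le {D : ℕ} (hD : 0 < D) (N : ℕ) (α : ℝ) :
    ‖wtSum D N α‖ * nd (D * α) ≤ (D : ℝ) ^ 2 := by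
  set f : ℕ → ℂ := fun k ↦ (wt D k : ℂ) * ee (k * α) with hf
  have hfn : ∀ k, ‖f k‖ ≤ D := fun k ↦ by
    rw [hf]
    simp only
    rw [norm_mul, norm_ee, mul_one, Complex.norm_real, Real.norm_eq_abs, abs_of_nonneg (wt_nonneg D k)]
    exact wt_le hD k
  have h1 : ee (D * α) * wtSum D N α = ∑ k ∈ Finset.Ioc D (D + N), f k := by
    rw [wtSum, Finset.mul_sum]
    have := Finset.sum_image (s := Finset.Ioc 0 N) (g := fun k ↦ k + D) (f := f) (fun a _ b _ h ↦ by simpa using h)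
    rw [Finset.image_add_right_Ioc, zero_add, add_comm N D] at this
    rw [this]
    refine Finset.sum_congr rfl fun k _ ↦ ?_
    rw [hf]
    simp only
    rw [wt_add_self, show ((k + D : ℕ) : ℝ) * α = D * α + k * α by push_cast; ring, ee_add]
    ring
  have h2 := Finset.sum_Ioc_consecutive f (Nat.zero_le D) (Nat.le_add_right D N)
  have h3 := Finset.sum_Ioc_consecutive f (Nat.zero_le N) (Nat.le_add_left N D)
  have h4 : (ee (D * α) - 1) * wtSum D N α = ∑ k ∈ Finset.Ioc N (D + N), f k - ∑ k ∈ Finset.Ioc 0 D, f k := by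
    rw [sub_mul, h1, one_mul]
    have : wtSum D N α = ∑ k ∈ Finset.Ioc 0 N, f k := rfl
    rw [this]
    linear_combination h2 - h3
  have h5 : ‖(ee (D * α) - 1) * wtSum D N α‖ ≤ D * D + D * D := by
    rw [h4]
    refine (norm_sub_le _ _).trans (add_le_add ?_ ?_)
    · refine (norm_sum_le _ _).trans ((Finset.sum_le_card_nsmul _ _ _ fun k _ ↦ hfn k).trans ?_)
      rw [Nat.card_Ioc, Nat.add_sub_cancel, nsmul_eq_mul]
    · refine (norm_sum_le _ _).trans ((Finset.sum_le_card_nsmul _ _ _ fun k _ ↦ hfn k).trans ?_)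
      rw [Nat.card_Ioc, Nat.sub_zero, nsmul_eq_mul]
  rw [norm_mul] at h5
  have h6 := mul_le_mul_of_nonneg_right (four_nd_le (D * α)) (norm_nonneg (wtSum D N α))
  nlinarith

lemma norm_sum_mul_ee_le (a : ℕ → ℂ) (N : ℕ) (β : ℝ) {B : ℝ}
    (hB : ∀ X ≤ N, ‖∑ n ∈ Finset.Ioc 0 X, a n‖ ≤ B) :
    ‖∑ n ∈ Finset.Ioc 0 N, a n * ee (n * β)‖ ≤ B * (1 + 2 * Real.pi * |β| * N) := by
  set A : ℕ → ℂ := fun X ↦ ∑ n ∈ Finset.Ioc 0 X, a n with hA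
  have key : ∀ M : ℕ, ∑ n ∈ Finset.Ioc 0 M, a n * ee (n * β) = A M * ee (M * β) +
      ∑ n ∈ Finset.range M, A n * (ee (n * β) * (1 - ee β)) := by
    intro M
    induction M with
    | zero => simp [hA]
    | succ M ih =>
      rw [Finset.sum_Ioc_succ_top (Nat.zero_le M), ih, Finset.sum_range_succ]
      have h1 : A (M + 1) = A M + a (M + 1) := Finset.sum_Ioc_succ_top (Nat.zero_le M) _
      have h2 : ee ((M + 1 : ℕ) * β) = ee (M * β) * ee β := by
        rw [← ee_add]; congr 1; push_cast; ring
      rw [h1, h2]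
      ring
  rw [key]
  have hpt : ∀ n ∈ Finset.range N, ‖A n * (ee (n * β) * (1 - ee β))‖ ≤ B * (2 * Real.pi * |β|) := by
    intro n hn
    rw [Finset.mem_range] at hn
    rw [norm_mul, norm_mul, norm_ee, one_mul, norm_sub_rev]
    have := hB n hn.le
    gcongr
    · exact (norm_nonneg _).trans this
    · exact norm_ee_sub_one_le β
  calc _ ≤ B + N * (B * (2 * Real.pi * |β|)) := by
        refine (norm_add_le _ _).trans (add_le_add ?_ ?_)
        · rw [norm_mul, norm_ee, mul_one]; exact hB N le_rfl
        · refine (norm_sum_le _ _).trans ((Finset.sum_le_card_nsmul _ _ _ hpt).trans ?_)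
          rw [Finset.card_range, nsmul_eq_mul]
    _ = _ := by ring

lemma abs_card_modEq_sub_le {W : ℕ} (hW : 0 < W) (X b : ℕ) :
    |(((Finset.Ioc 0 X).filter (fun n ↦ n ≡ b [MOD W])).card : ℝ) - X / W| ≤ 1 := by
  have h := Nat.Ioc_filter_modEq_card 0 X hW b
  have hW' : (0 : ℚ) < W := by exact_mod_cast hW
  have h1 := Int.floor_le (((X : ℚ) - b) / W)
  have h2 := Int.lt_floor_add_one (((X : ℚ) - b) / W)
  have h3 := Int.floor_le (((0 : ℕ) - (b : ℚ)) / W)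
  have h4 := Int.lt_floor_add_one (((0 : ℕ) - (b : ℚ)) / W)
  have h0 : ⌊((0 : ℕ) - (b : ℚ)) / W⌋ ≤ ⌊((X : ℚ) - b) / W⌋ := by
    apply Int.floor_le_floor
    gcongr
    exact Nat.zero_le X
  rw [max_eq_left (by linarith)] at h
  have h5 : (((Finset.Ioc 0 X).filter (fun n ↦ n ≡ b [MOD W])).card : ℚ) =
      (⌊((X : ℚ) - b) / W⌋ : ℚ) - (⌊((0 : ℕ) - (b : ℚ)) / W⌋ : ℚ) := by exact_mod_cast h
  have e : ((X : ℚ) - b) / W - ((0 : ℕ) - (b : ℚ)) / W = X / W := by push_cast; ring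
  have h6 : |(((Finset.Ioc 0 X).filter (fun n ↦ n ≡ b [MOD W])).card : ℚ) - X / W| ≤ 1 := by
    rw [abs_le]; constructor <;> linarith
  have h7 := (Rat.cast_le (K := ℝ)).2 h6
  push_cast at h7
  exact h7

lemma exists_major_le {W : ℕ} (hW : 0 < W) {η : ℝ} (hη : 0 < η) : ∃ C > 0, ∀ (X : ℕ) (h : ℤ),
    ‖∑ n ∈ Finset.Ioc 0 X, (((th n - wt W n : ℝ) : ℂ) * ee (n * ((h : ℝ) / W)))‖ ≤ η * X + C := by
  have hW' : (0 : ℝ) < W := by exact_mod_cast hW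
  obtain ⟨C, hC, hpnt⟩ := exists_pnt_ap W hW (η / W) (by positivity)
  refine ⟨W * (C + W), by positivity, fun X h ↦ ?_⟩
  have hfib := Finset.sum_fiberwise_of_maps_to (s := Finset.Ioc 0 X) (t := Finset.range W)
    (g := fun n ↦ n % W) (fun n _ ↦ Finset.mem_range.2 (Nat.mod_lt n hW))
    (fun n : ℕ ↦ ((th n - wt W n : ℝ) : ℂ) * ee (n * ((h : ℝ) / W)))
  rw [← hfib]
  have hpt : ∀ b ∈ Finset.range W, ‖∑ n ∈ (Finset.Ioc 0 X).filter (fun n ↦ n % W = b),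
      (((th n - wt W n : ℝ) : ℂ) * ee (n * ((h : ℝ) / W)))‖ ≤ η / W * X + (C + W) := by
    intro b hb
    have hb' := Finset.mem_range.1 hb
    have hfilter : (Finset.Ioc 0 X).filter (fun n ↦ n % W = b) =
        (Finset.Ioc 0 X).filter (fun n ↦ n ≡ b [MOD W]) := by
      refine Finset.filter_congr fun n _ ↦ ?_
      rw [Nat.ModEq, Nat.mod_eq_of_lt hb']
    have e1 : ∑ n ∈ (Finset.Ioc 0 X).filter (fun n ↦ n % W = b),
        (((th n - wt W n : ℝ) : ℂ) * ee (n * ((h : ℝ) / W))) =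
        ((∑ n ∈ (Finset.Ioc 0 X).filter (fun n ↦ n % W = b), (th n - wt W n) : ℝ) : ℂ) *
          ee (b * ((h : ℝ) / W)) := by
      push_cast
      rw [Finset.sum_mul]
      refine Finset.sum_congr rfl fun n hn ↦ ?_
      congr 1
      have h1 := (Finset.mem_filter.1 hn).2
      have h2 : (n : ℝ) = b + W * (n / W : ℕ) := by
        rw [← h1]; exact_mod_cast (Nat.mod_add_div n W).symm
      generalize n / W = t at h2
      rw [h2, show ((b : ℝ) + W * t) * (h / W) = b * (h / W) + ((t * h : ℤ) : ℝ) by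
        push_cast; field_simp, ee_add_int]
    rw [e1, norm_mul, norm_ee, mul_one, Complex.norm_real, Real.norm_eq_abs, hfilter,
      Finset.sum_sub_distrib]
    have e2 : ∑ n ∈ (Finset.Ioc 0 X).filter (fun n ↦ n ≡ b [MOD W]), wt W n =
        ((Finset.Ioc 0 X).filter (fun n ↦ n ≡ b [MOD W])).card * wt W b := by
      rw [← nsmul_eq_mul, ← Finset.sum_const]
      refine Finset.sum_congr rfl fun n hn ↦ ?_
      have h1 : n % W = b % W := (Finset.mem_filter.1 hn).2
      rw [← wt_mod, h1, wt_mod]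
    have e3 : (if b.Coprime W then (X : ℝ) / W.totient else 0) = X / W * wt W b := by
      rw [wt]
      split_ifs
      · field_simp
      · ring
    have h1 := hpnt X b
    rw [e3, ← zero_add 1, Finset.Icc_add_one_left_eq_Ioc] at h1
    have h2 : |(X : ℝ) / W * wt W b - ((Finset.Ioc 0 X).filter (fun n ↦ n ≡ b [MOD W])).card * wt W b| ≤ W := by
      rw [← sub_mul, abs_mul, abs_sub_comm, abs_of_nonneg (wt_nonneg W b)]
      calc _ ≤ 1 * (W : ℝ) := mul_le_mul (abs_card_modEq_sub_le hW X b) (wt_le hW b) (wt_nonneg W b) zero_le_one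
        _ = W := one_mul _
    rw [e2]
    have h3 := abs_sub_le (∑ n ∈ (Finset.Ioc 0 X).filter (fun n ↦ n ≡ b [MOD W]), th n) (X / W * wt W b)
      (((Finset.Ioc 0 X).filter (fun n ↦ n ≡ b [MOD W])).card * wt W b)
    linarith
  refine (norm_sum_le _ _).trans ((Finset.sum_le_card_nsmul _ _ _ hpt).trans (le_of_eq ?_))
  rw [Finset.card_range, nsmul_eq_mul]
  field_simp

/-- The primes are modelled, uniformly over all frequencies, by the integers without small prime factors. -/
lemma exists_wt_approx {η : ℝ} (hη : 0 < η) : ∃ Q ≥ 2, ∃ N0 : ℕ, ∀ N ≥ N0, ∀ α : ℝ,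
    ‖thSum N α - wtSum (primorial Q) N α‖ ≤ η * N := by
  obtain ⟨Q0, hQ0⟩ := exists_minor_le (η := η / 2) (by positivity)
  set Q := max 2 Q0 with hQ
  obtain ⟨N1, hN1⟩ := hQ0 Q (le_max_right _ _)
  have hQ2 : 2 ≤ Q := le_max_left _ _
  set W := Q.factorial with hW
  have hWpos : 0 < W := Q.factorial_pos
  have hW' : (0 : ℝ) < W := by exact_mod_cast hWpos
  set K : ℝ := max (W * Q) (2 * W ^ 2 / η) with hK
  have hKpos : 0 < K := lt_max_of_lt_right (by positivity)
  set c := 1 + 2 * Real.pi * K with hc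
  have hcpos : 0 < c := by positivity
  obtain ⟨C, hC, hmajor⟩ := exists_major_le hWpos (η := η / (2 * c)) (by positivity)
  obtain ⟨N2, hN2⟩ := exists_nat_ge (2 * C * c / η)
  refine ⟨Q, hQ2, max 1 (max N1 N2), fun N hN α ↦ ?_⟩
  simp only [ge_iff_le, max_le_iff] at hN
  have hN0 : (0 : ℝ) < N := by exact_mod_cast hN.1
  have hconv : wtSum (primorial Q) N α = wtSum W N α := by
    unfold wtSum
    refine Finset.sum_congr rfl fun k _ ↦ ?_
    rw [wt_congr (primorial_pos Q) hWpos ?_]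
    ext p
    rw [Nat.mem_primeFactors, Nat.mem_primeFactors]
    refine and_congr_right fun hp ↦ ?_
    rw [hp.dvd_primorial_iff, hp.dvd_factorial]
    simp [primorial_ne_zero, hWpos.ne']
  rw [hconv]
  rcases le_or_gt (K / N) (nd (W * α)) with hcase | hcase
  · have h1 : ‖thSum N α‖ ≤ η / 2 * N := by
      refine hN1 N hN.2.1 α fun q hq1 hqQ ↦ ?_
      obtain ⟨e, he⟩ : q ∣ W := Nat.dvd_factorial hq1 hqQ
      have h2 := nd_natMul_le e (q * α)
      rw [← mul_assoc, show (e : ℝ) * q = W by rw [he]; push_cast; ring] at h2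
      have heW : (e : ℝ) ≤ W := by
        have : e ≤ W := by rw [he]; exact Nat.le_mul_of_pos_left _ hq1
        exact_mod_cast this
      have h3 : W * (Q : ℝ) / N ≤ K / N := by gcongr; exact le_max_left _ _
      have h4 : W * ((Q : ℝ) / N) ≤ W * nd (q * α) := by
        calc _ = W * (Q : ℝ) / N := by ring
          _ ≤ e * nd (q * α) := h3.trans (hcase.trans h2)
          _ ≤ _ := by gcongr; exact nd_nonneg _
      exact le_of_mul_le_mul_left h4 hW'
    have h2 : ‖wtSum W N α‖ ≤ η / 2 * N := by
      have h3 := norm_wtSum_mul_nd_le hWpos N α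
      have h4 : 2 * (W : ℝ) ^ 2 / η / N ≤ nd (W * α) := le_trans (by gcongr; exact le_max_right _ _) hcase
      have h5 : ‖wtSum W N α‖ * (2 * (W : ℝ) ^ 2 / η / N) ≤ W ^ 2 := le_trans (by gcongr) h3
      have h6 : (0 : ℝ) < 2 * (W : ℝ) ^ 2 / η / N := by positivity
      rw [← le_div_iff₀ h6] at h5
      refine h5.trans (le_of_eq ?_)
      field_simp
    exact (norm_sub_le _ _).trans (by linarith)
  · set h := round ((W : ℝ) * α) with hh
    set β := α - h / W with hβ
    have hβ1 : |β| * N ≤ K := by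
      have h1 : |β| ≤ nd (W * α) := by
        have h2 : nd (W * α) = W * |β| := by
          rw [nd, ← hh, hβ, ← abs_of_pos hW', ← abs_mul, abs_of_pos hW']
          congr 1; field_simp
        rw [h2]
        have : (1 : ℝ) ≤ W := by exact_mod_cast hWpos
        nlinarith [abs_nonneg β]
      rw [← le_div_iff₀ hN0]
      exact h1.trans hcase.le
    have e1 : thSum N α - wtSum W N α =
        ∑ n ∈ Finset.Ioc 0 N, (((th n - wt W n : ℝ) : ℂ) * ee (n * ((h : ℝ) / W))) * ee (n * β) := by
      rw [thSum, wtSum, ← Finset.sum_sub_distrib]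
      refine Finset.sum_congr rfl fun n _ ↦ ?_
      rw [mul_assoc, ← ee_add, hβ, ← mul_add, add_sub_cancel]
      push_cast; ring
    rw [e1]
    have hCN : C * c ≤ η / 2 * N := by
      have h1 : (N2 : ℝ) ≤ N := by exact_mod_cast hN.2.2
      have := hN2.trans h1
      rw [div_le_iff₀ hη] at this
      linarith
    have hb := norm_sum_mul_ee_le
      (fun n ↦ ((th n - wt W n : ℝ) : ℂ) * ee (n * ((h : ℝ) / W))) N β (B := η / (2 * c) * N + C)
      (fun X hX ↦ (hmajor X h).trans (by gcongr))
    refine hb.trans ?_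
    calc _ ≤ (η / (2 * c) * N + C) * c := by
          gcongr
          rw [hc]
          have := mul_le_mul_of_nonneg_left hβ1 (by positivity : 0 ≤ 2 * Real.pi)
          linarith
      _ = η / 2 * N + C * c := by field_simp
      _ ≤ η * N := by linarith

lemma sum_cube_le {ι : Type} (s : Finset ι) (v : ι → ℝ) (hv : ∀ i ∈ s, 0 ≤ v i) {C : ℝ} (hC : 0 ≤ C)
    (hcard : ∀ κ > 0, ((s.filter (fun i ↦ κ ≤ v i)).card : ℝ) * (κ ^ 2 * √κ) ≤ C) {τ : ℝ} (hτ : 0 < τ) :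
    ∑ i ∈ s.filter (fun i ↦ v i ≤ τ), v i ^ 3 ≤ 24 * C * √τ := by
  classical
  have hstep : ∀ t > 0, ∑ i ∈ s.filter (fun i ↦ v i ≤ t), v i ^ 3 - 24 * C * √t ≤
      ∑ i ∈ s.filter (fun i ↦ v i ≤ t / 2), v i ^ 3 - 24 * C * √(t / 2) := by
    intro t ht
    have h1 : ∑ i ∈ s.filter (fun i ↦ v i ≤ t), v i ^ 3 ≤
        ∑ i ∈ s.filter (fun i ↦ v i ≤ t / 2), v i ^ 3 +
        ∑ i ∈ s.filter (fun i ↦ t / 2 ≤ v i), t ^ 3 := by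
      rw [← Finset.sum_filter_add_sum_filter_not (s.filter (fun i ↦ v i ≤ t)) (fun i ↦ v i ≤ t / 2)]
      refine add_le_add ?_ ?_
      · refine Finset.sum_le_sum_of_subset_of_nonneg ?_ ?_
        · intro i; simp only [Finset.mem_filter]; tauto
        · intro i hi _; have := hv i (Finset.mem_filter.1 hi).1; positivity
      · calc _ ≤ ∑ i ∈ (s.filter (fun i ↦ v i ≤ t)).filter (fun i ↦ ¬ v i ≤ t / 2), t ^ 3 := by
              refine Finset.sum_le_sum fun i hi ↦ ?_
              simp only [Finset.mem_filter] at hi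
              have := hv i hi.1.1
              have := hi.1.2
              gcongr
          _ ≤ _ := by
              refine Finset.sum_le_sum_of_subset_of_nonneg ?_ fun _ _ _ ↦ by positivity
              intro i; simp only [Finset.mem_filter, not_le]
              exact fun h ↦ ⟨h.1.1, h.2.le⟩
    rw [Finset.sum_const, nsmul_eq_mul] at h1
    have h2 := hcard (t / 2) (by positivity)
    set c := ((s.filter (fun i ↦ t / 2 ≤ v i)).card : ℝ)
    set r := √(t / 2) with hr
    have hr0 : 0 < r := Real.sqrt_pos.2 (by positivity)
    have hr2 : r ^ 2 = t / 2 := Real.sq_sqrt (by positivity)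
    have ht2 : t = 2 * r ^ 2 := by linarith
    have hst : √t = √2 * r := by rw [hr, ← Real.sqrt_mul (by norm_num)]; congr 1; ring
    have hs2 : 1.4 ≤ √2 := Real.le_sqrt_of_sq_le (by norm_num)
    have h3 : c * t ^ 3 ≤ 8 * C * r := by
      rw [← hr2] at h2
      calc c * t ^ 3 = 8 * (c * ((r ^ 2) ^ 2 * r)) * r := by rw [ht2]; ring
        _ ≤ 8 * C * r := by gcongr
    have h4 : 24 * C * r + 8 * C * r ≤ 24 * C * √t := by
      rw [hst]
      have : 0 ≤ C * r * (√2 - 1.4) := by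
        have : 0 ≤ √2 - 1.4 := by linarith
        positivity
      have : 0 ≤ C * r := by positivity
      nlinarith
    linarith
  have hiter : ∀ k : ℕ, ∑ i ∈ s.filter (fun i ↦ v i ≤ τ), v i ^ 3 - 24 * C * √τ ≤
      s.card * (τ / 2 ^ k) ^ 3 := by
    intro k
    have h1 : ∑ i ∈ s.filter (fun i ↦ v i ≤ τ), v i ^ 3 - 24 * C * √τ ≤
        ∑ i ∈ s.filter (fun i ↦ v i ≤ τ / 2 ^ k), v i ^ 3 - 24 * C * √(τ / 2 ^ k) := by
      induction k with
      | zero => simp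
      | succ k ih =>
        refine ih.trans ((hstep _ (by positivity)).trans_eq ?_)
        rw [div_div, ← pow_succ]
    have h2 : ∑ i ∈ s.filter (fun i ↦ v i ≤ τ / 2 ^ k), v i ^ 3 ≤ s.card * (τ / 2 ^ k) ^ 3 := by
      calc _ ≤ ∑ i ∈ s.filter (fun i ↦ v i ≤ τ / 2 ^ k), (τ / 2 ^ k) ^ 3 := by
            refine Finset.sum_le_sum fun i hi ↦ ?_
            rw [Finset.mem_filter] at hi
            have := hv i hi.1
            have := hi.2
            gcongr
        _ ≤ _ := by
            rw [Finset.sum_const, nsmul_eq_mul]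
            gcongr
            exact Finset.filter_subset _ _
    have h3 : 0 ≤ 24 * C * √(τ / 2 ^ k) := by positivity
    linarith
  have hlim : Tendsto (fun k : ℕ ↦ (s.card : ℝ) * (τ / 2 ^ k) ^ 3) atTop (nhds 0) := by
    have h1 : Tendsto (fun k : ℕ ↦ τ * (1 / 2 : ℝ) ^ k) atTop (nhds 0) := by
      simpa using (tendsto_pow_atTop_nhds_zero_of_lt_one (by norm_num : (0 : ℝ) ≤ 1 / 2) (by norm_num)).const_mul τ
    have h2 := (h1.pow 3).const_mul (s.card : ℝ)
    simp only [ne_eq, OfNat.ofNat_ne_zero, not_false_eq_true, zero_pow, mul_zero] at h2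
    refine h2.congr fun k ↦ ?_
    rw [one_div, inv_pow, div_eq_mul_inv]
  linarith [ge_of_tendsto' hlim hiter]

lemma exists_sum_cube_sub_le {C σ : ℝ} (hC : 0 ≤ C) (hσ : 0 < σ) : ∃ η > 0, ∀ (ι : Type) (s : Finset ι) (f g : ι → ℂ),
    (∀ κ > 0, ((s.filter (fun i ↦ κ ≤ ‖f i‖)).card : ℝ) * (κ ^ 2 * √κ) ≤ C) →
    (∀ κ > 0, ((s.filter (fun i ↦ κ ≤ ‖g i‖)).card : ℝ) * (κ ^ 2 * √κ) ≤ C) →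
    (∀ i ∈ s, ‖f i‖ ≤ 6) → (∀ i ∈ s, ‖f i - g i‖ ≤ η) →
    ∑ i ∈ s, ‖f i ^ 3 - g i ^ 3‖ ≤ σ := by
  classical
  obtain ⟨τ, hτ, hτσ⟩ : ∃ τ > 0, 48 * C * √τ ≤ σ / 2 := by
    refine ⟨(σ / (96 * (C + 1))) ^ 2, by positivity, ?_⟩
    rw [Real.sqrt_sq (by positivity)]
    rw [mul_div_assoc', div_le_div_iff₀ (by positivity) (by norm_num)]
    nlinarith
  set B := C / (τ ^ 2 * √τ) with hB
  have hB0 : 0 ≤ B := by positivity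
  refine ⟨min 1 (σ / (508 * (B + 1))), by positivity, fun ι s f g hf hg hf6 hfg ↦ ?_⟩
  set η := min 1 (σ / (508 * (B + 1))) with hη
  have hη0 : 0 < η := by positivity
  have hη1 : η ≤ 1 := min_le_left _ _
  have hηB : 254 * η * B ≤ σ / 2 := by
    have h1 : η ≤ σ / (508 * (B + 1)) := min_le_right _ _
    rw [le_div_iff₀ (by positivity)] at h1
    nlinarith
  have hpt : ∀ i ∈ s, ‖f i ^ 3 - g i ^ 3‖ ≤
      ((if ‖f i‖ ≤ τ then ‖f i‖ ^ 3 else 0) + (if ‖g i‖ ≤ τ then ‖g i‖ ^ 3 else 0)) +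
      ((if τ ≤ ‖f i‖ then 127 * η else 0) + (if τ ≤ ‖g i‖ then 127 * η else 0)) := by
    intro i hi
    have hg7 : ‖g i‖ ≤ 7 := by
      have h1 : ‖g i‖ ≤ ‖f i‖ + ‖f i - g i‖ := by
        have := norm_sub_le (f i) (f i - g i)
        rwa [sub_sub_cancel] at this
      linarith [hf6 i hi, hfg i hi]
    have hd : ‖f i ^ 3 - g i ^ 3‖ ≤ 127 * η := by
      have e : f i ^ 3 - g i ^ 3 = (f i ^ 2 + f i * g i + g i ^ 2) * (f i - g i) := by ring
      rw [e, norm_mul]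
      refine mul_le_mul ?_ (hfg i hi) (norm_nonneg _) (by norm_num)
      calc _ ≤ ‖f i‖ ^ 2 + ‖f i‖ * ‖g i‖ + ‖g i‖ ^ 2 := by
            refine (norm_add₃_le).trans ?_
            rw [norm_pow, norm_mul, norm_pow]
        _ ≤ 6 ^ 2 + 6 * 7 + 7 ^ 2 := by
            have := hf6 i hi
            gcongr
        _ = 127 := by norm_num
    have hs : ‖f i ^ 3 - g i ^ 3‖ ≤ ‖f i‖ ^ 3 + ‖g i‖ ^ 3 := by
      refine (norm_sub_le _ _).trans ?_
      rw [norm_pow, norm_pow]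
    have p1 : 0 ≤ ‖f i‖ ^ 3 := by positivity
    have p2 : 0 ≤ ‖g i‖ ^ 3 := by positivity
    split_ifs <;> linarith
  have hcardτ : ∀ h : ι → ℂ, (∀ κ > 0, ((s.filter (fun i ↦ κ ≤ ‖h i‖)).card : ℝ) * (κ ^ 2 * √κ) ≤ C) →
      ∑ i ∈ s, (if τ ≤ ‖h i‖ then 127 * η else 0) ≤ B * (127 * η) := by
    intro h hh
    rw [← Finset.sum_filter, Finset.sum_const, nsmul_eq_mul]
    gcongr
    rw [hB, le_div_iff₀ (by positivity)]
    exact hh τ hτ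
  have c1 := sum_cube_le s (fun i ↦ ‖f i‖) (fun i _ ↦ norm_nonneg _) hC hf hτ
  have c2 := sum_cube_le s (fun i ↦ ‖g i‖) (fun i _ ↦ norm_nonneg _) hC hg hτ
  refine (Finset.sum_le_sum hpt).trans ?_
  rw [Finset.sum_add_distrib, Finset.sum_add_distrib, Finset.sum_add_distrib, ← Finset.sum_filter,
    ← Finset.sum_filter]
  linarith [hcardτ f hf, hcardτ g hg]

lemma sum_divisors_one_div_totient {D : ℕ} (hD : Squarefree D) :
    ∑ k ∈ D.divisors, 1 / (k.totient : ℝ) = D / D.totient := by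
  let f : ArithmeticFunction ℝ := ⟨fun k ↦ 1 / (k.totient : ℝ), by simp⟩
  have hf : f.IsMultiplicative := by
    refine ⟨by simp [f], fun {m n} hmn ↦ ?_⟩
    simp [f, Nat.totient_mul hmn, mul_comm]
  have h := hf.prodPrimeFactors_one_add_of_squarefree hD
  rw [← prod_primeFactors_inv D (Nat.pos_of_ne_zero hD.ne_zero)]
  refine h.symm.trans (Finset.prod_congr rfl fun p hp ↦ ?_)
  have hp' := Nat.prime_of_mem_primeFactors hp
  have h1 : (1 : ℝ) < p := by exact_mod_cast hp'.one_lt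
  have h2 : (p : ℝ) - 1 ≠ 0 := by linarith
  simp only [f, ArithmeticFunction.coe_mk, Nat.totient_prime hp', Nat.cast_pred hp'.pos]
  field_simp
  ring

lemma exists_card_large_wt : ∃ C : ℝ, 0 < C ∧ ∀ (ι : Type) (s : Finset ι) (x : ι → ℝ) (D L : ℕ) (κ : ℝ),
    0 < D → Squarefree D → D ^ 4 ≤ L → 0 < κ →
    (∀ i ∈ s, ∀ j ∈ s, i ≠ j → 1 / (L : ℝ) ≤ nd (x i - x j)) →
    ∀ a : ℕ → ℂ, (∀ n, ‖a n‖ ≤ wt D n) →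
    (∀ i ∈ s, κ * L ≤ ‖expSum a L (x i)‖) → (s.card : ℝ) ≤ C * κ ^ (-(5 / 2) : ℝ) := by
  obtain ⟨C, hC, h⟩ := exists_largeValues
  refine ⟨(4 * C) ^ (5 / 4 : ℝ), by positivity, ?_⟩
  intro ι s x D L κ hD hsq hL hκ hs a ha hlarge
  rcases s.eq_empty_or_nonempty with rfl | hne
  · simp; positivity
  have hDL : D ≤ L := (Nat.le_self_pow (by norm_num) D).trans hL
  have hc : (0 : ℝ) < s.card := by exact_mod_cast hne.card_pos
  have hL' : (0 : ℝ) < L := by exact_mod_cast (by omega : 0 < L)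
  have hD' : (0 : ℝ) < D := by exact_mod_cast hD
  have hφ : (0 : ℝ) < D.totient := by exact_mod_cast Nat.totient_pos.2 hD
  have h1 := h ι s x L D (by omega) hL hs D.divisors
    (fun k hk ↦ hsq.squarefree_of_dvd (Nat.dvd_of_mem_divisors hk))
    (fun k hk d hd ↦ Nat.mem_divisors.2 ⟨hd.trans (Nat.dvd_of_mem_divisors hk), hD.ne'⟩)
    (fun k hk ↦ Nat.divisor_le hk) a (fun n hn k hk ↦ by
      by_contra hp
      have := ha n
      rw [wt, if_neg fun hc ↦ hp (hc.coprime_dvd_right (Nat.dvd_of_mem_divisors hk))] at this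
      exact hn (norm_le_zero_iff.1 this))
  rw [sum_divisors_one_div_totient hsq] at h1
  have h2 : s.card * (κ * L) ^ 2 ≤ ∑ i ∈ s, ‖expSum a L (x i)‖ ^ 2 := by
    rw [← nsmul_eq_mul, ← Finset.sum_const]
    refine Finset.sum_le_sum fun i hi ↦ ?_
    have := hlarge i hi
    gcongr
  have h3 : ∑ n ∈ Finset.range (L + 1), ‖a n‖ ^ 2 ≤ 4 * L * (D / D.totient) := by
    have hcop : (((Finset.range (L + 1)).filter (fun n ↦ D.Coprime n)).card : ℝ) ≤ D.totient * (4 * L / D) := by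
      have h1 := Nat.Ico_filter_coprime_le 0 (L + 1) hD.ne'
      rw [zero_add, ← Finset.range_eq_Ico] at h1
      have h2 : ((L + 1) / D + 1 : ℕ) ≤ (4 * L / D : ℝ) := by
        have h3 : (((L + 1) / D : ℕ) : ℝ) ≤ ((L + 1 : ℕ) : ℝ) / D := Nat.cast_div_le
        have h4 : (1 : ℝ) ≤ L / D := by
          rw [le_div_iff₀ hD', one_mul]; exact_mod_cast hDL
        have h5 : ((L + 1 : ℕ) : ℝ) / D ≤ 2 * L / D := by
          gcongr
          exact_mod_cast (by omega : L + 1 ≤ 2 * L)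
        push_cast
        calc (((L + 1) / D : ℕ) : ℝ) + 1 ≤ 2 * L / D + L / D := add_le_add (h3.trans h5) h4
          _ = 3 * L / D := by ring
          _ ≤ 4 * L / D := by gcongr; norm_num
      calc _ ≤ ((D.totient * ((L + 1) / D + 1) : ℕ) : ℝ) := by exact_mod_cast h1
        _ = D.totient * ((L + 1) / D + 1 : ℕ) := by push_cast; ring
        _ ≤ _ := by gcongr
    calc _ ≤ ∑ n ∈ Finset.range (L + 1), wt D n ^ 2 := by
          refine Finset.sum_le_sum fun n _ ↦ ?_
          have := ha n
          gcongr
      _ = ((Finset.range (L + 1)).filter (fun n ↦ D.Coprime n)).card * ((D : ℝ) / D.totient) ^ 2 := by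
          rw [← nsmul_eq_mul, ← Finset.sum_const, Finset.sum_filter]
          refine Finset.sum_congr rfl fun n _ ↦ ?_
          simp only [wt, Nat.coprime_comm (m := D)]
          split_ifs <;> simp
      _ ≤ D.totient * (4 * L / D) * ((D : ℝ) / D.totient) ^ 2 := by gcongr
      _ = _ := by field_simp
  set ρ := (D : ℝ) / D.totient with hρ
  have hρ0 : 0 < ρ := by positivity
  have h4 : (s.card : ℝ) * (κ * L) ^ 2 * ρ ≤
      C * (s.card : ℝ) ^ (1 / 5 : ℝ) * L * (4 * L * ρ) := by
    calc _ ≤ _ := mul_le_mul_of_nonneg_right h2 hρ0.le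
      _ ≤ _ := h1
      _ ≤ _ := by gcongr
  have e1 : (s.card : ℝ) ^ (1 / 5 : ℝ) * (s.card : ℝ) ^ (4 / 5 : ℝ) = s.card := by
    rw [← Real.rpow_add hc, show (1 / 5 + 4 / 5 : ℝ) = 1 by norm_num, Real.rpow_one]
  have hc5 : 0 < (s.card : ℝ) ^ (1 / 5 : ℝ) := by positivity
  have h5 : (s.card : ℝ) ^ (4 / 5 : ℝ) * κ ^ 2 ≤ 4 * C := by
    have : ((s.card : ℝ) ^ (1 / 5 : ℝ) * L ^ 2 * ρ) * ((s.card : ℝ) ^ (4 / 5 : ℝ) * κ ^ 2) ≤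
        ((s.card : ℝ) ^ (1 / 5 : ℝ) * L ^ 2 * ρ) * (4 * C) := by
      calc _ = ((s.card : ℝ) ^ (1 / 5 : ℝ) * (s.card : ℝ) ^ (4 / 5 : ℝ)) * (κ * L) ^ 2 * ρ := by ring
        _ ≤ C * (s.card : ℝ) ^ (1 / 5 : ℝ) * L * (4 * L * ρ) := by rw [e1]; exact h4
        _ = _ := by ring
    exact le_of_mul_le_mul_left this (by positivity)
  have h6 : (s.card : ℝ) ^ (4 / 5 : ℝ) ≤ 4 * C * κ ^ (-2 : ℝ) := by
    rw [Real.rpow_neg hκ.le, Real.rpow_two, ← div_eq_mul_inv, le_div_iff₀ (by positivity)]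
    exact h5
  calc (s.card : ℝ) = ((s.card : ℝ) ^ (4 / 5 : ℝ)) ^ (5 / 4 : ℝ) := by
        rw [← Real.rpow_mul hc.le, show (4 / 5 * (5 / 4) : ℝ) = 1 by norm_num, Real.rpow_one]
    _ ≤ (4 * C * κ ^ (-2 : ℝ)) ^ (5 / 4 : ℝ) := by gcongr
    _ = _ := by
        rw [Real.mul_rpow (by positivity) (by positivity), ← Real.rpow_mul hκ.le,
          show (-2 * (5 / 4) : ℝ) = -(5 / 2) by norm_num]

/-- The number of representations of `N` as a sum of three naturals, weighted by `u`. -/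
noncomputable def tern (u : ℕ → ℝ) (N : ℕ) : ℝ :=
  ∑ a ∈ Finset.range (N + 1), ∑ b ∈ Finset.range (N + 1), ∑ c ∈ Finset.range (N + 1),
    if a + b + c = N then u a * u b * u c else 0

lemma sum_ee_intMul_div {M : ℕ} (hM : 0 < M) {k : ℤ} (hk : |k| < M) :
    ∑ m ∈ Finset.range M, ee (k * ((m : ℝ) / M)) = if k = 0 then (M : ℂ) else 0 := by
  split_ifs with h
  · simp [h, ee_zero]
  · have hdvd : ¬ (M : ℤ) ∣ k := fun hd ↦ h (Int.eq_zero_of_abs_lt_dvd hd hk)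
    have hM' : (0 : ℝ) < M := by exact_mod_cast hM
    have h1 : ee ((k : ℝ) / M) ≠ 1 := by
      intro h1
      have h2 := nd_intCast_div_ge hM hdvd
      have h3 := four_nd_le ((k : ℝ) / M)
      rw [h1, sub_self, norm_zero] at h3
      have : 0 < 1 / (M : ℝ) := by positivity
      linarith
    have h2 : ∀ m ∈ Finset.range M, ee (k * ((m : ℝ) / M)) = ee ((k : ℝ) / M) ^ m := by
      intro m _
      rw [← ee_natMul]; congr 1; ring
    rw [Finset.sum_congr rfl h2, geom_sum_eq h1, ← ee_natMul,
      show (M : ℝ) * (k / M) = k by field_simp, ee_int, sub_self, zero_div]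

lemma sum_expSum_cube (u : ℕ → ℝ) {N : ℕ} (hN : 0 < N) :
    ∑ m ∈ Finset.range (3 * N), expSum (fun n ↦ (u n : ℂ)) N ((m : ℝ) / (3 * N : ℕ)) ^ 3 *
      ee (-(N * ((m : ℝ) / (3 * N : ℕ)))) = ((3 * N * tern u N : ℝ) : ℂ) := by
  have hM : 0 < 3 * N := by omega
  have h1 : ∀ m ∈ Finset.range (3 * N), expSum (fun n ↦ (u n : ℂ)) N ((m : ℝ) / (3 * N : ℕ)) ^ 3 *
      ee (-(N * ((m : ℝ) / (3 * N : ℕ)))) =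
      ∑ a ∈ Finset.range (N + 1), ∑ b ∈ Finset.range (N + 1), ∑ c ∈ Finset.range (N + 1),
        ((u a * u b * u c : ℝ) : ℂ) * ee ((((a + b + c : ℕ) : ℤ) - (N : ℤ) : ℤ) * ((m : ℝ) / (3 * N : ℕ))) := by
    intro m _
    rw [pow_three', expSum, Finset.sum_mul_sum, Finset.sum_mul, Finset.sum_mul]
    refine Finset.sum_congr rfl fun a _ ↦ ?_
    rw [Finset.sum_mul, Finset.sum_mul]
    refine Finset.sum_congr rfl fun b _ ↦ ?_
    rw [Finset.mul_sum, Finset.sum_mul]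
    refine Finset.sum_congr rfl fun c _ ↦ ?_
    set x := (m : ℝ) / (3 * N : ℕ)
    rw [show ((((a + b + c : ℕ) : ℤ) - (N : ℤ) : ℤ) : ℝ) * x = a * x + b * x + c * x + -(N * x) by
      push_cast; ring, ee_add, ee_add, ee_add]
    push_cast; ring
  rw [Finset.sum_congr rfl h1, Finset.sum_comm, tern]
  push_cast
  rw [Finset.mul_sum]
  refine Finset.sum_congr rfl fun a ha ↦ ?_
  rw [Finset.sum_comm, Finset.mul_sum]
  refine Finset.sum_congr rfl fun b hb ↦ ?_
  rw [Finset.sum_comm, Finset.mul_sum]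
  refine Finset.sum_congr rfl fun c hc ↦ ?_
  rw [Finset.mem_range] at ha hb hc
  have h2 := sum_ee_intMul_div hM (k := ((a + b + c : ℕ) : ℤ) - (N : ℤ)) (by
    rw [abs_lt]; constructor <;> push_cast <;> omega)
  push_cast at h2
  rw [← Finset.mul_sum, h2]
  by_cases h : a + b + c = N
  · rw [if_pos h, if_pos (by omega)]; push_cast; ring
  · rw [if_neg h, if_neg (by omega)]; simp

lemma grid_spacing {N : ℕ} (hN : 0 < N) {m m' : ℕ} (hm : m < 3 * N) (hm' : m' < 3 * N) (hne : m ≠ m')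
    (hmod : m % 3 = m' % 3) : 1 / (N : ℝ) ≤ nd ((m : ℝ) / (3 * N : ℕ) - (m' : ℝ) / (3 * N : ℕ)) := by
  obtain ⟨k, hk⟩ : ∃ k : ℤ, (m : ℤ) - m' = 3 * k := ⟨((m : ℤ) - m') / 3, by omega⟩
  have hN' : (N : ℝ) ≠ 0 := by exact_mod_cast hN.ne'
  have h1 : (m : ℝ) - m' = 3 * k := by exact_mod_cast hk
  have h2 : (m : ℝ) / (3 * N : ℕ) - (m' : ℝ) / (3 * N : ℕ) = (k : ℝ) / N := by
    rw [← sub_div, h1]; push_cast; field_simp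
  rw [h2]
  refine nd_intCast_div_ge hN fun hd ↦ ?_
  have := Int.eq_zero_of_abs_lt_dvd hd (by rw [abs_lt]; constructor <;> omega)
  omega

lemma card_grid_le {N : ℕ} (hN : 0 < N) (P : ℕ → Prop) [DecidablePred P] {B : ℝ}
    (h : ∀ s : Finset ℕ, (∀ i ∈ s, P i) → (∀ i ∈ s, ∀ j ∈ s, i ≠ j →
      1 / (N : ℝ) ≤ nd ((i : ℝ) / (3 * N : ℕ) - (j : ℝ) / (3 * N : ℕ))) → (s.card : ℝ) ≤ B) :
    (((Finset.range (3 * N)).filter P).card : ℝ) ≤ 3 * B := by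
  have h1 := Finset.card_eq_sum_card_fiberwise (s := (Finset.range (3 * N)).filter P)
    (t := Finset.range 3) (f := fun m ↦ m % 3) (fun m _ ↦ by
      simp only [Finset.coe_range, Set.mem_Iio]; exact Nat.mod_lt m (by norm_num))
  rw [h1]
  push_cast
  calc _ ≤ ∑ r ∈ Finset.range 3, B := by
        refine Finset.sum_le_sum fun r _ ↦ h _ ?_ ?_
        · intro i hi
          simp only [Finset.mem_filter] at hi
          exact hi.1.2
        · intro i hi j hj hij
          simp only [Finset.mem_filter, Finset.mem_range] at hi hj
          exact grid_spacing hN hi.1.1 hj.1.1 hij (hi.2.trans hj.2.symm)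
    _ = 3 * B := by simp

lemma expSum_cut_eq (t : ℕ → ℝ) {a N : ℕ} (ha : a ≤ N) (x : ℝ) :
    expSum (fun n ↦ ((if a < n then t n else 0 : ℝ) : ℂ)) N x =
      ∑ n ∈ Finset.Ioc 0 N, (t n : ℂ) * ee (n * x) - ∑ n ∈ Finset.Ioc 0 a, (t n : ℂ) * ee (n * x) := by
  rw [eq_sub_iff_add_eq, add_comm, ← Finset.sum_Ioc_consecutive _ (Nat.zero_le a) ha]
  congr 1
  rw [expSum]
  simp only [apply_ite Complex.ofReal, Complex.ofReal_zero, ite_mul, zero_mul]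
  rw [← Finset.sum_filter]
  refine Finset.sum_congr ?_ fun _ _ ↦ rfl
  ext n; simp only [Finset.mem_filter, Finset.mem_range, Finset.mem_Ioc]; omega

lemma rpow_mul_sq_mul_sqrt {κ : ℝ} (hκ : 0 < κ) : κ ^ (-(5 / 2) : ℝ) * (κ ^ 2 * √κ) = 1 := by
  rw [Real.sqrt_eq_rpow, ← Real.rpow_two, ← Real.rpow_add hκ, ← Real.rpow_add hκ]
  norm_num

lemma exists_tern_sub_le {σ c : ℝ} (hσ : 0 < σ) (hc : 0 < c) : ∃ Q ≥ 2, ∃ N0 : ℕ, ∀ N ≥ N0, ∀ a : ℕ,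
    c * N ≤ a → a ≤ N →
    |tern (fun n ↦ if a < n then th n else 0) N - tern (fun n ↦ if a < n then wt (primorial Q) n else 0) N| ≤
      σ * N ^ 2 := by
  obtain ⟨C1, hC1, h1⟩ := exists_card_large_th
  obtain ⟨C2, hC2, h2⟩ := exists_card_large_wt
  obtain ⟨η, hη, hcube⟩ := exists_sum_cube_sub_le (C := 3 * max C1 C2) (σ := 3 * σ) (by positivity) (by positivity)
  obtain ⟨Q, hQ, N1, hN1⟩ := exists_wt_approx (η := η / 2) (by positivity)
  set D := primorial Q with hD
  have hD0 : 0 < D := primorial_pos Q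
  have hDsq : Squarefree D := squarefree_primorial Q
  refine ⟨Q, hQ, max 2 (max N1 (max (D ^ 4) (max ⌈N1 / c⌉₊ (⌈1 / c ^ 2⌉₊ + 1)))), fun N hN a haN haN' ↦ ?_⟩
  simp only [ge_iff_le, max_le_iff] at hN
  obtain ⟨hN2, hNN1, hND, hNc, hNc2⟩ := hN
  have hN0 : (0 : ℝ) < N := by exact_mod_cast (by omega : 0 < N)
  have haN1 : N1 ≤ a := by
    have h3 : (N1 : ℝ) / c ≤ N := (Nat.le_ceil _).trans (by exact_mod_cast hNc)
    rw [div_le_iff₀ hc] at h3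
    exact_mod_cast (h3.trans (by linarith : (N : ℝ) * c ≤ a))
  have haN2 : ∀ n : ℕ, a < n → N < n ^ 2 := by
    intro n hn
    have h3 : (1 : ℝ) / c ^ 2 ≤ N := (Nat.le_ceil _).trans (by exact_mod_cast (by omega : ⌈1 / c ^ 2⌉₊ ≤ N))
    rw [div_le_iff₀ (by positivity)] at h3
    have h4 : (N : ℝ) ≤ a ^ 2 := by
      calc (N : ℝ) = N * 1 := (mul_one _).symm
        _ ≤ N * (N * c ^ 2) := by gcongr
        _ = (c * N) ^ 2 := by ring
        _ ≤ a ^ 2 := by gcongr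
    have h5 : N ≤ a ^ 2 := by exact_mod_cast h4
    exact h5.trans_lt (Nat.pow_lt_pow_left hn (by norm_num))
  set u : ℕ → ℝ := fun n ↦ if a < n then th n else 0 with hu
  set w : ℕ → ℝ := fun n ↦ if a < n then wt D n else 0 with hw
  set f : ℕ → ℂ := fun m ↦ expSum (fun n ↦ (u n : ℂ)) N ((m : ℝ) / (3 * N : ℕ)) / N with hf
  set g : ℕ → ℂ := fun m ↦ expSum (fun n ↦ (w n : ℂ)) N ((m : ℝ) / (3 * N : ℕ)) / N with hg
  have hnorm : ∀ (z : ℂ) (κ : ℝ), κ ≤ ‖z / N‖ → κ * N ≤ ‖z‖ := by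
    intro z κ h
    rwa [norm_div, Complex.norm_natCast, le_div_iff₀ hN0] at h
  have hfc : ∀ κ > 0, (((Finset.range (3 * N)).filter (fun i ↦ κ ≤ ‖f i‖)).card : ℝ) * (κ ^ 2 * √κ) ≤ 3 * max C1 C2 := by
    intro κ hκ
    have h3 := card_grid_le (by omega : 0 < N) (fun i ↦ κ ≤ ‖f i‖) (B := C1 * κ ^ (-(5 / 2) : ℝ)) (by
      intro s hs hsp
      refine h1 ℕ s (fun m ↦ (m : ℝ) / (3 * N : ℕ)) N κ hN2 hκ hsp (fun n ↦ (u n : ℂ)) ?_ ?_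
        fun i hi ↦ hnorm _ _ (hs i hi)
      · intro n
        rw [Complex.norm_real, Real.norm_eq_abs]
        simp only [hu]
        split_ifs
        · rw [abs_of_nonneg (th_nonneg n)]
        · rw [abs_zero]; exact th_nonneg n
      · intro n hn
        refine haN2 n ?_
        by_contra h
        exact hn (by simp [hu, h]))
    calc _ ≤ 3 * (C1 * κ ^ (-(5 / 2) : ℝ)) * (κ ^ 2 * √κ) := by gcongr
      _ = 3 * C1 * (κ ^ (-(5 / 2) : ℝ) * (κ ^ 2 * √κ)) := by ring
      _ = 3 * C1 := by rw [rpow_mul_sq_mul_sqrt hκ, mul_one]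
      _ ≤ _ := by gcongr; exact le_max_left _ _
  have hgc : ∀ κ > 0, (((Finset.range (3 * N)).filter (fun i ↦ κ ≤ ‖g i‖)).card : ℝ) * (κ ^ 2 * √κ) ≤ 3 * max C1 C2 := by
    intro κ hκ
    have h3 := card_grid_le (by omega : 0 < N) (fun i ↦ κ ≤ ‖g i‖) (B := C2 * κ ^ (-(5 / 2) : ℝ)) (by
      intro s hs hsp
      refine h2 ℕ s (fun m ↦ (m : ℝ) / (3 * N : ℕ)) D N κ hD0 hDsq hND hκ hsp (fun n ↦ (w n : ℂ)) ?_
        fun i hi ↦ hnorm _ _ (hs i hi)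
      intro n
      rw [Complex.norm_real, Real.norm_eq_abs]
      simp only [hw]
      split_ifs
      · rw [abs_of_nonneg (wt_nonneg D n)]
      · rw [abs_zero]; exact wt_nonneg D n)
    calc _ ≤ 3 * (C2 * κ ^ (-(5 / 2) : ℝ)) * (κ ^ 2 * √κ) := by gcongr
      _ = 3 * C2 * (κ ^ (-(5 / 2) : ℝ) * (κ ^ 2 * √κ)) := by ring
      _ = 3 * C2 := by rw [rpow_mul_sq_mul_sqrt hκ, mul_one]
      _ ≤ _ := by gcongr; exact le_max_right _ _
  have hf6 : ∀ i ∈ Finset.range (3 * N), ‖f i‖ ≤ 6 := by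
    intro i _
    simp only [hf]
    rw [norm_div, Complex.norm_natCast, div_le_iff₀ hN0]
    refine le_trans ?_ (sum_th_le N)
    rw [hu, expSum_cut_eq th haN', sub_eq_iff_eq_add'.2 (Finset.sum_Ioc_consecutive _ (Nat.zero_le a) haN').symm]
    refine (norm_sum_le _ _).trans ?_
    refine (Finset.sum_le_sum fun n _ ↦ (?_ : _ ≤ th n)).trans
      (Finset.sum_le_sum_of_subset_of_nonneg (Finset.Ioc_subset_Ioc_left (Nat.zero_le a)) fun n _ _ ↦ th_nonneg n)
    rw [norm_th_mul_ee]
  have hfg : ∀ i ∈ Finset.range (3 * N), ‖f i - g i‖ ≤ η := by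
    intro i _
    simp only [hf, hg]
    rw [← sub_div, norm_div, Complex.norm_natCast, div_le_iff₀ hN0, hu, hw, expSum_cut_eq th haN',
      expSum_cut_eq (wt D) haN']
    set x := (i : ℝ) / (3 * N : ℕ)
    have k1 := hN1 N hNN1 x
    have k2 := hN1 a haN1 x
    have k3 : (a : ℝ) ≤ N := by exact_mod_cast haN'
    calc _ = ‖(thSum N x - wtSum D N x) - (thSum a x - wtSum D a x)‖ := by
          congr 1; simp only [thSum, wtSum]; ring
      _ ≤ η / 2 * N + η / 2 * a := (norm_sub_le _ _).trans (add_le_add k1 k2)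
      _ ≤ η / 2 * N + η / 2 * N := by gcongr
      _ = η * N := by ring
  have hsum := hcube ℕ (Finset.range (3 * N)) f g hfc hgc hf6 hfg
  have hdft : ((3 * N * (tern u N - tern w N) : ℝ) : ℂ) =
      N ^ 3 * ∑ m ∈ Finset.range (3 * N), (f m ^ 3 - g m ^ 3) * ee (-(N * ((m : ℝ) / (3 * N : ℕ)))) := by
    have e1 := sum_expSum_cube u (by omega : 0 < N)
    have e2 := sum_expSum_cube w (by omega : 0 < N)
    rw [mul_sub, Complex.ofReal_sub, ← e1, ← e2, ← Finset.sum_sub_distrib, Finset.mul_sum]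
    refine Finset.sum_congr rfl fun m _ ↦ ?_
    have hN0' : (N : ℂ) ≠ 0 := by exact_mod_cast hN0.ne'
    simp only [hf, hg]
    field_simp
  have hnorm2 : 3 * N * |tern u N - tern w N| ≤ N ^ 3 * (3 * σ) := by
    have h3 := congrArg norm hdft
    rw [Complex.norm_real, Real.norm_eq_abs, abs_mul, abs_of_pos (by positivity : (0 : ℝ) < 3 * N), norm_mul,
      norm_pow, Complex.norm_natCast] at h3
    rw [h3]
    gcongr
    refine (norm_sum_le _ _).trans (le_trans (Finset.sum_le_sum fun m _ ↦ ?_) hsum)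
    rw [norm_mul, norm_ee, mul_one]
  have : (3 * N) * |tern u N - tern w N| ≤ (3 * N) * (σ * N ^ 2) := by linarith [hnorm2]
  exact le_of_mul_le_mul_left this (by positivity)

open Classical in
/-- The indicator function of the units. -/
noncomputable def unitInd {R : Type*} [CommRing R] (x : R) : ℝ := if IsUnit x then 1 else 0

lemma unitInd_nonneg {R : Type*} [CommRing R] (x : R) : 0 ≤ unitInd x := by
  rw [unitInd]; split_ifs <;> norm_num

/-- The number of representations of `t` as a sum of three units. -/
noncomputable def unitTern (R : Type*) [CommRing R] [Fintype R] (t : R) : ℝ :=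
  ∑ x : R, ∑ y : R, unitInd x * unitInd y * unitInd (t - x - y)

lemma unitInd_map {R R' : Type*} [CommRing R] [CommRing R'] (e : R ≃+* R') (x : R) :
    unitInd (e x) = unitInd x := by
  by_cases hx : IsUnit x <;> simp [unitInd, hx]

lemma unitTern_map {R R' : Type*} [CommRing R] [CommRing R'] [Fintype R] [Fintype R'] (e : R ≃+* R')
    (t : R) : unitTern R' (e t) = unitTern R t := by
  rw [unitTern, unitTern, ← e.toEquiv.sum_comp]
  refine Finset.sum_congr rfl fun x _ ↦ ?_
  rw [← e.toEquiv.sum_comp]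
  refine Finset.sum_congr rfl fun y _ ↦ ?_
  simp only [RingEquiv.toEquiv_eq_coe, EquivLike.coe_coe, ← map_sub, unitInd_map]

lemma unitInd_prod {A B : Type*} [CommRing A] [CommRing B] (x : A × B) :
    unitInd x = unitInd x.1 * unitInd x.2 := by
  by_cases h1 : IsUnit x.1 <;> by_cases h2 : IsUnit x.2 <;> simp [unitInd, Prod.isUnit_iff, h1, h2]

lemma unitTern_prod {A B : Type*} [CommRing A] [CommRing B] [Fintype A] [Fintype B] (t : A × B) :
    unitTern (A × B) t = unitTern A t.1 * unitTern B t.2 := by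
  simp only [unitTern, Fintype.sum_prod_type, Finset.sum_mul_sum, unitInd_prod]
  refine Finset.sum_congr rfl fun x _ ↦ Finset.sum_congr rfl fun x' _ ↦
    Finset.sum_congr rfl fun y _ ↦ Finset.sum_congr rfl fun y' _ ↦ ?_
  simp only [Prod.fst_sub, Prod.snd_sub]
  ring

lemma unitTern_coprime {m n : ℕ} [NeZero m] [NeZero n] (h : m.Coprime n) (t : ℕ) :
    unitTern (ZMod (m * n)) t = unitTern (ZMod m) t * unitTern (ZMod n) t := by
  rw [← unitTern_map (ZMod.chineseRemainder h), unitTern_prod]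
  simp

lemma unitTern_prime_ge (p : ℕ) [Fact p.Prime] (t : ZMod p) :
    ((p : ℝ) - 1) * (p - 2) ≤ unitTern (ZMod p) t := by
  have h1 : ∀ x : ZMod p, unitInd x = 1 - if x = 0 then 1 else 0 := by
    intro x
    simp only [unitInd, isUnit_iff_ne_zero]
    split_ifs <;> simp_all
  have h2 : ∑ x : ZMod p, unitInd x = p - 1 := by
    simp [h1]
  have h3 : ∀ x : ZMod p, (p : ℝ) - 2 ≤ ∑ y : ZMod p, unitInd y * unitInd (t - x - y) := by
    intro x
    calc (p : ℝ) - 2 = ∑ y : ZMod p, ((1 : ℝ) - (if y = 0 then 1 else 0) - (if y = t - x then 1 else 0)) := by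
          simp; ring
      _ ≤ _ := by
          refine Finset.sum_le_sum fun y _ ↦ ?_
          have e : t - x - y = 0 ↔ y = t - x := by rw [sub_eq_zero, eq_comm]
          rw [h1, h1]
          simp only [e]
          split_ifs <;> norm_num
  calc _ = ∑ x : ZMod p, unitInd x * ((p : ℝ) - 2) := by rw [← Finset.sum_mul, h2]
    _ ≤ ∑ x : ZMod p, unitInd x * ∑ y : ZMod p, unitInd y * unitInd (t - x - y) :=
        Finset.sum_le_sum fun x _ ↦ mul_le_mul_of_nonneg_left (h3 x) (unitInd_nonneg x)
    _ = _ := by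
        rw [unitTern]
        refine Finset.sum_congr rfl fun x _ ↦ ?_
        rw [Finset.mul_sum]
        exact Finset.sum_congr rfl fun y _ ↦ by ring

lemma one_le_unitTern_two {N : ℕ} (hN : Odd N) : 1 ≤ unitTern (ZMod 2) N := by
  have hN' : (N : ZMod 2) = 1 := by
    obtain ⟨k, rfl⟩ := hN
    push_cast
    rw [show (2 : ZMod 2) = 0 from rfl, zero_mul, zero_add]
  rw [hN', unitTern]
  have hnn : ∀ x y : ZMod 2, 0 ≤ unitInd x * unitInd y * unitInd (1 - x - y) := fun x y ↦
    mul_nonneg (mul_nonneg (unitInd_nonneg _) (unitInd_nonneg _)) (unitInd_nonneg _)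
  have h1 : (1 : ℝ) = unitInd (1 : ZMod 2) * unitInd (1 : ZMod 2) * unitInd (1 - 1 - 1 : ZMod 2) := by
    rw [show (1 - 1 - 1 : ZMod 2) = 1 from rfl]
    simp [unitInd]
  refine h1.le.trans ((Finset.single_le_sum (f := fun y ↦ unitInd (1 : ZMod 2) * unitInd y * unitInd (1 - 1 - y))
    (fun y _ ↦ hnn 1 y) (Finset.mem_univ 1)).trans ?_)
  exact Finset.single_le_sum (f := fun x ↦ ∑ y : ZMod 2, unitInd x * unitInd y * unitInd (1 - x - y))
    (fun x _ ↦ Finset.sum_nonneg fun y _ ↦ hnn x y) (Finset.mem_univ 1)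

lemma unitTern_primorial_ge {N : ℕ} (hN : Odd N) (Q : ℕ) (hQ : 2 ≤ Q) :
    ∀ (D : ℕ) [NeZero D], D = primorial Q → (Q : ℝ) / (Q - 1) * (D : ℝ) ^ 2 ≤
      ((D : ℝ) / D.totient) ^ 3 * unitTern (ZMod D) N := by
  induction Q, hQ using Nat.le_induction with
  | base =>
    intro D _ hD
    rw [primorial_two] at hD
    subst hD
    have h1 := one_le_unitTern_two hN
    have e : ((2 : ℕ) : ℝ) / ((2 : ℕ) - 1) * ((2 : ℕ) : ℝ) ^ 2 = 8 := by norm_num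
    have e' : (((2 : ℕ) : ℝ) / (Nat.totient 2 : ℕ)) ^ 3 = 8 := by rw [Nat.totient_two]; norm_num
    rw [e, e']
    convert (by linarith : (8 : ℝ) ≤ 8 * unitTern (ZMod 2) N)
  | succ Q hQ ih =>
    intro D _ hD
    have hQ' : (2 : ℝ) ≤ Q := by exact_mod_cast hQ
    have hQ1 : (0 : ℝ) < Q - 1 := by linarith
    rw [primorial_eq_prod_primesLE, Nat.primesLE_succ] at hD
    by_cases hp : (Q + 1).Prime
    · rw [if_pos hp, Finset.prod_insert (Nat.notMem_primesLE Q), ← primorial_eq_prod_primesLE] at hD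
      have hne : NeZero (primorial Q) := ⟨(primorial_pos Q).ne'⟩
      have ih := ih (primorial Q) rfl
      have hcop : (Q + 1).Coprime (primorial Q) :=
        hp.coprime_iff_not_dvd.2 fun h ↦ by have := hp.dvd_primorial_iff.1 h; omega
      have hfact : Fact (Q + 1).Prime := ⟨hp⟩
      have hpr := unitTern_prime_ge (Q + 1) (N : ZMod (Q + 1))
      set E := primorial Q
      have hE : (0 : ℝ) < E := by exact_mod_cast primorial_pos Q
      have hφ : (0 : ℝ) < E.totient := by exact_mod_cast Nat.totient_pos.2 (primorial_pos Q)
      subst hD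
      have key : unitTern (ZMod ((Q + 1) * E)) N = unitTern (ZMod (Q + 1)) N * unitTern (ZMod E) N := by
        convert unitTern_coprime hcop N
      rw [key, Nat.totient_mul hcop, Nat.totient_prime hp, Nat.add_sub_cancel]
      push_cast at hpr ⊢
      have hQ0 : (0 : ℝ) < Q := by linarith
      have hpr' : (Q : ℝ) * (Q - 1) ≤ unitTern (ZMod (Q + 1)) N := by
        refine le_trans (le_of_eq (by ring)) hpr
      calc ((Q : ℝ) + 1) / (Q + 1 - 1) * ((Q + 1) * E) ^ 2 =
            ((Q + 1) / Q) ^ 3 * (Q * (Q - 1)) * (Q / (Q - 1) * E ^ 2) := by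
            rw [add_sub_cancel_right]; field_simp
        _ ≤ ((Q + 1) / Q) ^ 3 * unitTern (ZMod (Q + 1)) N * ((E / E.totient) ^ 3 * unitTern (ZMod E) N) := by
            have : 0 ≤ (Q : ℝ) * (Q - 1) := by positivity
            have h0 : 0 ≤ unitTern (ZMod (Q + 1)) N := this.trans hpr'
            gcongr
        _ = _ := by field_simp
    · rw [if_neg hp, ← primorial_eq_prod_primesLE] at hD
      refine le_trans ?_ (ih D hD)
      refine mul_le_mul_of_nonneg_right ?_ (by positivity)
      rw [div_le_div_iff₀ (by push_cast; linarith) hQ1]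
      push_cast
      nlinarith

lemma sum_Ioc_natCast (D : ℕ) [NeZero D] (f : ZMod D → ℝ) (a : ℕ) :
    ∑ n ∈ Finset.Ioc a (a + D), f n = ∑ x : ZMod D, f x := by
  have hinj : Set.InjOn (fun n : ℕ ↦ (n : ZMod D)) (Finset.Ioc a (a + D)) := by
    intro m hm n hn h
    simp only [Finset.coe_Ioc, Set.mem_Ioc] at hm hn
    have h := (ZMod.natCast_eq_natCast_iff m n D).1 h
    rcases le_total m n with hmn | hmn
    · have := Nat.eq_zero_of_dvd_of_lt ((Nat.modEq_iff_dvd' hmn).1 h) (by omega)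
      omega
    · have := Nat.eq_zero_of_dvd_of_lt ((Nat.modEq_iff_dvd' hmn).1 h.symm) (by omega)
      omega
  have himg : (Finset.Ioc a (a + D)).image (fun n : ℕ ↦ (n : ZMod D)) = Finset.univ := by
    rw [← Finset.card_eq_iff_eq_univ, Finset.card_image_of_injOn hinj, Nat.card_Ioc, ZMod.card]
    omega
  rw [← himg, Finset.sum_image hinj]

lemma sum_Ioc_mul_natCast (D : ℕ) [NeZero D] (f : ZMod D → ℝ) (a H : ℕ) :
    ∑ n ∈ Finset.Ioc a (a + D * H), f n = H * ∑ x : ZMod D, f x := by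
  induction H with
  | zero => simp
  | succ H ih =>
    rw [← Finset.sum_Ioc_consecutive _ (Nat.le_add_right a (D * H)) (by rw [Nat.mul_succ]; omega), ih,
      show a + D * (H + 1) = (a + D * H) + D by ring, sum_Ioc_natCast]
    push_cast; ring

lemma wt_eq_unitInd (D n : ℕ) : wt D n = (D : ℝ) / D.totient * unitInd (n : ZMod D) := by
  simp only [wt, unitInd, ZMod.isUnit_iff_coprime]
  split_ifs <;> simp

lemma tern_wt_ge {N Q a H : ℕ} (hN : Odd N) (hQ : 2 ≤ Q) (h : 3 * a + 2 * (primorial Q * H) < N) :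
    ((primorial Q * H : ℕ) : ℝ) ^ 2 ≤ tern (fun n ↦ if a < n then wt (primorial Q) n else 0) N := by
  have hne : NeZero (primorial Q) := ⟨(primorial_pos Q).ne'⟩
  have hmain := unitTern_primorial_ge hN Q hQ (primorial Q) rfl
  set D := primorial Q
  set w : ℕ → ℝ := fun n ↦ if a < n then wt D n else 0 with hw
  have hw0 : ∀ n, 0 ≤ w n := by
    intro n; simp only [hw]; split_ifs
    · exact wt_nonneg D n
    · exact le_rfl
  have hterm : ∀ x y z : ℕ, 0 ≤ if x + y + z = N then w x * w y * w z else 0 := by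
    intro x y z
    split_ifs
    · exact mul_nonneg (mul_nonneg (hw0 _) (hw0 _)) (hw0 _)
    · exact le_rfl
  set J := Finset.Ioc a (a + D * H) with hJ
  have hJN : J ⊆ Finset.range (N + 1) := by
    intro n hn
    rw [hJ, Finset.mem_Ioc] at hn
    rw [Finset.mem_range]; omega
  set ρ := (D : ℝ) / D.totient with hρ
  have hQ' : (2 : ℝ) ≤ Q := by exact_mod_cast hQ
  have h1 : (1 : ℝ) ≤ Q / (Q - 1) := by
    rw [le_div_iff₀ (by linarith)]; linarith
  calc ((D * H : ℕ) : ℝ) ^ 2 = 1 * (D : ℝ) ^ 2 * H ^ 2 := by push_cast; ring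
    _ ≤ (ρ ^ 3 * unitTern (ZMod D) N) * H ^ 2 := by
        refine mul_le_mul_of_nonneg_right (le_trans ?_ hmain) (by positivity)
        gcongr
    _ = ∑ x ∈ J, ∑ y ∈ J, ρ ^ 3 * (unitInd (x : ZMod D) * unitInd (y : ZMod D) *
          unitInd ((N : ZMod D) - x - y)) := by
        have e1 : ∀ x : ZMod D, ∑ y ∈ J, ρ ^ 3 * (unitInd x * unitInd (y : ZMod D) *
          unitInd ((N : ZMod D) - x - y)) = H * ∑ y : ZMod D, ρ ^ 3 * (unitInd x * unitInd y * unitInd (N - x - y)) :=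
          fun x ↦ sum_Ioc_mul_natCast D (fun y ↦ ρ ^ 3 * (unitInd x * unitInd y * unitInd (N - x - y))) a H
        simp only [e1]
        rw [sum_Ioc_mul_natCast D (fun x ↦ H * ∑ y : ZMod D, ρ ^ 3 * (unitInd x * unitInd y * unitInd (N - x - y))) a H,
          unitTern]
        simp only [← Finset.mul_sum]
        ring
    _ ≤ ∑ x ∈ J, ∑ y ∈ J, ∑ z ∈ Finset.range (N + 1), if x + y + z = N then w x * w y * w z else 0 := by
        refine Finset.sum_le_sum fun x hx ↦ Finset.sum_le_sum fun y hy ↦ ?_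
        rw [hJ, Finset.mem_Ioc] at hx hy
        refine le_trans (le_of_eq ?_) (Finset.single_le_sum (fun z _ ↦ hterm x y z)
          (Finset.mem_range.2 (by omega : N - x - y < N + 1)))
        rw [if_pos (by omega)]
        simp only [hw]
        rw [if_pos hx.1, if_pos hy.1, if_pos (by omega), wt_eq_unitInd, wt_eq_unitInd, wt_eq_unitInd,
          Nat.cast_sub (by omega), Nat.cast_sub (by omega)]
        ring
    _ ≤ ∑ x ∈ J, ∑ y ∈ Finset.range (N + 1), ∑ z ∈ Finset.range (N + 1),
          if x + y + z = N then w x * w y * w z else 0 :=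
        Finset.sum_le_sum fun x _ ↦ Finset.sum_le_sum_of_subset_of_nonneg hJN
          fun y _ _ ↦ Finset.sum_nonneg fun z _ ↦ hterm x y z
    _ ≤ _ := Finset.sum_le_sum_of_subset_of_nonneg hJN
          fun x _ _ ↦ Finset.sum_nonneg fun y _ ↦ Finset.sum_nonneg fun z _ ↦ hterm x y z

/-- Every large odd `N` is a sum of three primes, none much smaller than `N / 3`. -/
lemma exists_three_primes {δ : ℝ} (hδ : 0 < δ) (hδ1 : δ ≤ 1 / 2) : ∃ N0 : ℕ, ∀ N ≥ N0, Odd N →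
    ∃ p q r : ℕ, p.Prime ∧ q.Prime ∧ r.Prime ∧ p + q + r = N ∧ (1 - δ) / 3 * N < p ∧
      (1 - δ) / 3 * N < q ∧ (1 - δ) / 3 * N < r := by
  set c := (1 - δ) / 3 with hc
  have hc0 : 0 < c := by rw [hc]; linarith
  obtain ⟨Q, hQ, N1, hN1⟩ := exists_tern_sub_le (σ := δ ^ 2 / 72) (c := c / 2) (by positivity) (by positivity)
  set D := primorial Q with hD
  have hD0 : (0 : ℝ) < D := by exact_mod_cast primorial_pos Q
  refine ⟨max 1 (max N1 (max ⌈2 / c⌉₊ ⌈6 * D / δ⌉₊)), fun N hN hodd ↦ ?_⟩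
  simp only [ge_iff_le, max_le_iff] at hN
  obtain ⟨hN0, hNN1, hNc, hND⟩ := hN
  have hN' : (0 : ℝ) < N := by exact_mod_cast hN0
  have hNc' : 2 ≤ c * N := by
    have h := (Nat.le_ceil (2 / c)).trans (by exact_mod_cast hNc : ((⌈2 / c⌉₊ : ℕ) : ℝ) ≤ N)
    rw [div_le_iff₀ hc0] at h
    linarith
  have hND' : 6 * D ≤ δ * N := by
    have h := (Nat.le_ceil (6 * D / δ)).trans (by exact_mod_cast hND : ((⌈6 * D / δ⌉₊ : ℕ) : ℝ) ≤ N)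
    rw [div_le_iff₀ hδ] at h
    linarith
  set a := ⌊c * N⌋₊ with ha
  set H := ⌊δ * N / (3 * D)⌋₊ with hH
  have ha1 : (a : ℝ) ≤ c * N := Nat.floor_le (by positivity)
  have ha2 : c * N < a + 1 := Nat.lt_floor_add_one _
  have hH1 : (H : ℝ) ≤ δ * N / (3 * D) := Nat.floor_le (by positivity)
  have hH2 : δ * N / (3 * D) < H + 1 := Nat.lt_floor_add_one _
  rw [le_div_iff₀ (by positivity)] at hH1
  rw [div_lt_iff₀ (by positivity)] at hH2
  have hca : c * N = (1 - δ) / 3 * N := rfl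
  have hδN : 0 < δ * N := by positivity
  have hlow := tern_wt_ge (N := N) (Q := Q) (a := a) (H := H) hodd hQ (by
    have : (3 : ℝ) * a + 2 * (D * H) < N := by linarith
    exact_mod_cast this)
  have haN : a ≤ N := by
    have : (a : ℝ) ≤ N := by linarith
    exact_mod_cast this
  have happ := hN1 N hNN1 a (by linarith) haN
  have hDH : δ / 6 * N ≤ ((D * H : ℕ) : ℝ) := by push_cast; linarith
  have hpos : 0 < tern (fun n ↦ if a < n then th n else 0) N := by
    have h1 : (δ / 6 * N) ^ 2 ≤ ((D * H : ℕ) : ℝ) ^ 2 := by gcongr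
    have h2 := (abs_le.1 happ).1
    have h3 : 0 < δ ^ 2 * (N : ℝ) ^ 2 := by positivity
    have h4 : (δ / 6 * N) ^ 2 = δ ^ 2 * (N : ℝ) ^ 2 / 36 := by ring
    have h5 : δ ^ 2 / 72 * (N : ℝ) ^ 2 = δ ^ 2 * (N : ℝ) ^ 2 / 72 := by ring
    linarith
  obtain ⟨p, -, h1⟩ := Finset.exists_ne_zero_of_sum_ne_zero hpos.ne'
  obtain ⟨q, -, h2⟩ := Finset.exists_ne_zero_of_sum_ne_zero h1
  obtain ⟨r, -, h3⟩ := Finset.exists_ne_zero_of_sum_ne_zero h2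
  obtain ⟨hsum, h4⟩ := ite_ne_right_iff.1 h3
  have key : ∀ n : ℕ, (if a < n then th n else 0) ≠ 0 → n.Prime ∧ c * N < n := by
    intro n hn
    obtain ⟨h5, h6⟩ := ite_ne_right_iff.1 hn
    refine ⟨?_, ?_⟩
    · by_contra hp
      exact h6 (if_neg hp)
    · have : (a : ℝ) + 1 ≤ n := by exact_mod_cast h5
      linarith
  have hp := key p (left_ne_zero_of_mul (left_ne_zero_of_mul h4))
  have hq := key q (right_ne_zero_of_mul (left_ne_zero_of_mul h4))
  have hr := key r (right_ne_zero_of_mul h4)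
  exact ⟨p, q, r, hp.1, hq.1, hr.1, hsum, hp.2, hq.2, hr.2⟩

end Ternary

theorem odd_large_mem_S_succ (ε : ℝ) (hε : 0 < ε) :
    ∃ n₀ : ℕ, ∀ n ≥ n₀, ∀ N : ℕ, Odd N → (3 + ε) * (nthPrime n : ℝ) ≤ (N : ℝ) →
      N ∈ S (n + 1) := by
  obtain ⟨δ, hδ, hδ1, hδε⟩ : ∃ δ > 0, δ ≤ 1 / 2 ∧ 1 ≤ (1 - δ) / 3 * (3 + ε) := by
    refine ⟨min (1 / 2) (ε / (3 + ε)), by positivity, min_le_left _ _, ?_⟩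
    have h1 : min (1 / 2) (ε / (3 + ε)) ≤ ε / (3 + ε) := min_le_right _ _
    rw [le_div_iff₀ (by positivity)] at h1
    linarith
  obtain ⟨N0, hN0⟩ := Ternary.exists_three_primes hδ hδ1
  refine ⟨N0 + 1, fun n hn N hodd hN ↦ ?_⟩
  have hn1 : n - 1 ≤ nthPrime n := Nat.le_nth fun hf ↦ absurd hf Nat.infinite_setOfPred_prime
  have hNn : nthPrime n ≤ N := by
    have h0 : (0 : ℝ) ≤ nthPrime n := Nat.cast_nonneg _
    have h1 : (nthPrime n : ℝ) ≤ N := by nlinarith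
    exact_mod_cast h1
  obtain ⟨p, q, r, hp, hq, hr, hsum, hpN, hqN, hrN⟩ := hN0 N (by omega) hodd
  have hlt : ∀ m : ℕ, (1 - δ) / 3 * N < m → nthPrime n < m := by
    intro m hm
    have h0 : (0 : ℝ) ≤ nthPrime n := Nat.cast_nonneg _
    have h1 : (1 - δ) / 3 * ((3 + ε) * nthPrime n) ≤ (1 - δ) / 3 * N :=
      mul_le_mul_of_nonneg_left hN (by linarith)
    have h2 : 1 * (nthPrime n : ℝ) ≤ (1 - δ) / 3 * (3 + ε) * nthPrime n :=
      mul_le_mul_of_nonneg_right hδε h0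
    have h3 : (nthPrime n : ℝ) < m := by linarith
    exact_mod_cast h3
  have hmem : ∀ m : ℕ, m.Prime → (1 - δ) / 3 * N < m → m ∈ S (n + 1) := by
    intro m hm hmN
    refine AddSubmonoid.subset_closure ⟨hm, ?_⟩
    have h1 := hlt m hmN
    rw [nthPrime, Nat.add_sub_cancel]
    rw [nthPrime, ← Nat.nth_count hm, Nat.nth_lt_nth Nat.infinite_setOfPred_prime] at h1
    rw [← Nat.nth_count hm, Nat.nth_le_nth Nat.infinite_setOfPred_prime]
    omega
  rw [← hsum]
  exact add_mem (add_mem (hmem p hp hpN) (hmem q hq hqN)) (hmem r hr hrN)
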